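/- arXiv:1812.06063 — 2 statements merged into one kernel-verified Lean document; each statement's English description precedes it below -/
import Mathlib

section
/- Let f(n,k) = sqrt(k/n) if 2 ≤ k < 2 n^{1/3}; f(n,k) = (log₂(k/n^{1/3})/n)^{1/3} if 2 n^{1/3} ≤ k < n^{1/3} 2^n; and f(n,k) = 1 if k ≥ n^{1/3} 2^n. There exists a universal constant C ≥ 1 such that for all sufficiently large n (with threshold not depending on k) and all integers k ≥ 2, one has f(n,k)/C ≤ R_n(F_k) ≤ C · f(n,k). -/
open Finset

/-- The class `F_k` of non-increasing probability densities on `{1, …, k}`,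
represented as functions `ℕ → ℝ` vanishing outside of `{1, …, k}`. -/
def Fk (k : ℕ) : Set (ℕ → ℝ) :=
  {f | (∀ x, 0 ≤ f x) ∧ (∀ x, x ∉ Finset.Icc 1 k → f x = 0) ∧
    (∑ x ∈ Finset.Icc 1 k, f x = 1) ∧
    (∀ x, 1 ≤ x → x + 1 ≤ k → f (x + 1) ≤ f x)}

/-- Total variation distance between two functions on `{1, …, k}`:
`TV(g, f) = (1/2) ∑_{x=1}^{k} |g x - f x|`. -/
noncomputable def TVk (k : ℕ) (g f : ℕ → ℝ) : ℝ :=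
  (∑ x ∈ Finset.Icc 1 k, |g x - f x|) / 2

/-- The risk of the density estimate `φ` (a map taking the `n` sample points to a
function on `{1, …, k}`) over the class `F`: the worst-case, over `f ∈ F`, expected
total variation distance between the estimate and `f`, the expectation being over
`n` i.i.d. samples drawn from the density `f`. -/
noncomputable def risk (n k : ℕ) (φ : (Fin n → ℕ) → ℕ → ℝ) (F : Set (ℕ → ℝ)) : ℝ :=
  ⨆ f ∈ F, ∑ x ∈ Fintype.piFinset (fun _ : Fin n => Finset.Icc 1 k),
    (∏ i, f (x i)) * TVk k (φ x) f

/-- The minimax risk `R_n(F)`: the infimum of the risk over all density estimates. -/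
noncomputable def minimaxRisk (n k : ℕ) (F : Set (ℕ → ℝ)) : ℝ :=
  ⨅ φ : (Fin n → ℕ) → ℕ → ℝ, risk n k φ F

open scoped Classical in
/-- The rate function `f(n,k)` of Theorem 2.1: `√(k/n)` for `2 ≤ k < 2 n^{1/3}`,
`(log₂(k / n^{1/3}) / n)^{1/3}` for `2 n^{1/3} ≤ k < n^{1/3} 2^n`, and `1` for
`k ≥ n^{1/3} 2^n`. -/
noncomputable def rateF (n k : ℕ) : ℝ :=
  if (k : ℝ) < 2 * (n : ℝ) ^ ((1 : ℝ) / 3) then Real.sqrt ((k : ℝ) / n)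
  else if (k : ℝ) < (n : ℝ) ^ ((1 : ℝ) / 3) * 2 ^ n then
    (Real.logb 2 ((k : ℝ) / (n : ℝ) ^ ((1 : ℝ) / 3)) / n) ^ ((1 : ℝ) / 3)
  else 1

namespace MR

/-- Expected loss of the estimate at `f`. -/
noncomputable def loss (n k : ℕ) (φ : (Fin n → ℕ) → ℕ → ℝ) (f : ℕ → ℝ) : ℝ :=
  ∑ x ∈ Fintype.piFinset (fun _ : Fin n => Finset.Icc 1 k), (∏ i, f (x i)) * TVk k (φ x) f

lemma TVk_nonneg (k : ℕ) (g f : ℕ → ℝ) : 0 ≤ TVk k g f := by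
  unfold TVk; positivity

lemma Fk_le_one {k : ℕ} {f : ℕ → ℝ} (hf : f ∈ Fk k) (x : ℕ) : f x ≤ 1 := by
  obtain ⟨h0, h1, h2, h3⟩ := hf
  by_cases hx : x ∈ Finset.Icc 1 k
  · rw [← h2]; exact Finset.single_le_sum (fun i _ => h0 i) hx
  · rw [h1 x hx]; norm_num

lemma loss_nonneg {n k : ℕ} (φ : (Fin n → ℕ) → ℕ → ℝ) {f : ℕ → ℝ} (hf : f ∈ Fk k) :
    0 ≤ loss n k φ f := by
  apply Finset.sum_nonneg
  intro x _
  exact mul_nonneg (Finset.prod_nonneg fun i _ => hf.1 _) (TVk_nonneg _ _ _)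

lemma loss_le_bound {n k : ℕ} (φ : (Fin n → ℕ) → ℕ → ℝ) {f : ℕ → ℝ} (hf : f ∈ Fk k) :
    loss n k φ f ≤ ∑ x ∈ Fintype.piFinset (fun _ : Fin n => Finset.Icc 1 k),
      (∑ y ∈ Finset.Icc 1 k, (|φ x y| + 1)) / 2 := by
  apply Finset.sum_le_sum
  intro x _
  have h1 : ∏ i, f (x i) ≤ 1 := Finset.prod_le_one (fun i _ => hf.1 _) (fun i _ => Fk_le_one hf _)
  have h2 : TVk k (φ x) f ≤ (∑ y ∈ Finset.Icc 1 k, (|φ x y| + 1)) / 2 := by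
    unfold TVk
    gcongr with y hy
    have := Fk_le_one hf y
    have h0 := hf.1 y
    calc |φ x y - f y| ≤ |φ x y| + |f y| := abs_sub _ _
      _ ≤ _ := by rw [abs_of_nonneg h0]; linarith
  calc _ ≤ 1 * TVk k (φ x) f := by gcongr; exact TVk_nonneg _ _ _
    _ ≤ _ := by rw [one_mul]; exact h2

lemma loss_le_risk {n k : ℕ} (φ : (Fin n → ℕ) → ℕ → ℝ) {f : ℕ → ℝ} (hf : f ∈ Fk k) :
    loss n k φ f ≤ risk n k φ (Fk k) := by
  unfold risk
  have hb : BddAbove (Set.range fun f : ℕ → ℝ => ⨆ _ : f ∈ Fk k, loss n k φ f) := by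
    refine ⟨∑ x ∈ Fintype.piFinset (fun _ : Fin n => Finset.Icc 1 k),
      (∑ y ∈ Finset.Icc 1 k, (|φ x y| + 1)) / 2, ?_⟩
    rintro _ ⟨g, rfl⟩
    apply Real.iSup_le
    · intro hg; exact loss_le_bound φ hg
    · positivity
  have := le_ciSup hb f
  refine le_trans ?_ this
  simp [hf]

lemma risk_le {n k : ℕ} (φ : (Fin n → ℕ) → ℕ → ℝ) {B : ℝ} (hB : 0 ≤ B)
    (h : ∀ f ∈ Fk k, loss n k φ f ≤ B) : risk n k φ (Fk k) ≤ B := by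
  unfold risk
  exact Real.iSup_le (fun f => Real.iSup_le (fun hf => h f hf) hB) hB

lemma risk_nonneg (n k : ℕ) (φ : (Fin n → ℕ) → ℕ → ℝ) : 0 ≤ risk n k φ (Fk k) := by
  unfold risk
  exact Real.iSup_nonneg fun f => Real.iSup_nonneg fun hf => loss_nonneg φ hf

lemma minimaxRisk_le {n k : ℕ} (φ : (Fin n → ℕ) → ℕ → ℝ) {B : ℝ} (hB : 0 ≤ B)
    (h : ∀ f ∈ Fk k, loss n k φ f ≤ B) : minimaxRisk n k (Fk k) ≤ B := by
  refine le_trans (ciInf_le ?_ φ) (risk_le φ hB h)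
  exact ⟨0, by rintro _ ⟨ψ, rfl⟩; exact risk_nonneg n k ψ⟩

/-- sum over the product space of a product -/
lemma sum_prod {n k : ℕ} (F : Fin n → ℕ → ℝ) :
    ∑ x ∈ Fintype.piFinset (fun _ : Fin n => Finset.Icc 1 k), ∏ i, F i (x i)
      = ∏ i, ∑ y ∈ Finset.Icc 1 k, F i y := by
  rw [Finset.prod_univ_sum]

lemma sum_prod_const {n k : ℕ} (f : ℕ → ℝ) :
    ∑ x ∈ Fintype.piFinset (fun _ : Fin n => Finset.Icc 1 k), ∏ i, f (x i)
      = (∑ y ∈ Finset.Icc 1 k, f y) ^ n := by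
  rw [sum_prod (fun _ => f)]; simp

/-- Le Cam: Hellinger affinity lower bounds the overlap. -/
lemma overlap {n k : ℕ} {f g : ℕ → ℝ} (hf : f ∈ Fk k) (hg : g ∈ Fk k) {u : ℝ}
    (hu : u ≤ 1)
    (h : 1 - u ≤ ∑ y ∈ Finset.Icc 1 k, √(f y * g y)) (hnu : 4 * n * u ≤ 1) :
    1 / 4 ≤ ∑ x ∈ Fintype.piFinset (fun _ : Fin n => Finset.Icc 1 k),
      min (∏ i, f (x i)) (∏ i, g (x i)) := by
  set A := Fintype.piFinset (fun _ : Fin n => Finset.Icc 1 k) with hA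
  set P : (Fin n → ℕ) → ℝ := fun x => ∏ i, f (x i)
  set Q : (Fin n → ℕ) → ℝ := fun x => ∏ i, g (x i)
  have hP : ∀ x, 0 ≤ P x := fun x => Finset.prod_nonneg fun i _ => hf.1 _
  have hQ : ∀ x, 0 ≤ Q x := fun x => Finset.prod_nonneg fun i _ => hg.1 _
  have hPs : ∑ x ∈ A, P x = 1 := by
    rw [hA, sum_prod_const, hf.2.2.1, one_pow]
  have hQs : ∑ x ∈ A, Q x = 1 := by
    rw [hA, sum_prod_const, hg.2.2.1, one_pow]
  have h1 : ∑ x ∈ A, √(P x * Q x) = (∑ y ∈ Finset.Icc 1 k, √(f y * g y)) ^ n := by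
    rw [← sum_prod_const]
    apply Finset.sum_congr rfl
    intro x _
    simp only [P, Q]
    rw [← Finset.prod_mul_distrib, Real.sqrt_prod]
    intro i _
    exact mul_nonneg (hf.1 _) (hg.1 _)
  have h2 : 3 / 4 ≤ ∑ x ∈ A, √(P x * Q x) := by
    rw [h1]
    calc (3 / 4 : ℝ) ≤ 1 + n * (-u) := by linarith
      _ ≤ (1 + -u) ^ n := one_add_mul_le_pow (by linarith) n
      _ ≤ _ := by gcongr <;> linarith
  have h3 : (∑ x ∈ A, √(P x * Q x)) ^ 2 ≤
      (∑ x ∈ A, min (P x) (Q x)) * (∑ x ∈ A, max (P x) (Q x)) := by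
    apply Finset.sum_sq_le_sum_mul_sum_of_sq_le_mul
    · intro x _; exact le_min (hP x) (hQ x)
    · intro x _; exact le_max_of_le_left (hP x)
    · intro x _
      rw [Real.sq_sqrt (mul_nonneg (hP x) (hQ x)), min_mul_max]
  have h4 : ∑ x ∈ A, max (P x) (Q x) ≤ 2 := by
    calc _ ≤ ∑ x ∈ A, (P x + Q x) := Finset.sum_le_sum fun x _ =>
          max_le (by linarith [hQ x]) (by linarith [hP x])
      _ = 2 := by rw [Finset.sum_add_distrib, hPs, hQs]; norm_num
  have h5 : 0 ≤ ∑ x ∈ A, min (P x) (Q x) :=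
    Finset.sum_nonneg fun x _ => le_min (hP x) (hQ x)
  have h6 : (9 / 16 : ℝ) ≤ (∑ x ∈ A, √(P x * Q x)) ^ 2 := by nlinarith
  show 1 / 4 ≤ ∑ x ∈ A, min (P x) (Q x)
  nlinarith

/-- The Assouad lemma. -/
lemma assouad {n k m : ℕ} (f : (Fin m → Bool) → ℕ → ℝ) (hf : ∀ ω, f ω ∈ Fk k)
    (π : ℕ → ℕ) {η u : ℝ} (hη : 0 ≤ η) (hu1 : u ≤ 1) (hnu : 4 * n * u ≤ 1)
    (hsep : ∀ (ω : Fin m → Bool) (j : Fin m),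
      η ≤ ∑ y ∈ (Finset.Icc 1 k).filter (fun y => π y = j),
        |f ω y - f (Function.update ω j (!ω j)) y|)
    (haff : ∀ (ω : Fin m → Bool) (j : Fin m),
      1 - u ≤ ∑ y ∈ Finset.Icc 1 k, √(f ω y * f (Function.update ω j (!ω j)) y)) :
    m * η / 16 ≤ minimaxRisk n k (Fk k) := by
  unfold minimaxRisk
  apply le_ciInf
  intro φ
  set R := risk n k φ (Fk k) with hR
  set A := Fintype.piFinset (fun _ : Fin n => Finset.Icc 1 k) with hA
  let P : (Fin m → Bool) → (Fin n → ℕ) → ℝ := fun ω x => ∏ i, f ω (x i)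
  have hP : ∀ ω x, 0 ≤ P ω x := fun ω x => Finset.prod_nonneg fun i _ => (hf ω).1 _
  let d : Fin m → (Fin m → Bool) → (Fin n → ℕ) → ℝ := fun j ω x =>
    ∑ y ∈ (Finset.Icc 1 k).filter (fun y => π y = j), |φ x y - f ω y|
  have hd : ∀ j ω x, 0 ≤ d j ω x := fun j ω x => Finset.sum_nonneg fun _ _ => abs_nonneg _
  let G : Fin m → (Fin m → Bool) → ℝ := fun j ω => ∑ x ∈ A, P ω x * d j ω x
  let fl : Fin m → (Fin m → Bool) → (Fin m → Bool) := fun j ω => Function.update ω j (!ω j)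
  have hinv : ∀ j, Function.Involutive (fl j) := by
    intro j ω
    simp [fl]
  -- loss decomposes
  have hloss : ∀ ω, (∑ j, G j ω) / 2 ≤ R := by
    intro ω
    refine le_trans ?_ (loss_le_risk φ (hf ω))
    unfold loss
    simp only [G]
    rw [Finset.sum_comm, Finset.sum_div]
    apply Finset.sum_le_sum
    intro x _
    rw [← Finset.mul_sum, mul_div_assoc]
    apply mul_le_mul_of_nonneg_left _ (hP ω x)
    unfold TVk
    gcongr
    simp only [d]
    rw [← Finset.sum_biUnion]
    · apply Finset.sum_le_sum_of_subset_of_nonneg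
      · intro y hy
        simp only [Finset.mem_biUnion, Finset.mem_filter] at hy
        obtain ⟨_, _, h, _⟩ := hy
        exact h
      · intros; exact abs_nonneg _
    · intro i _ j _ hij
      rw [Function.onFun, Finset.disjoint_left]
      intro y hy hy'
      simp only [Finset.mem_filter] at hy hy'
      exact hij (Fin.ext (hy.2.symm.trans hy'.2))
  have hpair : ∀ j ω, η / 4 ≤ G j ω + G j (fl j ω) := by
    intro j ω
    have ho := overlap (n := n) (hf ω) (hf (fl j ω)) hu1 (haff ω j) hnu
    calc η / 4 = (1 / 4) * η := by ring
      _ ≤ (∑ x ∈ A, min (P ω x) (P (fl j ω) x)) * η := by gcongr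
      _ = ∑ x ∈ A, min (P ω x) (P (fl j ω) x) * η := by rw [Finset.sum_mul]
      _ ≤ ∑ x ∈ A, (P ω x * d j ω x + P (fl j ω) x * d j (fl j ω) x) := by
          apply Finset.sum_le_sum
          intro x _
          have hs : η ≤ d j ω x + d j (fl j ω) x := by
            refine (hsep ω j).trans ?_
            simp only [d]
            rw [← Finset.sum_add_distrib]
            apply Finset.sum_le_sum
            intro y _
            have := abs_sub_le (f ω y) (φ x y) (f (fl j ω) y)
            rw [abs_sub_comm (f ω y) (φ x y)] at this
            exact this
          have m0 : 0 ≤ min (P ω x) (P (fl j ω) x) := le_min (hP _ _) (hP _ _)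
          calc _ ≤ min (P ω x) (P (fl j ω) x) * (d j ω x + d j (fl j ω) x) := by gcongr
            _ = min (P ω x) (P (fl j ω) x) * d j ω x
              + min (P ω x) (P (fl j ω) x) * d j (fl j ω) x := by ring
            _ ≤ _ := by
              exact add_le_add
                (mul_le_mul_of_nonneg_right (min_le_left _ _) (hd _ _ _))
                (mul_le_mul_of_nonneg_right (min_le_right _ _) (hd _ _ _))
      _ = _ := by rw [Finset.sum_add_distrib]
  have hsum : ∀ j, (Fintype.card (Fin m → Bool)) * (η / 8) ≤ ∑ ω, G j ω := by
    intro j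
    have e : ∑ ω, G j (fl j ω) = ∑ ω, G j ω :=
      Equiv.sum_comp (hinv j).toPerm (G j)
    have : ∑ _ω : Fin m → Bool, η / 4 ≤ ∑ ω, (G j ω + G j (fl j ω)) :=
      Finset.sum_le_sum fun ω _ => hpair j ω
    rw [Finset.sum_add_distrib, e, Finset.sum_const, nsmul_eq_mul, Finset.card_univ] at this
    linarith
  have htot : ∑ ω, (∑ j, G j ω) / 2 ≤ (Fintype.card (Fin m → Bool)) * R := by
    have : ∑ ω, (∑ j, G j ω) / 2 ≤ ∑ _ω : Fin m → Bool, R :=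
      Finset.sum_le_sum fun ω _ => hloss ω
    rwa [Finset.sum_const, nsmul_eq_mul, Finset.card_univ] at this
  rw [← Finset.sum_div, Finset.sum_comm] at htot
  have h2 : ∑ _j : Fin m, (Fintype.card (Fin m → Bool)) * (η / 8) ≤ ∑ j, ∑ ω, G j ω :=
    Finset.sum_le_sum fun j _ => hsum j
  rw [Finset.sum_const, nsmul_eq_mul, Finset.card_univ, Fintype.card_fin] at h2
  have hc : (0 : ℝ) < Fintype.card (Fin m → Bool) := by
    exact_mod_cast Fintype.card_pos
  have : (Fintype.card (Fin m → Bool) : ℝ) * (m * η / 16) ≤ Fintype.card (Fin m → Bool) * R := by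
    linarith
  exact le_of_mul_le_mul_left this hc

/-- index of the block `[S h, S (h+1))` containing `x`. -/
noncomputable def blk (S : ℕ → ℕ) (x : ℕ) : ℕ := sInf {h | x < S (h + 1)}

lemma blk_spec {S : ℕ → ℕ} (hS : StrictMono S) {x : ℕ} (hx : S 0 ≤ x) :
    S (blk S x) ≤ x ∧ x < S (blk S x + 1) := by
  have hne : {h | x < S (h + 1)}.Nonempty := ⟨x, lt_of_lt_of_le (Nat.lt_succ_self x) (hS.id_le _)⟩
  have h2 : x < S (blk S x + 1) := Nat.sInf_mem hne
  refine ⟨?_, h2⟩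
  rcases Nat.eq_zero_or_pos (blk S x) with h | h
  · rwa [h]
  · by_contra hc
    have h3 : blk S x - 1 ∈ {h | x < S (h + 1)} := by
      show x < S (blk S x - 1 + 1)
      rw [Nat.sub_add_cancel h]; omega
    have := Nat.sInf_le h3
    change blk S x ≤ _ at this
    omega

lemma blk_eq {S : ℕ → ℕ} (hS : StrictMono S) {x h : ℕ} (h1 : S h ≤ x) (h2 : x < S (h + 1)) :
    blk S x = h := by
  have h0 : S 0 ≤ x := (hS.monotone (Nat.zero_le h)).trans h1
  obtain ⟨h3, h4⟩ := blk_spec hS h0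
  have a : blk S x < h + 1 := hS.lt_iff_lt.1 (lt_of_le_of_lt h3 h2)
  have b : h < blk S x + 1 := hS.lt_iff_lt.1 (lt_of_le_of_lt h1 h4)
  omega

lemma blk_mono {S : ℕ → ℕ} (hS : StrictMono S) {x y : ℕ} (hx : S 0 ≤ x) (hxy : x ≤ y) :
    blk S x ≤ blk S y := by
  obtain ⟨h1, h2⟩ := blk_spec hS hx
  obtain ⟨h3, h4⟩ := blk_spec hS (hx.trans hxy)
  have := hS.lt_iff_lt.1 (lt_of_le_of_lt (h1.trans hxy) h4)
  omega

lemma sum_blocks {S : ℕ → ℕ} (hS : StrictMono S) (G : ℕ → ℝ) (M : ℕ) :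
    ∑ x ∈ Finset.Ico (S 0) (S M), G x
      = ∑ h ∈ Finset.range M, ∑ x ∈ Finset.Ico (S h) (S (h + 1)), G x := by
  induction M with
  | zero => simp
  | succ M ih =>
    rw [Finset.sum_range_succ, ← ih, Finset.sum_Ico_consecutive]
    · exact hS.monotone (Nat.zero_le _)
    · exact hS.monotone (Nat.le_succ _)

lemma sum_blocks_const {S : ℕ → ℕ} (hS : StrictMono S) (G : ℕ → ℝ) (M : ℕ) :
    ∑ x ∈ Finset.Ico (S 0) (S M), G (blk S x)
      = ∑ h ∈ Finset.range M, ((S (h + 1) : ℝ) - S h) * G h := by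
  rw [sum_blocks hS]
  apply Finset.sum_congr rfl
  intro h _
  rw [Finset.sum_congr rfl (g := fun _ => G h)]
  · rw [Finset.sum_const, Nat.card_Ico, nsmul_eq_mul, Nat.cast_sub (hS.monotone (Nat.le_succ _))]
  · intro x hx
    rw [Finset.mem_Ico] at hx
    rw [blk_eq hS hx.1 hx.2]

lemma Fk_step {k : ℕ} {f : ℕ → ℝ} (hf : f ∈ Fk k) {x : ℕ} (hx : 1 ≤ x) : f (x + 1) ≤ f x := by
  by_cases h : x + 1 ≤ k
  · exact hf.2.2.2 x hx h
  · rw [hf.2.1 (x + 1) (by simp; omega)]; exact hf.1 x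

lemma Fk_anti {k : ℕ} {f : ℕ → ℝ} (hf : f ∈ Fk k) {x y : ℕ} (hx : 1 ≤ x) (hxy : x ≤ y) :
    f y ≤ f x := by
  induction y, hxy using Nat.le_induction with
  | base => exact le_rfl
  | succ y hy ih => exact (Fk_step hf (hx.trans hy)).trans ih

/-- second moment of a centered sum. -/
lemma second_moment {n k : ℕ} {f : ℕ → ℝ} (hf : f ∈ Fk k) (g : ℕ → ℝ)
    (hg : ∑ y ∈ Finset.Icc 1 k, f y * g y = 0) :
    ∑ x ∈ Fintype.piFinset (fun _ : Fin n => Finset.Icc 1 k),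
      (∏ i, f (x i)) * (∑ i, g (x i)) ^ 2 = n * ∑ y ∈ Finset.Icc 1 k, f y * g y ^ 2 := by
  have h1 : ∀ x : Fin n → ℕ, (∏ i, f (x i)) * (∑ i, g (x i)) ^ 2
      = ∑ a, ∑ b, (∏ i, f (x i)) * (g (x a) * g (x b)) := by
    intro x
    rw [sq, Finset.sum_mul_sum, Finset.mul_sum]
    simp_rw [Finset.mul_sum]
  simp_rw [h1]
  rw [Finset.sum_comm]
  have key : ∀ a b : Fin n, ∑ x ∈ Fintype.piFinset (fun _ : Fin n => Finset.Icc 1 k),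
      (∏ i, f (x i)) * (g (x a) * g (x b))
      = if a = b then ∑ y ∈ Finset.Icc 1 k, f y * g y ^ 2 else 0 := by
    intro a b
    have e : ∀ x : Fin n → ℕ, (∏ i, f (x i)) * (g (x a) * g (x b))
      = ∏ i, (f (x i) * ((if i = a then g (x i) else 1) * (if i = b then g (x i) else 1))) := by
      intro x
      rw [Finset.prod_mul_distrib, Finset.prod_mul_distrib]
      simp
    simp_rw [e]
    rw [sum_prod (fun i y => f y * ((if i = a then g y else 1) * (if i = b then g y else 1)))]
    split_ifs with hab
    · subst hab
      rw [Finset.prod_eq_single a]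
      · simp [sq]
      · intro i _ hi
        simp [hi, hf.2.2.1]
      · simp
    · apply Finset.prod_eq_zero (Finset.mem_univ a)
      simp [hab, hg]
  have h2 : ∀ a : Fin n, ∑ x ∈ Fintype.piFinset (fun _ : Fin n => Finset.Icc 1 k),
      ∑ b, (∏ i, f (x i)) * (g (x a) * g (x b)) = ∑ y ∈ Finset.Icc 1 k, f y * g y ^ 2 := by
    intro a
    rw [Finset.sum_comm]
    simp_rw [key]
    simp
  simp_rw [h2]
  simp

/-- mean absolute deviation of the empirical frequency of a set. -/
lemma mad {n k : ℕ} (hn : 0 < n) {f : ℕ → ℝ} (hf : f ∈ Fk k) (B : ℕ → Prop) [DecidablePred B]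
    (p : ℝ) (hp : p = ∑ y ∈ Finset.Icc 1 k, if B y then f y else 0) :
    ∑ x ∈ Fintype.piFinset (fun _ : Fin n => Finset.Icc 1 k),
      (∏ i, f (x i)) * |(∑ i, if B (x i) then (1 : ℝ) else 0) / n - p| ≤ √(p / n) := by
  set A := Fintype.piFinset (fun _ : Fin n => Finset.Icc 1 k) with hA
  let g : ℕ → ℝ := fun y => (if B y then (1 : ℝ) else 0) - p
  have e1 : ∑ y ∈ Finset.Icc 1 k, f y * (if B y then (1 : ℝ) else 0) = p := by
    rw [hp]; apply Finset.sum_congr rfl; intro y _; split_ifs <;> simp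
  have hg : ∑ y ∈ Finset.Icc 1 k, f y * g y = 0 := by
    simp only [g, mul_sub]
    rw [Finset.sum_sub_distrib, e1, ← Finset.sum_mul, hf.2.2.1]; ring
  have hg2 : ∑ y ∈ Finset.Icc 1 k, f y * g y ^ 2 ≤ p := by
    have : ∀ y, f y * g y ^ 2 = (1 - 2 * p) * (f y * (if B y then (1 : ℝ) else 0)) + p ^ 2 * f y := by
      intro y; simp only [g]; split_ifs <;> ring
    simp_rw [this]
    rw [Finset.sum_add_distrib, ← Finset.mul_sum, ← Finset.mul_sum, e1, hf.2.2.1]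
    nlinarith [sq_nonneg p]
  have hn' : (0 : ℝ) < n := by exact_mod_cast hn
  have hZ : ∀ x : Fin n → ℕ, (∑ i, if B (x i) then (1 : ℝ) else 0) / n - p
      = (∑ i, g (x i)) / n := by
    intro x
    simp only [g]
    rw [Finset.sum_sub_distrib]
    simp
    field_simp
  have hP : ∀ x : Fin n → ℕ, 0 ≤ ∏ i, f (x i) :=
    fun x => Finset.prod_nonneg fun i _ => hf.1 _
  apply Real.le_sqrt_of_sq_le
  have cs := Finset.sum_sq_le_sum_mul_sum_of_sq_le_mul A
    (r := fun x => (∏ i, f (x i)) * |(∑ i, if B (x i) then (1 : ℝ) else 0) / n - p|)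
    (f := fun x => ∏ i, f (x i))
    (g := fun x => (∏ i, f (x i)) * ((∑ i, g (x i)) / n) ^ 2)
    (fun x _ => hP x) (fun x _ => mul_nonneg (hP x) (sq_nonneg _))
    (by
      intro x _
      rw [hZ, mul_pow, sq_abs]; apply le_of_eq; ring)
  refine cs.trans ?_
  rw [hA, sum_prod_const, hf.2.2.1, one_pow, one_mul]
  have : ∀ x : Fin n → ℕ, (∏ i, f (x i)) * ((∑ i, g (x i)) / n) ^ 2
     = (∏ i, f (x i)) * (∑ i, g (x i)) ^ 2 / n ^ 2 := by intro x; ring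
  simp_rw [this]
  rw [← Finset.sum_div, second_moment hf g hg]
  rw [div_le_div_iff₀ (by positivity) hn']
  calc _ ≤ n * p * (n : ℝ) := by gcongr
    _ = _ := by ring

lemma abel_sum {k : ℕ} {f : ℕ → ℝ} (hf : f ∈ Fk k) (N : ℕ) :
    ∑ x ∈ Finset.Ico 1 (N + 1), (x : ℝ) * (f x - f (x + 1)) ≤ 1 := by
  have h1 : ∑ x ∈ Finset.Ico 1 (N + 1), (x : ℝ) * (f x - f (x + 1))
      = ∑ x ∈ Finset.Ico 1 (N + 1), f x - N * f (N + 1) := by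
    induction N with
    | zero => simp
    | succ N ih =>
      rw [Finset.sum_Ico_succ_top (by omega), ih, Finset.sum_Ico_succ_top (a := 1) (b := N + 1) (by omega) f]
      push_cast; ring
  have h2 : ∑ x ∈ Finset.Ico 1 (N + 1), f x ≤ 1 := by
    rw [← hf.2.2.1, ← Finset.sum_filter_add_sum_filter_not _ (fun x => x ≤ k)]
    rw [Finset.sum_eq_zero (s := (Finset.Ico 1 (N + 1)).filter (fun x => ¬ x ≤ k)), add_zero]
    · apply Finset.sum_le_sum_of_subset_of_nonneg
      · intro x hx; simp at hx ⊢; omega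
      · intro x _ _; exact hf.1 x
    · intro x hx; simp at hx; exact hf.2.1 x (by simp; omega)
  have := mul_nonneg (Nat.cast_nonneg (α := ℝ) N) (hf.1 (N + 1))
  linarith

lemma bias_block {k : ℕ} {f : ℕ → ℝ} (hf : f ∈ Fk k) {s e : ℕ} (hs : 1 ≤ s) (hse : s < e)
    {β : ℝ} (hβ : (e : ℝ) - s - 1 ≤ β * s) :
    ∑ y ∈ Finset.Ico s e, |(∑ z ∈ Finset.Ico s e, f z) / ((e : ℝ) - s) - f y|
      ≤ 2 * β * ∑ x ∈ Finset.Ico s e, (x : ℝ) * (f x - f (x + 1)) := by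
  have hl : (0 : ℝ) < (e : ℝ) - s := by
    have : (s : ℝ) < e := by exact_mod_cast hse
    linarith
  set p := ∑ z ∈ Finset.Ico s e, f z with hp
  have hcard : ∀ c : ℝ, ∑ y ∈ Finset.Ico s e, c = ((e : ℝ) - s) * c := by
    intro c; rw [Finset.sum_const, Nat.card_Ico, nsmul_eq_mul, Nat.cast_sub hse.le]
  have hD : ∑ y ∈ Finset.Ico s e, (f s - f y) = ((e : ℝ) - s) * f s - p := by
    rw [Finset.sum_sub_distrib, hcard]
  have hD0 : 0 ≤ ∑ y ∈ Finset.Ico s e, (f s - f y) := by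
    apply Finset.sum_nonneg
    intro y hy
    rw [Finset.mem_Ico] at hy
    linarith [Fk_anti hf hs hy.1]
  have h1 : p / ((e : ℝ) - s) ≤ f s := by
    rw [div_le_iff₀ hl]; linarith
  have h2 : ∑ y ∈ Finset.Ico s e, |p / ((e : ℝ) - s) - f y|
      ≤ 2 * ∑ y ∈ Finset.Ico s e, (f s - f y) := by
    calc _ ≤ ∑ y ∈ Finset.Ico s e, ((f s - p / ((e : ℝ) - s)) + (f s - f y)) := by
          apply Finset.sum_le_sum
          intro y hy
          rw [Finset.mem_Ico] at hy
          have := Fk_anti hf hs hy.1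
          rw [abs_le]; constructor <;> linarith
      _ = _ := by
        rw [Finset.sum_add_distrib, hcard, hD]
        field_simp; ring
  have h3 : ∑ y ∈ Finset.Ico s e, (f s - f y) ≤ ((e : ℝ) - s - 1) * (f s - f e) := by
    rw [Finset.sum_eq_sum_Ico_succ_bot hse, sub_self, zero_add]
    calc _ ≤ ∑ y ∈ Finset.Ico (s + 1) e, (f s - f e) := by
          apply Finset.sum_le_sum
          intro y hy
          rw [Finset.mem_Ico] at hy
          linarith [Fk_anti hf (show 1 ≤ y by omega) hy.2.le]
      _ = _ := by
        rw [Finset.sum_const, Nat.card_Ico, nsmul_eq_mul, Nat.cast_sub hse]; push_cast; ring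
  have hfe : f e ≤ f s := Fk_anti hf hs hse.le
  have h4 : (s : ℝ) * (f s - f e) ≤ ∑ x ∈ Finset.Ico s e, (x : ℝ) * (f x - f (x + 1)) := by
    have ht : ∑ x ∈ Finset.Ico s e, (f x - f (x + 1)) = f s - f e := by
      have := Finset.sum_Ico_sub f hse.le
      rw [← neg_inj, ← Finset.sum_neg_distrib]
      simp only [neg_sub]
      exact this
    rw [← ht, Finset.mul_sum]
    apply Finset.sum_le_sum
    intro x hx
    rw [Finset.mem_Ico] at hx
    have := Fk_step hf (show 1 ≤ x by omega)
    have h' : (s : ℝ) ≤ x := by exact_mod_cast hx.1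
    apply mul_le_mul_of_nonneg_right h'; linarith
  have hs0 : (0 : ℝ) < s := by exact_mod_cast hs
  have he1 : (s : ℝ) + 1 ≤ e := by exact_mod_cast hse
  have hβ0 : 0 ≤ β := by
    by_contra hc
    push Not at hc
    nlinarith
  calc _ ≤ 2 * ∑ y ∈ Finset.Ico s e, (f s - f y) := h2
    _ ≤ 2 * ((β * s) * (f s - f e)) := by
      have := mul_le_mul_of_nonneg_right hβ (sub_nonneg.2 hfe)
      linarith
    _ = 2 * β * (s * (f s - f e)) := by ring
    _ ≤ _ := by gcongr

/-- Histogram upper bound. -/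
lemma upper {n k M : ℕ} (hn : 0 < n) {S : ℕ → ℕ} (hS : StrictMono S) (hS0 : S 0 = 1)
    {β : ℝ} (hβ0 : 0 ≤ β) (hβ : ∀ j, (S (j + 1) : ℝ) - S j - 1 ≤ β * S j) (hM : k < S M) :
    minimaxRisk n k (Fk k) ≤ (√((M : ℝ) / n) + 2 * β) / 2 := by
  have hl : ∀ j, (0 : ℝ) < (S (j + 1) : ℝ) - S j := by
    intro j
    have : (S j : ℝ) < S (j + 1) := by exact_mod_cast hS (Nat.lt_succ_self j)
    linarith
  let N : (Fin n → ℕ) → ℕ → ℝ := fun x j => ∑ i, if blk S (x i) = j then (1 : ℝ) else 0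
  refine minimaxRisk_le (fun x y => N x (blk S y) / n / ((S (blk S y + 1) : ℝ) - S (blk S y)))
    (by positivity) ?_
  intro f hf
  set A := Fintype.piFinset (fun _ : Fin n => Finset.Icc 1 k) with hA
  have hP : ∀ x : Fin n → ℕ, 0 ≤ ∏ i, f (x i) :=
    fun x => Finset.prod_nonneg fun i _ => hf.1 _
  let p : ℕ → ℝ := fun j => ∑ z ∈ Finset.Ico (S j) (S (j + 1)), f z
  have hsub : Finset.Icc 1 k ⊆ Finset.Ico (S 0) (S M) := by
    intro y hy; simp at hy ⊢; omega
  have hp : ∀ j ∈ Finset.range M, p j = ∑ y ∈ Finset.Icc 1 k, if blk S y = j then f y else 0 := by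
    intro j hj
    rw [Finset.mem_range] at hj
    have e : ∑ y ∈ Finset.Icc 1 k, (if blk S y = j then f y else 0)
        = ∑ y ∈ Finset.Ico (S 0) (S M), (if blk S y = j then f y else 0) := by
      apply Finset.sum_subset hsub
      intro y _ hy
      rw [hf.2.1 y hy]; simp
    rw [e, sum_blocks hS, Finset.sum_eq_single j]
    · apply Finset.sum_congr rfl
      intro y hy
      rw [Finset.mem_Ico] at hy
      rw [blk_eq hS hy.1 hy.2]; simp
    · intro h _ hne
      apply Finset.sum_eq_zero
      intro y hy
      rw [Finset.mem_Ico] at hy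
      rw [blk_eq hS hy.1 hy.2]; simp [hne]
    · intro h; exact absurd (Finset.mem_range.2 hj) h
  have hbias : ∑ j ∈ Finset.range M, ∑ y ∈ Finset.Ico (S j) (S (j + 1)),
      |p j / ((S (j + 1) : ℝ) - S j) - f y| ≤ 2 * β := by
    calc _ ≤ ∑ j ∈ Finset.range M, 2 * β *
            ∑ x ∈ Finset.Ico (S j) (S (j + 1)), (x : ℝ) * (f x - f (x + 1)) := by
          apply Finset.sum_le_sum
          intro j _
          exact bias_block hf (by rw [← hS0]; exact hS.monotone (Nat.zero_le j))
            (hS (Nat.lt_succ_self j)) (hβ j)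
      _ = 2 * β * ∑ x ∈ Finset.Ico (S 0) (S M), (x : ℝ) * (f x - f (x + 1)) := by
          rw [← Finset.mul_sum, ← sum_blocks hS]
      _ ≤ 2 * β * 1 := by
          apply mul_le_mul_of_nonneg_left _ (by positivity)
          have := abel_sum hf (S M - 1)
          rw [hS0]
          rwa [Nat.sub_add_cancel (by omega)] at this
      _ = _ := by ring
  have htv : ∀ x : Fin n → ℕ,
      TVk k (fun y => N x (blk S y) / n / ((S (blk S y + 1) : ℝ) - S (blk S y))) f
      ≤ (∑ j ∈ Finset.range M, |N x j / n - p j| + 2 * β) / 2 := by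
    intro x
    unfold TVk
    apply div_le_div_of_nonneg_right _ (by norm_num)
    calc _ ≤ ∑ y ∈ Finset.Ico (S 0) (S M),
            |N x (blk S y) / n / ((S (blk S y + 1) : ℝ) - S (blk S y)) - f y| :=
          Finset.sum_le_sum_of_subset_of_nonneg hsub fun _ _ _ => abs_nonneg _
      _ = ∑ j ∈ Finset.range M, ∑ y ∈ Finset.Ico (S j) (S (j + 1)),
            |N x j / n / ((S (j + 1) : ℝ) - S j) - f y| := by
          rw [sum_blocks hS]
          apply Finset.sum_congr rfl
          intro j _
          apply Finset.sum_congr rfl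
          intro y hy
          rw [Finset.mem_Ico] at hy
          rw [blk_eq hS hy.1 hy.2]
      _ ≤ ∑ j ∈ Finset.range M, (|N x j / n - p j| + ∑ y ∈ Finset.Ico (S j) (S (j + 1)),
            |p j / ((S (j + 1) : ℝ) - S j) - f y|) := by
          apply Finset.sum_le_sum
          intro j _
          have e : |N x j / n - p j| = ∑ y ∈ Finset.Ico (S j) (S (j + 1)),
              |N x j / n - p j| / ((S (j + 1) : ℝ) - S j) := by
            rw [Finset.sum_const, Nat.card_Ico, nsmul_eq_mul,
              Nat.cast_sub (hS.monotone (Nat.le_succ _))]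
            have := (hl j).ne'
            simp only [Nat.succ_eq_add_one]
            field_simp
          rw [e, ← Finset.sum_add_distrib]
          apply Finset.sum_le_sum
          intro y _
          have e2 : |N x j / n - p j| / ((S (j + 1) : ℝ) - S j)
            = |N x j / n / ((S (j + 1) : ℝ) - S j) - p j / ((S (j + 1) : ℝ) - S j)| := by
            rw [← sub_div, abs_div, abs_of_pos (hl j)]
          rw [e2]
          exact abs_sub_le _ _ _
      _ ≤ _ := by
          rw [Finset.sum_add_distrib]; linarith
  have hpn : ∀ j, 0 ≤ p j := fun j => Finset.sum_nonneg fun _ _ => hf.1 _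
  have hps : ∑ j ∈ Finset.range M, p j = 1 := by
    rw [← sum_blocks hS, ← hf.2.2.1]
    symm
    apply Finset.sum_subset hsub
    intro y _ hy
    exact hf.2.1 y hy
  have hn' : (0 : ℝ) < n := by exact_mod_cast hn
  have hvar : ∑ j ∈ Finset.range M, √(p j / n) ≤ √((M : ℝ) / n) := by
    apply Real.le_sqrt_of_sq_le
    refine sq_sum_le_card_mul_sum_sq.trans ?_
    rw [Finset.sum_congr rfl (g := fun j => p j / n)]
    · rw [← Finset.sum_div, hps, Finset.card_range]; apply le_of_eq; ring
    · intro j _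
      exact Real.sq_sqrt (div_nonneg (hpn j) hn'.le)
  unfold loss
  calc _ ≤ ∑ x ∈ A, (∏ i, f (x i)) * ((∑ j ∈ Finset.range M, |N x j / n - p j| + 2 * β) / 2) := by
        apply Finset.sum_le_sum
        intro x _
        exact mul_le_mul_of_nonneg_left (htv x) (hP x)
    _ = (∑ j ∈ Finset.range M, ∑ x ∈ A, (∏ i, f (x i)) * |N x j / n - p j|
          + (∑ x ∈ A, ∏ i, f (x i)) * (2 * β)) / 2 := by
        rw [Finset.sum_comm, Finset.sum_mul, ← Finset.sum_add_distrib, Finset.sum_div]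
        apply Finset.sum_congr rfl
        intro x _
        rw [← Finset.mul_sum]; ring
    _ ≤ (∑ j ∈ Finset.range M, √(p j / n) + 1 * (2 * β)) / 2 := by
        have h1 : ∑ x ∈ A, ∏ i, f (x i) = 1 := by
          rw [hA, sum_prod_const, hf.2.2.1, one_pow]
        rw [h1]
        have h2 : ∑ j ∈ Finset.range M, ∑ x ∈ A, (∏ i, f (x i)) * |N x j / n - p j|
            ≤ ∑ j ∈ Finset.range M, √(p j / n) := by
          apply Finset.sum_le_sum
          intro j hj
          exact mad hn hf (fun y => blk S y = j) (p j) (hp j hj)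
        linarith
    _ ≤ _ := by linarith

lemma sqrt_lower {a d : ℝ} (ha : 0 < a) (h1 : -a ≤ d) (h2 : d ≤ a) :
    a + d / 2 - d ^ 2 / (2 * a) ≤ √(a * (a + d)) := by
  apply Real.le_sqrt_of_sq_le
  have e : a + d / 2 - d ^ 2 / (2 * a) = (a + d) * (2 * a - d) / (2 * a) := by
    field_simp; ring
  rw [e, div_pow, div_le_iff₀ (by positivity)]
  have h3 : (a + d) * (2 * a - d) ^ 2 ≤ 4 * a ^ 3 := by
    nlinarith [mul_nonneg (sq_nonneg d) (show 0 ≤ 3 * a - d by linarith)]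
  nlinarith [mul_le_mul_of_nonneg_left h3 (show 0 ≤ a + d by linarith)]

lemma sum_range_two_mul (G : ℕ → ℝ) (m : ℕ) :
    ∑ h ∈ Finset.range (2 * m), G h = ∑ q ∈ Finset.range m, (G (2 * q) + G (2 * q + 1)) := by
  induction m with
  | zero => simp
  | succ m ih =>
    rw [show 2 * (m + 1) = 2 * m + 1 + 1 by ring, Finset.sum_range_succ, Finset.sum_range_succ, ih,
      Finset.sum_range_succ]
    ring

section construction

variable (W : ℕ)

/-- starting points of the half blocks -/
def SS (h : ℕ) : ℕ := 1 + ∑ j ∈ Finset.range h, 2 ^ (j / 2 / W)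

lemma SS_succ (h : ℕ) : SS W (h + 1) = SS W h + 2 ^ (h / 2 / W) := by
  unfold SS; rw [Finset.sum_range_succ]; ring

lemma SS_strict : StrictMono (SS W) := by
  apply strictMono_nat_of_lt_succ
  intro h; rw [SS_succ]
  have : 0 < 2 ^ (h / 2 / W) := by positivity
  omega

lemma SS_zero : SS W 0 = 1 := by simp [SS]

lemma SS_scale (hW : 0 < W) (I : ℕ) : SS W (2 * (I * W)) + 2 * W = 2 * W * 2 ^ I + 1 := by
  induction I with
  | zero => simp [SS]; ring
  | succ I ih =>
    have h : ∀ t ≤ 2 * W, SS W (2 * (I * W) + t) = SS W (2 * (I * W)) + t * 2 ^ I := by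
      intro t
      induction t with
      | zero => simp
      | succ t iht =>
        intro ht
        rw [← add_assoc, SS_succ, iht (by omega)]
        have : (2 * (I * W) + t) / 2 / W = I := by
          rw [Nat.div_div_eq_div_mul]
          rw [show 2 * (I * W) + t = t + (2 * W) * I by ring, Nat.add_mul_div_left _ _ (by omega),
            Nat.div_eq_of_lt (by omega), zero_add]
        rw [this]; ring
    have := h (2 * W) le_rfl
    rw [show 2 * ((I + 1) * W) = 2 * (I * W) + 2 * W by ring, this]
    rw [pow_succ]; linarith

/-- base heights -/
noncomputable def a0 (q : ℕ) : ℝ := (1 / 2) ^ (q / W) * (2 - ((q % W : ℕ) : ℝ) / W)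

/-- perturbations -/
noncomputable def d0 (θ : ℝ) (q : ℕ) : ℝ := θ * (1 / 2) ^ (q / W) / (2 * W)

lemma a0_ge (hW : 0 < W) (q : ℕ) : (1 / 2) ^ (q / W) ≤ a0 W q := by
  unfold a0
  have hW' : (0 : ℝ) < W := by exact_mod_cast hW
  have h : ((q % W : ℕ) : ℝ) / W ≤ 1 := by
    rw [div_le_one hW']; exact_mod_cast (Nat.mod_lt q hW).le
  have : (0 : ℝ) < (1 / 2) ^ (q / W) := by positivity
  nlinarith

lemma a0_le (q : ℕ) : a0 W q ≤ 2 * (1 / 2) ^ (q / W) := by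
  unfold a0
  have h : (0 : ℝ) ≤ ((q % W : ℕ) : ℝ) / W := by positivity
  have : (0 : ℝ) < (1 / 2) ^ (q / W) := by positivity
  nlinarith

lemma d0_nonneg {θ : ℝ} (h0 : 0 ≤ θ) (q : ℕ) : 0 ≤ d0 W θ q := by
  unfold d0; positivity

lemma d0_le (hW : 0 < W) {θ : ℝ} (h1 : θ ≤ 1) (q : ℕ) :
    d0 W θ q ≤ (1 / 2) ^ (q / W) / (2 * W) := by
  unfold d0
  gcongr
  have : (0 : ℝ) < (1 / 2) ^ (q / W) := by positivity
  nlinarith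

lemma d0_le_a0 (hW : 0 < W) {θ : ℝ} (h1 : θ ≤ 1) (q : ℕ) : d0 W θ q ≤ a0 W q := by
  refine (d0_le W hW h1 q).trans (le_trans ?_ (a0_ge W hW q))
  have hW' : (1 : ℝ) ≤ W := by exact_mod_cast hW
  apply div_le_self (by positivity); linarith

lemma step (hW : 0 < W) {θ : ℝ} (h1 : θ ≤ 1) (q : ℕ) :
    a0 W (q + 1) + d0 W θ (q + 1) ≤ a0 W q - d0 W θ q := by
  have hW' : (0 : ℝ) < W := by exact_mod_cast hW
  have e1 := d0_le W hW h1 q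
  have e2 := d0_le W hW h1 (q + 1)
  have hd := Nat.div_add_mod q W
  have hlt := Nat.mod_lt q hW
  set i := q / W with hi
  set r := q % W with hr
  by_cases h : r + 1 < W
  · have i1 : (q + 1) / W = i := by
      rw [← hd, add_assoc, Nat.mul_add_div hW, Nat.div_eq_of_lt h]; simp
    have i2 : (q + 1) % W = r + 1 := by
      rw [← hd, add_assoc, Nat.mul_add_mod, Nat.mod_eq_of_lt h]
    rw [i1] at e2
    have a1 : a0 W (q + 1) = (1 / 2) ^ i * (2 - (r + 1) / W) := by
      unfold a0; rw [i1, i2]; push_cast; ring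
    have a2 : a0 W q = (1 / 2) ^ i * (2 - r / W) := by unfold a0; rw [← hi, ← hr]
    have e3 : a0 W q - a0 W (q + 1) = 2 * ((1 / 2) ^ i / (2 * W)) := by
      rw [a1, a2]; field_simp; ring
    linarith
  · have hrW : r + 1 = W := by omega
    have e : q + 1 = W * (i + 1) := by rw [← hd, add_assoc, hrW]; ring
    have i1 : (q + 1) / W = i + 1 := by rw [e, Nat.mul_div_cancel_left _ hW]
    have i2 : (q + 1) % W = 0 := by rw [e, Nat.mul_mod_right]
    rw [i1] at e2
    have a1 : a0 W (q + 1) = (1 / 2) ^ i := by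
      unfold a0; rw [i1, i2, pow_succ]; simp
    have a2 : a0 W q = (1 / 2) ^ i * (2 - (W - 1) / W) := by
      unfold a0; rw [← hi, ← hr, ← hrW]; push_cast; ring
    have e3 : a0 W q - a0 W (q + 1) = 2 * ((1 / 2) ^ i / (2 * W)) := by
      rw [a1, a2]; field_simp; ring
    have e4 : (1 / 2 : ℝ) ^ (i + 1) / (2 * W) ≤ (1 / 2) ^ i / (2 * W) := by
      apply div_le_div_of_nonneg_right _ (by positivity)
      rw [pow_succ]; have : (0 : ℝ) < (1 / 2) ^ i := by positivity
      linarith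
    linarith

/-- heights -/
noncomputable def vv (θ c : ℝ) {m : ℕ} (ω : Fin m → Bool) (h : ℕ) : ℝ :=
  if hq : h / 2 < m then
    c * (a0 W (h / 2) + if ω ⟨h / 2, hq⟩ then 0 else
      if h % 2 = 0 then d0 W θ (h / 2) else - d0 W θ (h / 2))
  else 0

lemma vv_even (θ c : ℝ) {m : ℕ} (ω : Fin m → Bool) (q : ℕ) (hq : q < m) :
    vv W θ c ω (2 * q) = c * (a0 W q + if ω ⟨q, hq⟩ then 0 else d0 W θ q) := by
  unfold vv
  have h : 2 * q / 2 = q := by omega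
  have h2 : 2 * q % 2 = 0 := by omega
  rw [dif_pos (by omega)]
  simp [h]

lemma vv_odd (θ c : ℝ) {m : ℕ} (ω : Fin m → Bool) (q : ℕ) (hq : q < m) :
    vv W θ c ω (2 * q + 1) = c * (a0 W q + if ω ⟨q, hq⟩ then 0 else - d0 W θ q) := by
  unfold vv
  have h : (2 * q + 1) / 2 = q := by omega
  have h2 : (2 * q + 1) % 2 = 1 := by omega
  rw [dif_pos (by omega)]
  simp [h, h2]

lemma vv_big (θ c : ℝ) {m : ℕ} (ω : Fin m → Bool) {h : ℕ} (hq : 2 * m ≤ h) :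
    vv W θ c ω h = 0 := by
  unfold vv; rw [dif_neg (by omega)]

lemma vv_nonneg (hW : 0 < W) {θ c : ℝ} (h0 : 0 ≤ θ) (h1 : θ ≤ 1) (hc : 0 ≤ c) {m : ℕ}
    (ω : Fin m → Bool) (h : ℕ) : 0 ≤ vv W θ c ω h := by
  unfold vv
  have e1 := d0_nonneg W h0 (h / 2)
  have e2 := d0_le_a0 W hW h1 (h / 2)
  split_ifs
  · apply mul_nonneg hc; linarith
  · apply mul_nonneg hc; linarith
  · apply mul_nonneg hc; linarith
  · exact le_rfl

lemma vv_step (hW : 0 < W) {θ c : ℝ} (h0 : 0 ≤ θ) (h1 : θ ≤ 1) (hc : 0 ≤ c) {m : ℕ}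
    (ω : Fin m → Bool) (h : ℕ) : vv W θ c ω (h + 1) ≤ vv W θ c ω h := by
  by_cases hb : 2 * m ≤ h + 1
  · rw [vv_big W θ c ω hb]; exact vv_nonneg W hW h0 h1 hc ω h
  obtain ⟨q, hq | hq⟩ := Nat.even_or_odd' h
  · have hqm : q < m := by omega
    rw [hq, vv_even W θ c ω q hqm, vv_odd W θ c ω q hqm]
    have e1 := d0_nonneg W h0 q
    apply mul_le_mul_of_nonneg_left _ hc
    split_ifs <;> linarith
  · have hqm : q < m := by omega
    have hqm' : q + 1 < m := by omega
    rw [hq, vv_odd W θ c ω q hqm, show 2 * q + 1 + 1 = 2 * (q + 1) by ring,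
      vv_even W θ c ω (q + 1) hqm']
    have e1 := d0_nonneg W h0 q
    have e2 := d0_nonneg W h0 (q + 1)
    have e3 := step W hW h1 q
    apply mul_le_mul_of_nonneg_left _ hc
    split_ifs <;> linarith

lemma sumG {k m : ℕ} (hk : SS W (2 * m) ≤ k + 1) (G : ℕ → ℝ) (hG : ∀ h, 2 * m ≤ h → G h = 0) :
    ∑ x ∈ Finset.Icc 1 k, G (blk (SS W) x)
      = ∑ q ∈ Finset.range m, 2 ^ (q / W) * (G (2 * q) + G (2 * q + 1)) := by
  have hS := SS_strict W
  have h1 : ∑ x ∈ Finset.Ico (SS W 0) (SS W (2 * m)), G (blk (SS W) x)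
      = ∑ x ∈ Finset.Icc 1 k, G (blk (SS W) x) := by
    apply Finset.sum_subset
    · intro x hx; rw [SS_zero] at hx; simp at hx ⊢; omega
    · intro x hx hx'
      rw [SS_zero] at hx'
      simp only [Finset.mem_Icc, Finset.mem_Ico, not_and, not_lt] at hx hx'
      apply hG
      obtain ⟨_, h3⟩ := blk_spec hS (show SS W 0 ≤ x by rw [SS_zero]; exact hx.1)
      have := hS.lt_iff_lt.1 (lt_of_le_of_lt (hx' hx.1) h3)
      omega
  rw [← h1, sum_blocks_const hS, sum_range_two_mul]
  apply Finset.sum_congr rfl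
  intro q _
  have i1 : 2 * q / 2 = q := by omega
  have i2 : (2 * q + 1) / 2 = q := by omega
  rw [SS_succ W (2 * q + 1), SS_succ W (2 * q), i1, i2]
  push_cast; ring

lemma pow_cancel (i : ℕ) : (2 : ℝ) ^ i * (1 / 2) ^ i = 1 := by
  rw [← mul_pow]; norm_num

lemma lower (hW : 0 < W) {I n k : ℕ} (hI : 0 < I) {θ : ℝ} (h0 : 0 ≤ θ) (h1 : θ ≤ 1)
    (hk : 2 * W * 2 ^ I ≤ k + 2 * W) (hn : n * θ ^ 2 ≤ I * W ^ 3) :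
    θ / (64 * W) ≤ minimaxRisk n k (Fk k) := by
  have hW1 : (1 : ℝ) ≤ W := by exact_mod_cast hW
  have hI1 : (1 : ℝ) ≤ I := by exact_mod_cast hI
  obtain ⟨m, hm⟩ : ∃ m, m = I * W := ⟨_, rfl⟩
  have hmR : (m : ℝ) = I * W := by rw [hm]; push_cast; ring
  have hm1 : (1 : ℝ) ≤ m := by rw [hmR]; nlinarith
  have hSk : SS W (2 * m) ≤ k + 1 := by
    have := SS_scale W hW I
    rw [← hm] at this; omega
  set T : ℝ := ∑ q ∈ Finset.range m, 2 ^ (q / W) * (2 * a0 W q) with hT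
  have hTl : 2 * (m : ℝ) ≤ T := by
    have : ∑ q ∈ Finset.range m, (2 : ℝ) ≤ T := by
      apply Finset.sum_le_sum
      intro q _
      have := mul_le_mul_of_nonneg_left (a0_ge W hW q) (show (0 : ℝ) ≤ 2 ^ (q / W) by positivity)
      rw [pow_cancel] at this; linarith
    simpa [mul_comm] using this
  have hTu : T ≤ 4 * m := by
    have : T ≤ ∑ q ∈ Finset.range m, (4 : ℝ) := by
      apply Finset.sum_le_sum
      intro q _
      have := mul_le_mul_of_nonneg_left (a0_le W q) (show (0 : ℝ) ≤ 2 ^ (q / W) by positivity)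
      have e := pow_cancel (q / W)
      nlinarith
    simpa [mul_comm] using this
  have hT0 : 0 < T := by linarith
  set c := 1 / T with hc
  have hc0 : 0 < c := by positivity
  have hcT : c * T = 1 := by rw [hc]; field_simp
  have hcm : c * m ≤ 1 / 2 := by nlinarith
  have hcm' : 1 / 4 ≤ c * m := by nlinarith
  let f : (Fin m → Bool) → ℕ → ℝ := fun ω x =>
    if x ∈ Finset.Icc 1 k then vv W θ c ω (blk (SS W) x) else 0
  have hfe : ∀ ω, ∀ x ∈ Finset.Icc 1 k, f ω x = vv W θ c ω (blk (SS W) x) := by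
    intro ω x hx; simp only [f]; rw [if_pos hx]
  have hpair : ∀ (ω : Fin m → Bool) q, q < m →
      vv W θ c ω (2 * q) + vv W θ c ω (2 * q + 1) = c * (2 * a0 W q) := by
    intro ω q hq
    rw [vv_even W θ c ω q hq, vv_odd W θ c ω q hq]
    split_ifs <;> ring
  have hvs : ∀ ω : Fin m → Bool, ∀ h, 0 ≤ vv W θ c ω h := fun ω h =>
    vv_nonneg W hW h0 h1 hc0.le ω h
  have hfF : ∀ ω, f ω ∈ Fk k := by
    intro ω
    refine ⟨?_, ?_, ?_, ?_⟩
    · intro x; simp only [f]; split_ifs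
      · exact hvs _ _
      · exact le_rfl
    · intro x hx; simp only [f]; rw [if_neg hx]
    · rw [Finset.sum_congr rfl (hfe ω), sumG W hSk _ (fun h hh => vv_big W θ c ω hh)]
      rw [← hcT, hT, Finset.mul_sum]
      apply Finset.sum_congr rfl
      intro q hq
      rw [hpair ω q (Finset.mem_range.1 hq)]; ring
    · intro x hx1 hxk
      rw [hfe ω x (by simp; omega), hfe ω (x + 1) (by simp; omega)]
      have hanti : Antitone (vv W θ c ω) :=
        antitone_nat_of_succ_le (vv_step W hW h0 h1 hc0.le ω)
      exact hanti (blk_mono (SS_strict W) (by rw [SS_zero]; exact hx1) (Nat.le_succ x))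
  set u : ℝ := c * θ ^ 2 / (4 * W ^ 2) with hu
  have hθ2 : θ ^ 2 ≤ 1 := by nlinarith
  have key := assouad (n := n) f hfF (fun y => blk (SS W) y / 2) (η := c * θ / W) (u := u)
    (by positivity) ?_ ?_ ?_ ?_
  · refine le_trans ?_ key
    have e : (m : ℝ) * (c * θ / W) / 16 = (c * m) * (θ / (16 * W)) := by field_simp
    rw [e]
    calc θ / (64 * W) = 1 / 4 * (θ / (16 * W)) := by field_simp; ring
      _ ≤ _ := by gcongr
  · rw [hu, div_le_one (by positivity)]
    have : c ≤ 1 / 2 := by nlinarith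
    nlinarith
  · rw [hu]
    have e : 4 * (n : ℝ) * (c * θ ^ 2 / (4 * W ^ 2)) = c * (n * θ ^ 2) / W ^ 2 := by field_simp
    rw [e, div_le_one (by positivity)]
    calc c * (n * θ ^ 2) ≤ c * (I * W ^ 3) := by gcongr
      _ = (c * m) * W ^ 2 := by rw [hmR]; ring
      _ ≤ 1 * W ^ 2 := by gcongr; linarith
      _ = _ := by ring
  · -- separation
    intro ω j
    set ω' := Function.update ω j (!ω j) with hω'
    rw [Finset.sum_filter]
    have e : ∑ y ∈ Finset.Icc 1 k, (if blk (SS W) y / 2 = (j : ℕ) then |f ω y - f ω' y| else 0)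
        = ∑ y ∈ Finset.Icc 1 k, (fun h => if h / 2 = (j : ℕ) then
          |vv W θ c ω h - vv W θ c ω' h| else 0) (blk (SS W) y) := by
      apply Finset.sum_congr rfl
      intro y hy
      rw [hfe ω y hy, hfe ω' y hy]
    rw [e, sumG W hSk (fun h => if h / 2 = (j : ℕ) then
          |vv W θ c ω h - vv W θ c ω' h| else 0)]
    · refine le_trans ?_ (Finset.single_le_sum (f := fun q => (2 : ℝ) ^ (q / W) *
        ((fun h => if h / 2 = (j : ℕ) then |vv W θ c ω h - vv W θ c ω' h| else 0) (2 * q) +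
        (fun h => if h / 2 = (j : ℕ) then |vv W θ c ω h - vv W θ c ω' h| else 0) (2 * q + 1)))
        ?_ (Finset.mem_range.2 j.2))
      · have i1 : 2 * (j : ℕ) / 2 = j := by omega
        have i2 : (2 * (j : ℕ) + 1) / 2 = j := by omega
        simp only [i1, i2, if_true]
        rw [vv_even W θ c ω j j.2, vv_odd W θ c ω j j.2, vv_even W θ c ω' j j.2,
          vv_odd W θ c ω' j j.2]
        have hj : ω' ⟨j, j.2⟩ = !ω j := by simp [hω']
        rw [hj]
        have hd := d0_nonneg W h0 j
        have cd : 0 ≤ c * d0 W θ j := by positivity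
        have fin : c * θ / W = 2 ^ ((j : ℕ) / W) * (c * d0 W θ j + c * d0 W θ j) := by
          unfold d0
          have := pow_cancel ((j : ℕ) / W)
          calc c * θ / W = c * θ / W * (2 ^ ((j : ℕ) / W) * (1 / 2) ^ ((j : ℕ) / W)) := by
                rw [this, mul_one]
            _ = _ := by field_simp; ring
        rw [fin]
        apply le_of_eq
        congr 1
        cases h : ω j <;> simp [h, mul_add, abs_of_nonneg cd]
      · intro q _
        apply mul_nonneg (by positivity)
        apply add_nonneg
        · dsimp only; split_ifs <;> positivity
        · dsimp only; split_ifs <;> positivity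
    · intro h hh
      rw [if_neg (by have := j.2; omega)]
  · -- affinity
    intro ω j
    set ω' := Function.update ω j (!ω j) with hω'
    have e : ∑ y ∈ Finset.Icc 1 k, √(f ω y * f ω' y)
        = ∑ y ∈ Finset.Icc 1 k, (fun h => √(vv W θ c ω h * vv W θ c ω' h)) (blk (SS W) y) := by
      apply Finset.sum_congr rfl
      intro y hy
      rw [hfe ω y hy, hfe ω' y hy]
    rw [e, sumG W hSk (fun h => √(vv W θ c ω h * vv W θ c ω' h))]
    · have e2 : 1 - u = ∑ q ∈ Finset.range m,
          (c * (2 ^ (q / W) * (2 * a0 W q)) - if q = (j : ℕ) then u else 0) := by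
        rw [Finset.sum_sub_distrib, ← Finset.mul_sum, ← hT, hcT]
        simp
      rw [e2]
      apply Finset.sum_le_sum
      intro q hq
      rw [Finset.mem_range] at hq
      by_cases hqj : q = (j : ℕ)
      · subst hqj
        rw [if_pos rfl]
        rw [vv_even W θ c ω j j.2, vv_odd W θ c ω j j.2, vv_even W θ c ω' j j.2,
          vv_odd W θ c ω' j j.2]
        have hj : ω' ⟨j, j.2⟩ = !ω j := by simp [hω']
        rw [hj]
        have hd := d0_nonneg W h0 j
        have hda := d0_le_a0 W hW h1 j
        have hag := a0_ge W hW j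
        set a := a0 W j
        set d := d0 W θ j with hdd
        have hpp : (0 : ℝ) < (1 / 2) ^ ((j : ℕ) / W) := by positivity
        have ha : 0 < a := lt_of_lt_of_le hpp hag
        have s1 := sqrt_lower ha (by linarith) hda
        have s2 := sqrt_lower (d := -d) ha (by linarith) (by linarith)
        have s3 : 2 * a - d ^ 2 / a ≤ √(a * (a + d)) + √(a * (a + -d)) := by
          have : (2 : ℝ) * a - d ^ 2 / a = (a + d / 2 - d ^ 2 / (2 * a))
            + (a + -d / 2 - (-d) ^ 2 / (2 * a)) := by field_simp; ring
          rw [this]; linarith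
        have sc : ∀ x, √(c * a * (c * x)) = c * √(a * x) := by
          intro x
          rw [show c * a * (c * x) = c ^ 2 * (a * x) by ring, Real.sqrt_mul (by positivity),
            Real.sqrt_sq hc0.le]
        have sc' : ∀ x, √(c * x * (c * a)) = c * √(a * x) := by
          intro x
          rw [mul_comm (c * x), sc]
        have hb : 2 ^ ((j : ℕ) / W) * (d ^ 2 / a) * c ≤ u := by
          have hpc := pow_cancel ((j : ℕ) / W)
          set P := (1 / 2 : ℝ) ^ ((j : ℕ) / W)
          have h3 : d ^ 2 / a ≤ d ^ 2 / P := by gcongr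
          have h4 : d ^ 2 / P = θ ^ 2 * P / (4 * W ^ 2) := by
            have hdP : d = θ * P / (2 * W) := rfl
            rw [hdP]; field_simp; ring
          calc _ ≤ 2 ^ ((j : ℕ) / W) * (θ ^ 2 * P / (4 * W ^ 2)) * c := by
                rw [← h4]; gcongr
            _ = (2 ^ ((j : ℕ) / W) * P) * u := by rw [hu]; ring
            _ = u := by rw [hpc, one_mul]
        have fin : c * (2 ^ ((j : ℕ) / W) * (2 * a)) - u ≤
            2 ^ ((j : ℕ) / W) * (c * √(a * (a + d)) + c * √(a * (a + -d))) := by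
          calc _ ≤ 2 ^ ((j : ℕ) / W) * c * (2 * a - d ^ 2 / a) := by linarith
            _ ≤ 2 ^ ((j : ℕ) / W) * c * (√(a * (a + d)) + √(a * (a + -d))) := by gcongr
            _ = _ := by ring
        cases h : ω j
        · simpa [h, sc, sc'] using fin
        · simpa [h, sc, sc'] using fin
      · rw [if_neg hqj, sub_zero]
        have hne : ω' ⟨q, hq⟩ = ω ⟨q, hq⟩ := by
          rw [hω', Function.update_of_ne]
          intro hh; exact hqj (congrArg Fin.val hh)
        have v1 : vv W θ c ω' (2 * q) = vv W θ c ω (2 * q) := by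
          rw [vv_even W θ c ω' q hq, vv_even W θ c ω q hq, hne]
        have v2 : vv W θ c ω' (2 * q + 1) = vv W θ c ω (2 * q + 1) := by
          rw [vv_odd W θ c ω' q hq, vv_odd W θ c ω q hq, hne]
        rw [v1, v2, Real.sqrt_mul_self (hvs _ _), Real.sqrt_mul_self (hvs _ _), hpair ω q hq]
        apply le_of_eq; ring
    · intro h hh
      rw [vv_big W θ c ω hh]; simp

end construction

/-- starting points of the blocks of the estimator -/
def SU (W : ℕ) : ℕ → ℕ
  | 0 => 1
  | j + 1 => SU W j + SU W j / W + 1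

lemma SU_strict (W : ℕ) : StrictMono (SU W) := by
  apply strictMono_nat_of_lt_succ
  intro j; simp only [SU]
  have := Nat.zero_le (SU W j / W)
  linarith

lemma SU_growth (W : ℕ) (hW : 0 < W) (i : ℕ) : W * 2 ^ i + 1 ≤ SU W (W * (i + 1)) := by
  induction i with
  | zero =>
    have : ∀ t, t + 1 ≤ SU W t := by
      intro t
      induction t with
      | zero => simp [SU]
      | succ t ih =>
        simp only [SU]
        have := Nat.zero_le (SU W t / W)
        linarith
    simpa using this W
  | succ i ih =>
    have : ∀ t, W * 2 ^ i + 1 + t * 2 ^ i ≤ SU W (W * (i + 1) + t) := by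
      intro t
      induction t with
      | zero => simpa using ih
      | succ t iht =>
        rw [← add_assoc]
        simp only [SU]
        have h1 : 2 ^ i ≤ SU W (W * (i + 1) + t) / W := by
          rw [Nat.le_div_iff_mul_le hW]
          have : 2 ^ i * W = W * 2 ^ i := mul_comm _ _
          omega
        rw [add_mul]; omega
    have h2 := this W
    rw [show W * (i + 1 + 1) = W * (i + 1) + W by ring, pow_succ]
    linarith

lemma regime1 {n k : ℕ} (hn : 0 < n) (hk : 2 ≤ k) {r : ℝ} (hr0 : 0 ≤ r) (hr : r ^ 3 = n)
    (h : (k : ℝ) < 2 * r) :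
    √((k : ℝ) / n) / 1000 ≤ minimaxRisk n k (Fk k) ∧
      minimaxRisk n k (Fk k) ≤ 1000 * √((k : ℝ) / n) := by
  have hn' : (0 : ℝ) < n := by exact_mod_cast hn
  constructor
  · obtain ⟨W, hWd⟩ : ∃ W, W = k / 2 := ⟨_, rfl⟩
    have hW : 0 < W := by omega
    have hW' : (0 : ℝ) < W := by exact_mod_cast hW
    have h2 : 2 * (W : ℝ) ≤ k := by
      have : 2 * W ≤ k := by omega
      exact_mod_cast this
    have h3 : (k : ℝ) ≤ 4 * W := by
      have : k ≤ 4 * W := by omega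
      exact_mod_cast this
    have hWr : (W : ℝ) ^ 3 ≤ n := by
      rw [← hr]; gcongr; linarith
    have hq : 0 ≤ (W : ℝ) ^ 3 / n := by positivity
    have := lower W hW (I := 1) (n := n) (k := k) one_pos (θ := √((W : ℝ) ^ 3 / n))
      (Real.sqrt_nonneg _) (by rw [Real.sqrt_le_one]; exact (div_le_one hn').2 hWr) (by omega)
      (by rw [Real.sq_sqrt hq]; push_cast; field_simp; norm_num)
    refine le_trans ?_ this
    have e : √((W : ℝ) ^ 3 / n) = W * √((W : ℝ) / n) := by
      rw [show (W : ℝ) ^ 3 / n = (W : ℝ) ^ 2 * (W / n) by ring, Real.sqrt_mul (by positivity),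
        Real.sqrt_sq hW'.le]
    have e2 : √((k : ℝ) / n) ≤ 2 * √((W : ℝ) / n) := by
      rw [show 2 * √((W : ℝ) / n) = √(4 * ((W : ℝ) / n)) by
        rw [Real.sqrt_mul (by norm_num), show (4 : ℝ) = 2 ^ 2 by norm_num,
          Real.sqrt_sq (by norm_num)]]
      apply Real.sqrt_le_sqrt
      rw [← mul_div_assoc]; gcongr
    have e3 : W * √((W : ℝ) / n) / (64 * W) = √((W : ℝ) / n) / 64 := by field_simp
    rw [e, e3]
    have := Real.sqrt_nonneg ((W : ℝ) / n)
    linarith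
  · have := upper (n := n) (k := k) (M := k) hn (S := fun j => j + 1) (β := 0)
      (fun a b hab => by simpa using hab) rfl le_rfl (by intro j; push_cast; linarith) (by simp)
    have := Real.sqrt_nonneg ((k : ℝ) / n)
    linarith

lemma regime3 {n k : ℕ} (hn : 0 < n) {r : ℝ} (hr : 2 ≤ r) (h : r * 2 ^ n ≤ (k : ℝ)) :
    (1 : ℝ) / 1000 ≤ minimaxRisk n k (Fk k) ∧ minimaxRisk n k (Fk k) ≤ 1000 * 1 := by
  constructor
  · have hk : 2 * 2 ^ n ≤ k := by
      have : (2 : ℝ) * 2 ^ n ≤ k := le_trans (by gcongr) h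
      exact_mod_cast this
    have := lower 1 one_pos (I := n) (n := n) (k := k) hn (θ := 1) (by norm_num) le_rfl
      (by omega) (by simp)
    refine le_trans ?_ this
    norm_num
  · refine minimaxRisk_le (fun _ _ => 0) (by norm_num) ?_
    intro f hf
    unfold loss
    have : TVk k (fun _ => 0) f = 1 / 2 := by
      unfold TVk
      rw [← hf.2.2.1]
      congr 1
      apply Finset.sum_congr rfl
      intro y _
      rw [zero_sub, abs_neg, abs_of_nonneg (hf.1 y)]
    simp only [this]
    rw [← Finset.sum_mul, sum_prod_const, hf.2.2.1]; norm_num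

lemma regime2_lower {n k : ℕ} (hn : 0 < n) {r L ε : ℝ} (hr0 : 0 < r) (hr : r ^ 3 = n)
    (hL1 : 1 ≤ L) (hLn : L ≤ n) (hkL : (k : ℝ) = r * 2 ^ L) (hε0 : 0 < ε)
    (hε : ε ^ 3 = L / n) : ε / 1000 ≤ minimaxRisk n k (Fk k) := by
  have hn' : (0 : ℝ) < n := by exact_mod_cast hn
  obtain ⟨I, hI⟩ : ∃ I, I = max 1 ⌊L / 2⌋₊ := ⟨_, rfl⟩
  have hI1 : 1 ≤ I := by rw [hI]; exact le_max_left _ _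
  have hI1' : (1 : ℝ) ≤ I := by exact_mod_cast hI1
  have hfl : (⌊L / 2⌋₊ : ℝ) ≤ L / 2 := Nat.floor_le (by linarith)
  have hfl2 : L / 2 < ⌊L / 2⌋₊ + 1 := Nat.lt_floor_add_one _
  have hIL : (I : ℝ) ≤ L := by
    rw [hI]; push_cast; apply max_le hL1; linarith
  have hLI : L ≤ 4 * I := by
    by_cases h : L < 4
    · linarith
    · have : (⌊L / 2⌋₊ : ℝ) ≤ I := by rw [hI]; exact_mod_cast le_max_right _ _
      linarith
  obtain ⟨t, ht⟩ : ∃ t : ℝ, t = ((n : ℝ) / I) ^ ((1 : ℝ) / 3) := ⟨_, rfl⟩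
  have hnI : 1 ≤ (n : ℝ) / I := by rw [le_div_iff₀ (by linarith)]; linarith
  have ht3 : t ^ 3 = n / I := by
    rw [ht, ← Real.rpow_natCast, ← Real.rpow_mul (by linarith)]; norm_num
  have ht0 : 0 ≤ t := by rw [ht]; positivity
  have ht1 : 1 ≤ t := by rw [ht]; exact Real.one_le_rpow hnI (by norm_num)
  have htr : t ≤ r := by
    apply le_of_pow_le_pow_left₀ (n := 3) (by norm_num) hr0.le
    rw [ht3, hr]; exact div_le_self hn'.le hI1'
  obtain ⟨W, hWd⟩ : ∃ W, W = ⌊t⌋₊ := ⟨_, rfl⟩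
  have hW : 0 < W := by rw [hWd]; exact Nat.floor_pos.2 ht1
  have hW1 : (1 : ℝ) ≤ W := by exact_mod_cast hW
  have hWt : (W : ℝ) ≤ t := by rw [hWd]; exact Nat.floor_le ht0
  have htW : t ≤ 2 * W := by
    have : t < W + 1 := by rw [hWd]; exact Nat.lt_floor_add_one _
    linarith
  have hsupp : 2 * W * 2 ^ I ≤ k + 2 * W := by
    have : (2 : ℝ) * W * 2 ^ I ≤ k + 2 * W := by
      by_cases h : I = 1
      · rw [h, hkL]
        have : (2 : ℝ) ≤ 2 ^ L := by
          calc (2 : ℝ) = 2 ^ (1 : ℝ) := by simp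
            _ ≤ _ := Real.rpow_le_rpow_of_exponent_le (by norm_num) hL1
        nlinarith
      · have hI2 : 2 ≤ I := by omega
        have hIf : I = ⌊L / 2⌋₊ := by
          rcases le_total 1 ⌊L / 2⌋₊ with h' | h'
          · rw [hI, max_eq_right h']
          · rw [hI, max_eq_left h'] at h; exact absurd rfl h
        have hI2' : (2 : ℝ) ≤ I := by exact_mod_cast hI2
        rw [← hIf] at hfl
        have h5 : (2 : ℝ) ^ (I + 1) ≤ 2 ^ L := by
          rw [← Real.rpow_natCast]
          apply Real.rpow_le_rpow_of_exponent_le (by norm_num)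
          push_cast; linarith
        calc (2 : ℝ) * W * 2 ^ I = W * 2 ^ (I + 1) := by ring
          _ ≤ r * 2 ^ L := by gcongr; linarith
          _ ≤ _ := by rw [← hkL]; linarith
    exact_mod_cast this
  have hW3 : (n : ℝ) / I ≤ 8 * W ^ 3 := by
    rw [← ht3]
    calc t ^ 3 ≤ (2 * W) ^ 3 := by gcongr
      _ = _ := by ring
  have := lower W hW (I := I) (n := n) (k := k) hI1 (θ := 1 / 3) (by norm_num) (by norm_num) hsupp
    (by
      rw [div_le_iff₀ (by linarith)] at hW3
      have : (0 : ℝ) ≤ W ^ 3 * I := by positivity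
      nlinarith)
  refine le_trans ?_ this
  have het : ε * t ≤ 2 := by
    apply le_of_pow_le_pow_left₀ (n := 3) (by norm_num) (by norm_num)
    rw [mul_pow, hε, ht3]
    rw [show L / n * (n / I) = L / I by field_simp, div_le_iff₀ (by linarith)]
    linarith
  have heW : ε * W ≤ 2 := le_trans (by gcongr) het
  rw [div_le_div_iff₀ (by norm_num) (by linarith)]
  linarith

lemma regime2_upper {n k : ℕ} (hn : 0 < n) {r L ε : ℝ} (hr0 : 0 < r) (hr : r ^ 3 = n)
    (hL1 : 1 ≤ L) (hLn : L ≤ n) (hkL : (k : ℝ) = r * 2 ^ L) (hε0 : 0 < ε)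
    (hε : ε ^ 3 = L / n) : minimaxRisk n k (Fk k) ≤ 1000 * ε := by
  have hn' : (0 : ℝ) < n := by exact_mod_cast hn
  have hε1 : ε ≤ 1 := by
    apply le_of_pow_le_pow_left₀ (n := 3) (by norm_num) (by norm_num)
    rw [hε, one_pow]; exact (div_le_one hn').2 hLn
  obtain ⟨W, hWd⟩ : ∃ W, W = ⌈1 / ε⌉₊ := ⟨_, rfl⟩
  have hWl : 1 / ε ≤ W := by rw [hWd]; exact Nat.le_ceil _
  have h1ε : 1 ≤ 1 / ε := by rw [le_div_iff₀ hε0]; linarith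
  have hWu : (W : ℝ) ≤ 2 / ε := by
    have : (W : ℝ) < 1 / ε + 1 := by rw [hWd]; exact Nat.ceil_lt_add_one (by positivity)
    have e : 2 / ε = 1 / ε + 1 / ε := by ring
    linarith
  have hW0 : (0 : ℝ) < W := by linarith
  have hW : 0 < W := by exact_mod_cast hW0
  obtain ⟨i, hi⟩ : ∃ i, i = ⌈2 * L⌉₊ := ⟨_, rfl⟩
  have hil : 2 * L ≤ i := by rw [hi]; exact Nat.le_ceil _
  have hiu : (i : ℝ) ≤ 2 * L + 1 := by rw [hi]; exact (Nat.ceil_lt_add_one (by linarith)).le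
  have hkW : k ≤ W * 2 ^ i := by
    have her : ε * r ≤ L := by
      apply le_of_pow_le_pow_left₀ (n := 3) (by norm_num) (by linarith)
      rw [mul_pow, hε, hr, div_mul_cancel₀ _ hn'.ne']
      nlinarith [mul_nonneg (show 0 ≤ L - 1 by linarith) (show 0 ≤ L by linarith)]
    have hL2 : L ≤ 2 ^ L := by
      have := one_add_mul_self_le_rpow_one_add (s := 1) (by norm_num) hL1
      norm_num at this
      linarith
    have h3 : ε * k ≤ 2 ^ i := by
      rw [hkL]
      calc ε * (r * 2 ^ L) = (ε * r) * 2 ^ L := by ring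
        _ ≤ 2 ^ L * 2 ^ L := by gcongr; linarith
        _ = 2 ^ (2 * L) := by rw [← Real.rpow_add (by norm_num)]; congr 1; ring
        _ ≤ 2 ^ (i : ℝ) := Real.rpow_le_rpow_of_exponent_le (by norm_num) hil
        _ = _ := Real.rpow_natCast _ _
    have : (k : ℝ) ≤ W * 2 ^ i := by
      calc (k : ℝ) = 1 / ε * (ε * k) := by field_simp
        _ ≤ W * 2 ^ i := by gcongr
    exact_mod_cast this
  have := upper (n := n) (k := k) (M := W * (i + 1)) hn (SU_strict W) rfl
    (β := 1 / W) (by positivity)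
    (by
      intro j
      simp only [SU]
      push_cast
      have : ((SU W j / W : ℕ) : ℝ) ≤ SU W j / W := Nat.cast_div_le
      rw [one_div_mul_eq_div]; linarith)
    (by have := SU_growth W hW i; omega)
  have hβ : 1 / (W : ℝ) ≤ ε := by
    rw [div_le_iff₀ hW0]
    rw [div_le_iff₀ hε0] at hWl; linarith
  have hM : √(((W * (i + 1) : ℕ) : ℝ) / n) ≤ 3 * ε := by
    rw [Real.sqrt_le_left (by positivity)]
    push_cast
    calc (W : ℝ) * (i + 1) / n ≤ 2 / ε * (4 * L) / n := by gcongr; linarith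
      _ = 8 / ε * (L / n) := by ring
      _ = 8 * ε ^ 2 := by rw [← hε]; field_simp
      _ ≤ _ := by nlinarith [sq_nonneg ε]
  linarith

end MR

/-- **Theorem 2.1**: there is a universal constant `C ≥ 1` such that for all
sufficiently large `n` (with threshold not depending on `k`) and all `k ≥ 2`,
`f(n,k)/C ≤ R_n(F_k) ≤ C f(n,k)`. -/
theorem stmt0 :
    ∃ C : ℝ, 1 ≤ C ∧ ∃ N : ℕ, ∀ n : ℕ, N ≤ n → ∀ k : ℕ, 2 ≤ k →
      rateF n k / C ≤ minimaxRisk n k (Fk k) ∧ minimaxRisk n k (Fk k) ≤ C * rateF n k := by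

  refine ⟨1000, by norm_num, 8, ?_⟩
  intro n hn k hk
  have hn0 : 0 < n := by omega
  have hn' : (0 : ℝ) < n := by exact_mod_cast hn0
  have hn8 : (8 : ℝ) ≤ n := by exact_mod_cast hn
  unfold rateF
  obtain ⟨r, hrd⟩ : ∃ r : ℝ, r = (n : ℝ) ^ ((1 : ℝ) / 3) := ⟨_, rfl⟩
  rw [← hrd]
  have hr0 : 0 < r := by rw [hrd]; positivity
  have hr : r ^ 3 = n := by
    rw [hrd, ← Real.rpow_natCast, ← Real.rpow_mul hn'.le]; norm_num
  have hr2 : 2 ≤ r := by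
    apply le_of_pow_le_pow_left₀ (n := 3) (by norm_num) hr0.le
    rw [hr]; linarith
  split_ifs with h1 h2
  · exact MR.regime1 hn0 hk hr0.le hr h1
  · push Not at h1
    have hkr : 2 ≤ (k : ℝ) / r := by rw [le_div_iff₀ hr0]; exact h1
    have hkr' : (k : ℝ) / r < 2 ^ n := by rw [div_lt_iff₀ hr0]; linarith
    set L := Real.logb 2 ((k : ℝ) / r) with hL
    have hL1 : 1 ≤ L := by
      rw [hL, Real.le_logb_iff_rpow_le (by norm_num) (by linarith)]; simpa using hkr
    have hLn : L ≤ n := by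
      rw [hL, Real.logb_le_iff_le_rpow (by norm_num) (by linarith), Real.rpow_natCast]
      exact hkr'.le
    have h2L : (k : ℝ) = r * 2 ^ L := by
      rw [hL, Real.rpow_logb (by norm_num) (by norm_num) (by linarith)]; field_simp
    have hLn0 : 0 < L / n := by positivity
    have hε0 : 0 < (L / n) ^ ((1 : ℝ) / 3) := by positivity
    have hε : ((L / n) ^ ((1 : ℝ) / 3)) ^ 3 = L / n := by
      rw [← Real.rpow_natCast, ← Real.rpow_mul hLn0.le]; norm_num
    exact ⟨MR.regime2_lower hn0 hr0 hr hL1 hLn h2L hε0 hε,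
      MR.regime2_upper hn0 hr0 hr hL1 hLn h2L hε0 hε⟩
  · push Not at h2
    exact MR.regime3 hn0 hr2 h2
end

section
/- Let g(n,k) = sqrt(k/n) if 2 ≤ k < 3 n^{1/5}; g(n,k) = (log₃(k/n^{1/5})/n)^{2/5} if 3 n^{1/5} ≤ k < n^{1/5} 3^n; and g(n,k) = 1 if k ≥ n^{1/5} 3^n. There exists a universal constant C ≥ 1 such that for all sufficiently large n (with threshold not depending on k) and all integers k ≥ 2, one has g(n,k)/C ≤ R_n(G_k) ≤ C · g(n,k). -/
open Finset

/-- The class `G_k` of non-increasing convex probability densities on `{1, …, k}`,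
represented as functions `ℕ → ℝ` vanishing outside of `{1, …, k}`. -/
def Gk (k : ℕ) : Set (ℕ → ℝ) :=
  {f | (∀ x, 0 ≤ f x) ∧ (∀ x, x ∉ Finset.Icc 1 k → f x = 0) ∧
    (∑ x ∈ Finset.Icc 1 k, f x = 1) ∧
    (∀ x, 1 ≤ x → x + 1 ≤ k → f (x + 1) ≤ f x) ∧
    (∀ x, 1 ≤ x → x + 2 ≤ k → 0 ≤ f x - 2 * f (x + 1) + f (x + 2))}

open scoped Classical in
/-- The rate function `g(n,k)` of Theorem 2.2: `√(k/n)` for `2 ≤ k < 3 n^{1/5}`,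
`(log₃(k / n^{1/5}) / n)^{2/5}` for `3 n^{1/5} ≤ k < n^{1/5} 3^n`, and `1` for
`k ≥ n^{1/5} 3^n`. -/
noncomputable def rateG (n k : ℕ) : ℝ :=
  if (k : ℝ) < 3 * (n : ℝ) ^ ((1 : ℝ) / 5) then Real.sqrt ((k : ℝ) / n)
  else if (k : ℝ) < (n : ℝ) ^ ((1 : ℝ) / 5) * 3 ^ n then
    (Real.logb 3 ((k : ℝ) / (n : ℝ) ^ ((1 : ℝ) / 5)) / n) ^ ((2 : ℝ) / 5)
  else 1



lemma expE_prod (n : ℕ) (S : Finset ℕ) (g : Fin n → ℕ → ℝ) :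
    ∑ x ∈ Fintype.piFinset (fun _ : Fin n => S), ∏ i, g i (x i) = ∏ i, ∑ y ∈ S, g i y :=
  (Finset.prod_univ_sum (fun _ : Fin n => S) g).symm

lemma expE_one (n : ℕ) (S : Finset ℕ) (f : ℕ → ℝ) (hf : ∑ y ∈ S, f y = 1) :
    ∑ x ∈ Fintype.piFinset (fun _ : Fin n => S), ∏ i, f (x i) = 1 := by
  rw [expE_prod n S (fun _ => f)]; simp [hf]

lemma expE_pair (n : ℕ) (S : Finset ℕ) (f u : ℕ → ℝ) (hf : ∑ y ∈ S, f y = 1)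
    (hu : ∑ y ∈ S, f y * u y = 0) (i j : Fin n) :
    ∑ x ∈ Fintype.piFinset (fun _ : Fin n => S), (∏ l, f (x l)) * (u (x i) * u (x j))
      = if i = j then ∑ y ∈ S, f y * u y ^ 2 else 0 := by
  have h1 : ∀ x : Fin n → ℕ, (∏ l, f (x l)) * (u (x i) * u (x j)) =
      ∏ l, (fun l y => f y * ((if l = i then u y else 1) * (if l = j then u y else 1))) l (x l) := by
    intro x
    simp only [Finset.prod_mul_distrib]
    simp
  simp_rw [h1]
  rw [expE_prod n S (fun l y => f y * ((if l = i then u y else 1) * (if l = j then u y else 1)))]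
  split_ifs with hij
  · subst hij
    rw [Finset.prod_eq_single i]
    · simp [sq]
    · intro b _ hb; simp [hb, hf]
    · simp
  · apply Finset.prod_eq_zero (Finset.mem_univ i)
    simp [hij, hu]

lemma expE_var (n : ℕ) (S : Finset ℕ) (f u : ℕ → ℝ) (hf : ∑ y ∈ S, f y = 1)
    (hu : ∑ y ∈ S, f y * u y = 0) :
    ∑ x ∈ Fintype.piFinset (fun _ : Fin n => S), (∏ l, f (x l)) * (∑ i, u (x i)) ^ 2
      = n * ∑ y ∈ S, f y * u y ^ 2 := by
  have : ∀ x : Fin n → ℕ, (∏ l, f (x l)) * (∑ i, u (x i)) ^ 2 =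
      ∑ i, ∑ j, (∏ l, f (x l)) * (u (x i) * u (x j)) := by
    intro x
    rw [sq, Finset.sum_mul_sum, Finset.mul_sum]
    simp_rw [Finset.mul_sum]
  simp_rw [this]
  rw [Finset.sum_comm]
  have : ∀ i : Fin n, ∑ x ∈ Fintype.piFinset (fun _ : Fin n => S),
      ∑ j, (∏ l, f (x l)) * (u (x i) * u (x j)) = ∑ y ∈ S, f y * u y ^ 2 := by
    intro i
    rw [Finset.sum_comm]
    simp_rw [expE_pair n S f u hf hu]
    simp
  simp_rw [this]
  simp

lemma expE_abs (n : ℕ) (S : Finset ℕ) (f u : ℕ → ℝ) (hf0 : ∀ y, 0 ≤ f y)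
    (hf : ∑ y ∈ S, f y = 1)
    (hu : ∑ y ∈ S, f y * u y = 0) :
    ∑ x ∈ Fintype.piFinset (fun _ : Fin n => S), (∏ l, f (x l)) * |∑ i, u (x i)|
      ≤ Real.sqrt (n * ∑ y ∈ S, f y * u y ^ 2) := by
  apply Real.le_sqrt_of_sq_le
  rw [← expE_var n S f u hf hu]
  have h0 : ∀ x : Fin n → ℕ, 0 ≤ ∏ l, f (x l) := fun x => Finset.prod_nonneg fun _ _ => hf0 _
  have := Finset.sum_sq_le_sum_mul_sum_of_sq_le_mul (Fintype.piFinset (fun _ : Fin n => S))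
    (r := fun x => (∏ l, f (x l)) * |∑ i, u (x i)|) (f := fun x => ∏ l, f (x l))
    (g := fun x => (∏ l, f (x l)) * (∑ i, u (x i)) ^ 2) (fun x _ => h0 x)
    (fun x _ => mul_nonneg (h0 x) (sq_nonneg _))
    (fun x _ => by rw [mul_pow, sq_abs]; apply le_of_eq; ring)
  rw [expE_one n S f hf, one_mul] at this
  exact this

/-- empirical density -/
noncomputable def emp (n : ℕ) (x : Fin n → ℕ) (y : ℕ) : ℝ :=
  (∑ i, if x i = y then (1:ℝ) else 0) / n

lemma emp_abs (n : ℕ) (hn : 0 < n) (S A : Finset ℕ) (hA : A ⊆ S) (f : ℕ → ℝ) (hf0 : ∀ y, 0 ≤ f y)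
    (hf : ∑ y ∈ S, f y = 1) :
    ∑ x ∈ Fintype.piFinset (fun _ : Fin n => S), (∏ l, f (x l)) * |∑ y ∈ A, (emp n x y - f y)|
      ≤ Real.sqrt ((∑ y ∈ A, f y) / n) := by
  set p := ∑ y ∈ A, f y with hp
  have hn' : (0:ℝ) < n := by exact_mod_cast hn
  have hfA : ∑ y ∈ S, f y * (if y ∈ A then (1:ℝ) else 0) = p := by
    rw [hp, ← Finset.sum_subset hA (f := fun y => f y * (if y ∈ A then (1:ℝ) else 0))]
    · exact Finset.sum_congr rfl fun y hy => by simp [hy]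
    · intro y _ hy; simp [hy]
  have hu : ∑ y ∈ S, f y * ((if y ∈ A then (1:ℝ) else 0) - p) = 0 := by
    simp_rw [mul_sub]
    rw [Finset.sum_sub_distrib, hfA, ← Finset.sum_mul, hf]; ring
  have key := expE_abs n S f (fun y => (if y ∈ A then (1:ℝ) else 0) - p) hf0 hf hu
  have hs : ∑ y ∈ S, f y * ((if y ∈ A then (1:ℝ) else 0) - p) ^ 2 = p - p ^ 2 := by
    have : ∀ y, f y * ((if y ∈ A then (1:ℝ) else 0) - p) ^ 2 =
      f y * (if y ∈ A then (1:ℝ) else 0) * (1 - 2 * p) + f y * p ^ 2 := by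
      intro y; split_ifs <;> ring
    simp_rw [this]
    rw [Finset.sum_add_distrib, ← Finset.sum_mul, ← Finset.sum_mul, hfA, hf]; ring
  rw [hs] at key
  have hx : ∀ x : Fin n → ℕ, |∑ y ∈ A, (emp n x y - f y)| =
      |∑ i, ((if x i ∈ A then (1:ℝ) else 0) - p)| / n := by
    intro x
    rw [Finset.sum_sub_distrib, ← hp]
    have : ∑ y ∈ A, emp n x y = (∑ i, if x i ∈ A then (1:ℝ) else 0) / n := by
      unfold emp
      rw [← Finset.sum_div, Finset.sum_comm]
      congr 1
      apply Finset.sum_congr rfl; intro i _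
      simp
    rw [this, Finset.sum_sub_distrib, ← abs_of_pos hn', ← abs_div, abs_of_pos hn']
    congr 1
    simp only [Finset.sum_const, Finset.card_univ, Fintype.card_fin, nsmul_eq_mul]
    field_simp
  simp_rw [hx, ← mul_div_assoc]
  rw [← Finset.sum_div, div_le_iff₀ hn']
  refine key.trans ?_
  have h3 : Real.sqrt (p / n) * n = Real.sqrt (n * p) := by
    have : (n:ℝ) * p = p / n * (n:ℝ) ^ 2 := by field_simp
    rw [this, Real.sqrt_mul' _ (by positivity), Real.sqrt_sq hn'.le]
  rw [h3]
  apply Real.sqrt_le_sqrt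
  nlinarith [sq_nonneg p]

lemma risk_bdd (n k : ℕ) (φ : (Fin n → ℕ) → ℕ → ℝ) :
    BddAbove (Set.range fun f : ℕ → ℝ => ⨆ (_ : f ∈ Gk k),
      ∑ x ∈ Fintype.piFinset (fun _ : Fin n => Finset.Icc 1 k),
    (∏ i, f (x i)) * TVk k (φ x) f) := by
  refine ⟨∑ x ∈ Fintype.piFinset (fun _ : Fin n => Finset.Icc 1 k),
    (∑ y ∈ Finset.Icc 1 k, |φ x y| + 1) / 2, ?_⟩
  rintro _ ⟨f, rfl⟩
  have hnn : 0 ≤ ∑ x ∈ Fintype.piFinset (fun _ : Fin n => Finset.Icc 1 k),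
    (∑ y ∈ Finset.Icc 1 k, |φ x y| + 1) / 2 := by positivity
  apply Real.iSup_le _ hnn
  rintro ⟨h0, hz, h1, -, -⟩
  apply Finset.sum_le_sum
  intro x hx
  have hle : ∀ y, f y ≤ 1 := by
    intro y
    by_cases hy : y ∈ Finset.Icc 1 k
    · rw [← h1]; exact Finset.single_le_sum (fun z _ => h0 z) hy
    · rw [hz y hy]; norm_num
  have hp : ∏ i, f (x i) ≤ 1 := Finset.prod_le_one (fun _ _ => h0 _) (fun _ _ => hle _)
  have ht : TVk k (φ x) f ≤ (∑ y ∈ Finset.Icc 1 k, |φ x y| + 1) / 2 := by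
    unfold TVk
    gcongr
    rw [← h1, ← Finset.sum_add_distrib]
    apply Finset.sum_le_sum
    intro y _
    refine (abs_sub _ _).trans ?_
    rw [abs_of_nonneg (h0 y)]
  have ht0 : 0 ≤ TVk k (φ x) f := by unfold TVk; positivity
  nlinarith

lemma le_risk (n k : ℕ) (φ : (Fin n → ℕ) → ℕ → ℝ) (f : ℕ → ℝ) (hf : f ∈ Gk k) :
    ∑ x ∈ Fintype.piFinset (fun _ : Fin n => Finset.Icc 1 k),
      (∏ i, f (x i)) * TVk k (φ x) f ≤ risk n k φ (Gk k) := by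
  have := le_ciSup (risk_bdd n k φ) f
  simp only [ciSup_pos hf] at this
  exact this

lemma le_minimax (n k : ℕ) (c : ℝ) (h : ∀ φ, c ≤ risk n k φ (Gk k)) :
    c ≤ minimaxRisk n k (Gk k) := le_ciInf h

lemma minimax_le (n k : ℕ) (c : ℝ) (hc : 0 ≤ c) (φ : (Fin n → ℕ) → ℕ → ℝ)
    (h : ∀ f ∈ Gk k, ∑ x ∈ Fintype.piFinset (fun _ : Fin n => Finset.Icc 1 k),
      (∏ i, f (x i)) * TVk k (φ x) f ≤ c) :
    minimaxRisk n k (Gk k) ≤ c := by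
  unfold minimaxRisk
  have hb : BddBelow (Set.range fun φ : (Fin n → ℕ) → ℕ → ℝ => risk n k φ (Gk k)) := by
    refine ⟨0, ?_⟩
    rintro _ ⟨φ, rfl⟩
    apply Real.iSup_nonneg
    intro f
    apply Real.iSup_nonneg
    rintro ⟨h0, -⟩
    apply Finset.sum_nonneg; intro x _
    apply mul_nonneg (Finset.prod_nonneg fun _ _ => h0 _)
    unfold TVk; positivity
  refine (ciInf_le hb φ).trans ?_
  apply Real.iSup_le _ hc
  intro f
  apply Real.iSup_le _ hc
  exact h f


lemma affinity (n : ℕ) (hn : 0 < n) (S : Finset ℕ) (f g : ℕ → ℝ) (hf0 : ∀ y, 0 ≤ f y)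
    (hg0 : ∀ y, 0 ≤ g y) (hf : ∑ y ∈ S, f y = 1) (hg : ∑ y ∈ S, g y = 1)
    (h : ∑ y ∈ S, (Real.sqrt (f y) - Real.sqrt (g y)) ^ 2 ≤ 1 / (2 * n)) :
    1 / 4 ≤ ∑ x ∈ Fintype.piFinset (fun _ : Fin n => S), min (∏ i, f (x i)) (∏ i, g (x i)) := by
  have hn' : (0:ℝ) < n := by exact_mod_cast hn
  set ρ := ∑ y ∈ S, Real.sqrt (f y) * Real.sqrt (g y) with hρ
  have h1 : ∑ y ∈ S, (Real.sqrt (f y) - Real.sqrt (g y)) ^ 2 = 2 - 2 * ρ := by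
    have : ∀ y, (Real.sqrt (f y) - Real.sqrt (g y)) ^ 2 =
        f y + g y - 2 * (Real.sqrt (f y) * Real.sqrt (g y)) := by
      intro y
      have a := Real.sq_sqrt (hf0 y); have b := Real.sq_sqrt (hg0 y)
      nlinarith
    simp_rw [this]
    rw [Finset.sum_sub_distrib, Finset.sum_add_distrib, hf, hg, ← Finset.mul_sum]; ring
  have hρ1 : 1 - 1 / (4 * n) ≤ ρ := by
    rw [h1] at h
    have : (1:ℝ) / (2 * n) = 2 * (1 / (4 * n)) := by field_simp; norm_num
    linarith
  have hq : (1:ℝ) / (4 * n) ≤ 1 := by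
    rw [div_le_one (by positivity)]
    have : (1:ℝ) ≤ n := by exact_mod_cast hn
    linarith
  have hpow : (3:ℝ) / 4 ≤ ρ ^ n := by
    have b := one_add_mul_le_pow (a := -(1 / (4 * (n:ℝ)))) (by linarith) n
    have c : (1 + -(1 / (4 * (n:ℝ)))) ^ n ≤ ρ ^ n := by
      apply pow_le_pow_left₀ <;> linarith
    have d : 1 + (n:ℝ) * -(1 / (4 * (n:ℝ))) = 3 / 4 := by field_simp; norm_num
    linarith
  have hprod : ∑ x ∈ Fintype.piFinset (fun _ : Fin n => S),
      Real.sqrt ((∏ i, f (x i)) * (∏ i, g (x i))) = ρ ^ n := by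
    have : ∀ x : Fin n → ℕ, Real.sqrt ((∏ i, f (x i)) * (∏ i, g (x i))) =
        ∏ i, (Real.sqrt (f (x i)) * Real.sqrt (g (x i))) := by
      intro x
      rw [← Finset.prod_mul_distrib, Real.sqrt_eq_iff_mul_self_eq]
      · rw [← Finset.prod_mul_distrib]
        apply Finset.prod_congr rfl
        intro i _
        have a := Real.mul_self_sqrt (hf0 (x i)); have b := Real.mul_self_sqrt (hg0 (x i))
        rw [mul_mul_mul_comm, a, b]
      · exact Finset.prod_nonneg fun i _ => mul_nonneg (hf0 _) (hg0 _)
      · exact Finset.prod_nonneg fun i _ => by positivity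
    simp_rw [this]
    rw [expE_prod n S (fun _ y => Real.sqrt (f y) * Real.sqrt (g y))]
    simp [hρ]
  have hF0 : ∀ x : Fin n → ℕ, 0 ≤ ∏ l, f (x l) := fun x => Finset.prod_nonneg fun _ _ => hf0 _
  have hG0 : ∀ x : Fin n → ℕ, 0 ≤ ∏ l, g (x l) := fun x => Finset.prod_nonneg fun _ _ => hg0 _
  have cs := Finset.sum_sq_le_sum_mul_sum_of_sq_le_mul (Fintype.piFinset (fun _ : Fin n => S))
    (r := fun x => Real.sqrt ((∏ i, f (x i)) * (∏ i, g (x i))))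
    (f := fun x => min (∏ i, f (x i)) (∏ i, g (x i)))
    (g := fun x => max (∏ i, f (x i)) (∏ i, g (x i)))
    (fun x _ => le_min (hF0 x) (hG0 x)) (fun x _ => le_max_of_le_left (hF0 x))
    (fun x _ => by rw [Real.sq_sqrt (mul_nonneg (hF0 x) (hG0 x)), min_mul_max])
  have hmax : ∑ x ∈ Fintype.piFinset (fun _ : Fin n => S), max (∏ i, f (x i)) (∏ i, g (x i)) ≤ 2 := by
    have : ∑ x ∈ Fintype.piFinset (fun _ : Fin n => S), (∏ i, f (x i) + ∏ i, g (x i)) = 2 := by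
      rw [Finset.sum_add_distrib, expE_one n S f hf, expE_one n S g hg]; norm_num
    rw [← this]
    apply Finset.sum_le_sum
    intro x _
    exact max_le (by linarith [hG0 x]) (by linarith [hF0 x])
  rw [hprod] at cs
  have hmin : 0 ≤ ∑ x ∈ Fintype.piFinset (fun _ : Fin n => S), min (∏ i, f (x i)) (∏ i, g (x i)) :=
    Finset.sum_nonneg fun x _ => le_min (hF0 x) (hG0 x)
  nlinarith

/-- flip coordinate `j` -/
def flipB {J : Type} [DecidableEq J] (j : J) (θ : J → Bool) : J → Bool :=
  Function.update θ j (!θ j)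

lemma flipB_inv {J : Type} [DecidableEq J] (j : J) : Function.Involutive (flipB j) := by
  intro θ
  funext i
  by_cases h : i = j
  · subst h; simp [flipB]
  · simp [flipB, h]

lemma assouad {J : Type} [Fintype J] [DecidableEq J] (n k : ℕ) (hn : 0 < n)
    (F : (J → Bool) → ℕ → ℝ) (hF : ∀ θ, F θ ∈ Gk k) (I : J → Finset ℕ)
    (hI : ∀ j, I j ⊆ Finset.Icc 1 k) (hdisj : ∀ i j, i ≠ j → Disjoint (I i) (I j))
    (τ : ℝ) (hτ : ∀ θ j, τ ≤ ∑ y ∈ I j, |F θ y - F (flipB j θ) y|)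
    (hτ0 : 0 ≤ τ)
    (hchi : ∀ θ j, ∑ y ∈ Finset.Icc 1 k, (Real.sqrt (F θ y) - Real.sqrt (F (flipB j θ) y)) ^ 2
      ≤ 1 / (2 * n)) :
    Fintype.card J * τ / 16 ≤ minimaxRisk n k (Gk k) := by
  apply le_minimax
  intro φ
  set r := risk n k φ (Gk k) with hr
  set P : (J → Bool) → (Fin n → ℕ) → ℝ := fun θ x => ∏ i, F θ (x i) with hP
  have hP0 : ∀ θ x, 0 ≤ P θ x := fun θ x => Finset.prod_nonneg fun _ _ => (hF θ).1 _
  set d : J → (J → Bool) → (Fin n → ℕ) → ℝ := fun j θ x => ∑ y ∈ I j, |φ x y - F θ y| with hd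
  have hd0 : ∀ j θ x, 0 ≤ d j θ x := fun j θ x => Finset.sum_nonneg fun _ _ => abs_nonneg _
  set X := Fintype.piFinset (fun _ : Fin n => Finset.Icc 1 k) with hX
  have h1 : ∀ θ, ∑ j, (∑ x ∈ X, P θ x * d j θ x) ≤ 2 * r := by
    intro θ
    have a := le_risk n k φ (F θ) (hF θ)
    rw [← hr, ← hX] at a
    have b : ∑ j, (∑ x ∈ X, P θ x * d j θ x) ≤ ∑ x ∈ X, P θ x * (2 * TVk k (φ x) (F θ)) := by
      rw [Finset.sum_comm]
      apply Finset.sum_le_sum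
      intro x _
      rw [← Finset.mul_sum]
      apply mul_le_mul_of_nonneg_left _ (hP0 θ x)
      unfold TVk
      rw [mul_div_cancel₀ _ (two_ne_zero)]
      rw [hd]
      simp only
      rw [← Finset.sum_biUnion (fun i _ j _ hij => hdisj i j hij)]
      apply Finset.sum_le_sum_of_subset_of_nonneg
      · intro y hy
        simp only [Finset.mem_biUnion] at hy
        obtain ⟨j, _, hj⟩ := hy
        exact hI j hj
      · intros; positivity
    have c : ∑ x ∈ X, P θ x * (2 * TVk k (φ x) (F θ)) =
        2 * ∑ x ∈ X, (∏ i, F θ (x i)) * TVk k (φ x) (F θ) := by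
      rw [Finset.mul_sum]
      exact Finset.sum_congr rfl fun x _ => by rw [hP]; ring
    linarith
  have h2 : ∀ j θ, τ / 4 ≤ (∑ x ∈ X, P θ x * d j θ x) +
      ∑ x ∈ X, P (flipB j θ) x * d j (flipB j θ) x := by
    intro j θ
    have haf := affinity n hn (Finset.Icc 1 k) (F θ) (F (flipB j θ)) (hF θ).1 (hF _).1 (hF θ).2.2.1
      (hF _).2.2.1 (hchi θ j)
    rw [← Finset.sum_add_distrib]
    calc τ / 4 ≤ (∑ x ∈ X, min (P θ x) (P (flipB j θ) x)) * τ := by nlinarith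
      _ = ∑ x ∈ X, min (P θ x) (P (flipB j θ) x) * τ := by rw [Finset.sum_mul]
      _ ≤ _ := by
        apply Finset.sum_le_sum
        intro x _
        have e : τ ≤ d j θ x + d j (flipB j θ) x := by
          refine (hτ θ j).trans ?_
          rw [hd]
          simp only
          rw [← Finset.sum_add_distrib]
          apply Finset.sum_le_sum
          intro y _
          rw [abs_sub_comm (φ x y) (F θ y)]
          exact abs_sub_le _ _ _
        have m1 := min_le_left (P θ x) (P (flipB j θ) x)
        have m2 := min_le_right (P θ x) (P (flipB j θ) x)
        have m0 : 0 ≤ min (P θ x) (P (flipB j θ) x) := le_min (hP0 _ _) (hP0 _ _)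
        have := hd0 j θ x
        have := hd0 j (flipB j θ) x
        nlinarith
  have h3 : ∀ j, (Fintype.card (J → Bool) : ℝ) * (τ / 4) ≤
      2 * ∑ θ, ∑ x ∈ X, P θ x * d j θ x := by
    intro j
    have e := Equiv.sum_comp (flipB_inv j).toPerm (fun θ => ∑ x ∈ X, P θ x * d j θ x)
    simp only [Function.Involutive.coe_toPerm] at e
    have : ∑ θ : J → Bool, τ / 4 ≤ ∑ θ, ((∑ x ∈ X, P θ x * d j θ x) +
      ∑ x ∈ X, P (flipB j θ) x * d j (flipB j θ) x) := Finset.sum_le_sum fun θ _ => h2 j θ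
    rw [Finset.sum_add_distrib, e] at this
    simp only [Finset.sum_const, Finset.card_univ, nsmul_eq_mul] at this
    linarith
  have h4 : ∑ θ, ∑ j, (∑ x ∈ X, P θ x * d j θ x) ≤ (Fintype.card (J → Bool) : ℝ) * (2 * r) := by
    have := Finset.sum_le_sum (s := Finset.univ) fun θ (_ : θ ∈ Finset.univ) => h1 θ
    simpa using this
  rw [Finset.sum_comm] at h4
  have h5 : (Fintype.card J : ℝ) * ((Fintype.card (J → Bool) : ℝ) * (τ / 4)) ≤
      2 * ∑ j, ∑ θ, ∑ x ∈ X, P θ x * d j θ x := by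
    have := Finset.sum_le_sum (s := Finset.univ) fun j (_ : j ∈ Finset.univ) => h3 j
    rw [Finset.sum_const, Finset.card_univ, nsmul_eq_mul, ← Finset.mul_sum] at this
    exact this
  have hc : (0:ℝ) < Fintype.card (J → Bool) := by exact_mod_cast Fintype.card_pos
  have h6 : (Fintype.card (J → Bool) : ℝ) * (Fintype.card J * (τ / 4)) ≤
    (Fintype.card (J → Bool) : ℝ) * (4 * r) := by linarith
  have := le_of_mul_le_mul_left h6 hc
  linarith


lemma sqrt_diff (f g q : ℝ) (hq : 0 < q) (hf : q ≤ f) (hg : 0 ≤ g) :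
    (Real.sqrt f - Real.sqrt g) ^ 2 ≤ (f - g) ^ 2 / q := by
  rw [le_div_iff₀ hq]
  have hf0 : 0 ≤ f := hq.le.trans hf
  have a := Real.sq_sqrt hf0
  have b := Real.sq_sqrt hg
  have c := Real.sqrt_nonneg f
  have d := Real.sqrt_nonneg g
  set s := Real.sqrt f
  set t := Real.sqrt g
  have e : (f - g) ^ 2 = (s - t) ^ 2 * (s + t) ^ 2 := by rw [← a, ← b]; ring
  rw [e]
  apply mul_le_mul_of_nonneg_left _ (sq_nonneg _)
  nlinarith [mul_nonneg c d, sq_nonneg t]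

def Cone (k : ℕ) (g : ℕ → ℝ) : Prop :=
  (∀ x, 0 ≤ g x) ∧ (∀ x, k < x → g x = 0) ∧ (∀ x, g (x + 1) ≤ g x) ∧
    (∀ x, 0 ≤ g x - 2 * g (x + 1) + g (x + 2))

lemma Cone.add {k : ℕ} {g h : ℕ → ℝ} (hg : Cone k g) (hh : Cone k h) :
    Cone k (fun x => g x + h x) := by
  obtain ⟨a, b, c, d⟩ := hg
  obtain ⟨a', b', c', d'⟩ := hh
  refine ⟨fun x => add_nonneg (a x) (a' x), fun x hx => ?_, fun x => add_le_add (c x) (c' x), ?_⟩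
  · simp [b x hx, b' x hx]
  · intro x
    have := d x; have := d' x
    linarith

lemma Cone.smul {k : ℕ} {g : ℕ → ℝ} (r : ℝ) (hr : 0 ≤ r) (hg : Cone k g) :
    Cone k (fun x => r * g x) := by
  obtain ⟨a, b, c, d⟩ := hg
  refine ⟨fun x => mul_nonneg hr (a x), fun x hx => ?_,
    fun x => mul_le_mul_of_nonneg_left (c x) hr, ?_⟩
  · simp [b x hx]
  · intro x
    have := mul_nonneg hr (d x)
    linarith

lemma Cone.sum {k : ℕ} {J : Type} (s : Finset J) (g : J → ℕ → ℝ) (hg : ∀ j, Cone k (g j)) :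
    Cone k (fun x => ∑ j ∈ s, g j x) := by
  classical
  induction s using Finset.induction_on with
  | empty => simp [Cone]
  | insert j s hj ih =>
    simp_rw [Finset.sum_insert hj]
    exact (hg j).add ih

/-- hinge function -/
def hinge (t x : ℕ) : ℝ := ((t - x : ℕ) : ℝ)

lemma hinge_of_le {t x : ℕ} (h : x ≤ t) : hinge t x = (t : ℝ) - x := by
  unfold hinge; push_cast [h]; ring

lemma hinge_of_ge {t x : ℕ} (h : t ≤ x) : hinge t x = 0 := by
  unfold hinge; simp [h]

lemma hinge_cone (k t : ℕ) (ht : t ≤ k + 1) : Cone k (hinge t) := by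
  refine ⟨fun x => by unfold hinge; positivity, fun x hx => hinge_of_ge (by omega), ?_, ?_⟩
  · intro x
    unfold hinge
    exact_mod_cast (by omega : t - (x+1) ≤ t - x)
  · intro x
    have : 2 * (t - (x+1)) ≤ (t - x) + (t - (x+2)) := by omega
    have h2 : 2 * ((t - (x+1) : ℕ) : ℝ) ≤ ((t - x : ℕ) : ℝ) + ((t - (x+2) : ℕ) : ℝ) := by
      exact_mod_cast this
    unfold hinge
    linarith

lemma hinge_sum (k t : ℕ) (ht1 : 1 ≤ t) (ht : t ≤ k + 1) :
    ∑ x ∈ Finset.Icc 1 k, hinge t x = (t : ℝ) * (t - 1) / 2 := by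
  obtain ⟨s, rfl⟩ : ∃ s, t = s + 1 := ⟨t - 1, by omega⟩
  have hs : s ≤ k := by omega
  have : ∑ x ∈ Finset.Icc 1 k, hinge (s+1) x = ∑ x ∈ Finset.Icc 1 s, hinge (s+1) x := by
    symm
    apply Finset.sum_subset (Finset.Icc_subset_Icc_right hs)
    intro x hx hx'
    apply hinge_of_ge
    simp only [Finset.mem_Icc] at hx hx'
    omega
  rw [this]
  clear this ht hs ht1
  induction s with
  | zero => simp
  | succ s ih =>
    rw [Finset.sum_Icc_succ_top (by omega)]
    have : ∀ x ∈ Finset.Icc 1 s, hinge (s + 1 + 1) x = hinge (s+1) x + 1 := by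
      intro x hx
      simp only [Finset.mem_Icc] at hx
      rw [hinge_of_le (by omega), hinge_of_le (by omega)]
      push_cast; ring
    rw [Finset.sum_congr rfl this, Finset.sum_add_distrib, ih, hinge_of_le (by omega)]
    simp
    ring

lemma cone_mem (k : ℕ) (g : ℕ → ℝ) (hg : Cone k g) (h1 : ∑ x ∈ Finset.Icc 1 k, g x = 1) :
    (fun x => if x ∈ Finset.Icc 1 k then g x else 0) ∈ Gk k := by
  obtain ⟨a, b, c, d⟩ := hg
  refine ⟨?_, ?_, ?_, ?_, ?_⟩
  · intro x; dsimp only; split_ifs; exacts [a x, le_rfl]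
  · intro x hx; simp only [hx, if_false]
  · rw [← h1]; exact Finset.sum_congr rfl fun x hx => by simp only [hx, if_true]
  · intro x h h'
    have e1 : x ∈ Finset.Icc 1 k := by simp; omega
    have e2 : x + 1 ∈ Finset.Icc 1 k := by simp; omega
    simp only [e1, e2, if_true]; exact c x
  · intro x h h'
    have e1 : x ∈ Finset.Icc 1 k := by simp; omega
    have e2 : x + 1 ∈ Finset.Icc 1 k := by simp; omega
    have e3 : x + 2 ∈ Finset.Icc 1 k := by simp; omega
    simp only [e1, e2, e3, if_true]; exact d x

/-- the two alternatives in a bin -/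
noncomputable def dd (a w : ℕ) (s : Bool) (x : ℕ) : ℝ :=
  if s then hinge a x + 3 * hinge (a + 2 * w) x else 3 * hinge (a + w) x + hinge (a + 3 * w) x

noncomputable def ddS (a w : ℕ) : ℝ := ((a:ℝ) * (a - 1) + 3 * ((a + 2 * w) * (a + 2 * w - 1))) / 2

noncomputable def hh (l : ℝ) (a w : ℕ) (s : Bool) (x : ℕ) : ℝ :=
  (1 + l) / 2 * dd a w s x + (1 - l) / 2 * dd a w (!s) x

lemma dd_cone (k a w : ℕ) (h : a + 3 * w ≤ k + 1) (s : Bool) : Cone k (dd a w s) := by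
  cases s
  · have := ((hinge_cone k (a + w) (by omega)).smul 3 (by norm_num)).add (hinge_cone k (a + 3 * w) h)
    convert this using 1
    funext x; simp [dd]
  · have := (hinge_cone k a (by omega)).add
      ((hinge_cone k (a + 2 * w) (by omega)).smul 3 (by norm_num))
    convert this using 1
    funext x; simp [dd]

lemma dd_sum (k a w : ℕ) (ha : 1 ≤ a) (h : a + 3 * w ≤ k + 1) (s : Bool) :
    ∑ x ∈ Finset.Icc 1 k, dd a w s x = ddS a w := by
  cases s
  · simp only [dd, Bool.false_eq_true, if_false]
    rw [Finset.sum_add_distrib, ← Finset.mul_sum, hinge_sum _ _ (by omega) (by omega),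
      hinge_sum _ _ (by omega) (by omega)]
    unfold ddS; push_cast; ring
  · simp only [dd, if_true]
    rw [Finset.sum_add_distrib, ← Finset.mul_sum, hinge_sum _ _ (by omega) (by omega),
      hinge_sum _ _ (by omega) (by omega)]
    unfold ddS; push_cast; ring

lemma hh_cone (k a w : ℕ) (l : ℝ) (hl0 : 0 ≤ l) (hl1 : l ≤ 1) (h : a + 3 * w ≤ k + 1) (s : Bool) :
    Cone k (hh l a w s) :=
  ((dd_cone k a w h s).smul ((1 + l) / 2) (by linarith)).add
    ((dd_cone k a w h (!s)).smul ((1 - l) / 2) (by linarith))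

lemma hh_sum (k a w : ℕ) (l : ℝ) (ha : 1 ≤ a) (h : a + 3 * w ≤ k + 1) (s : Bool) :
    ∑ x ∈ Finset.Icc 1 k, hh l a w s x = ddS a w := by
  unfold hh
  rw [Finset.sum_add_distrib, ← Finset.mul_sum, ← Finset.mul_sum, dd_sum k a w ha h,
    dd_sum k a w ha h]
  ring

noncomputable def psi (a w x : ℕ) : ℝ := dd a w true x - dd a w false x

lemma hh_diff (l : ℝ) (a w : ℕ) (s : Bool) (x : ℕ) (hl : 0 ≤ l) :
    |hh l a w s x - hh l a w (!s) x| = l * |psi a w x| := by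
  cases s
  · have : hh l a w false x - hh l a w (!false) x = - (l * psi a w x) := by
      simp only [hh, psi, Bool.not_false, Bool.not_true]; ring
    rw [this, abs_neg, abs_mul, abs_of_nonneg hl]
  · have : hh l a w true x - hh l a w (!true) x = l * psi a w x := by
      simp only [hh, psi, Bool.not_false, Bool.not_true]; ring
    rw [this, abs_mul, abs_of_nonneg hl]

lemma psi_zero (a w x : ℕ) (h : x ∉ Finset.Ico a (a + 3 * w)) : psi a w x = 0 := by
  simp only [Finset.mem_Ico, not_and_or, not_le, not_lt] at h
  simp only [psi, dd, if_true, Bool.false_eq_true, if_false]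
  rcases h with h | h
  · rw [hinge_of_le (by omega), hinge_of_le (by omega), hinge_of_le (by omega),
      hinge_of_le (by omega)]
    push_cast; ring
  · rw [hinge_of_ge (by omega), hinge_of_ge (by omega), hinge_of_ge (by omega),
      hinge_of_ge (by omega)]
    ring

lemma psi_le (a w x : ℕ) : |psi a w x| ≤ 6 * w := by
  by_cases h : x ∈ Finset.Ico a (a + 3 * w)
  · simp only [Finset.mem_Ico] at h
    have e : hinge a x = 0 := hinge_of_ge h.1
    have e1 : 0 ≤ hinge (a + w) x ∧ hinge (a + w) x ≤ w := by
      unfold hinge; exact ⟨by positivity, by exact_mod_cast (by omega)⟩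
    have e2 : 0 ≤ hinge (a + 2 * w) x ∧ hinge (a + 2 * w) x ≤ 2 * w := by
      unfold hinge; exact ⟨by positivity, by exact_mod_cast (by omega)⟩
    have e3 : 0 ≤ hinge (a + 3 * w) x ∧ hinge (a + 3 * w) x ≤ 3 * w := by
      unfold hinge; exact ⟨by positivity, by exact_mod_cast (by omega)⟩
    simp only [psi, dd, if_true, Bool.false_eq_true, if_false, e]
    rw [abs_le]
    constructor <;> linarith [e1.1, e1.2, e2.1, e2.2, e3.1, e3.2]
  · rw [psi_zero a w x h]; simp

lemma psi_sum (a w : ℕ) : (w:ℝ) ^ 2 / 2 ≤ ∑ y ∈ Finset.Ico a (a + 3 * w), |psi a w y| := by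
  have h1 : ∑ y ∈ Finset.Ico (a + 2 * w) (a + 3 * w), |psi a w y| ≤
      ∑ y ∈ Finset.Ico a (a + 3 * w), |psi a w y| :=
    Finset.sum_le_sum_of_subset_of_nonneg (Finset.Ico_subset_Ico_left (by omega))
      (fun _ _ _ => abs_nonneg _)
  refine le_trans ?_ h1
  have h2 : ∀ y ∈ Finset.Ico (a + 2 * w) (a + 3 * w), |psi a w y| = (a:ℝ) + 3 * w - y := by
    intro y hy
    simp only [Finset.mem_Ico] at hy
    have : psi a w y = -((a:ℝ) + 3 * w - y) := by
      simp only [psi, dd, if_true, Bool.false_eq_true, if_false]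
      rw [hinge_of_ge (by omega), hinge_of_ge (by omega), hinge_of_ge (by omega),
        hinge_of_le (by omega)]
      push_cast; ring
    rw [this, abs_neg, abs_of_nonneg]
    have : (y:ℝ) ≤ a + 3 * w := by exact_mod_cast hy.2.le
    linarith
  rw [Finset.sum_congr rfl h2, Finset.sum_Ico_eq_sum_range]
  have : a + 3 * w - (a + 2 * w) = w := by omega
  rw [this]
  have h3 : ∀ m : ℕ, ∑ i ∈ Finset.range m, ((a:ℝ) + 3 * w - ((a + 2 * w + i : ℕ) : ℝ)) =
      m * w - m * (m - 1) / 2 := by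
    intro m
    induction m with
    | zero => simp
    | succ m ih => rw [Finset.sum_range_succ, ih]; push_cast; ring
  rw [h3]
  have : (0:ℝ) ≤ w := by positivity
  nlinarith


noncomputable def cc (R B i b : ℕ) : ℝ := 1 / (2 * R * B) / ddS (3 * (B + b) * 2 ^ i) (2 ^ i)

noncomputable def base (R B : ℕ) (x : ℕ) : ℝ :=
  ∑ i ∈ Finset.range R, 1 / (2 * (R:ℝ)) / (((12 * B * 2 ^ i : ℕ) : ℝ) *
    (((12 * B * 2 ^ i : ℕ) : ℝ) - 1) / 2) * hinge (12 * B * 2 ^ i) x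

noncomputable def fam (l : ℝ) (R B : ℕ) (θ : Fin R × Fin B → Bool) (x : ℕ) : ℝ :=
  base R B x + ∑ p : Fin R × Fin B, cc R B p.1 p.2 *
    hh l (3 * (B + p.2) * 2 ^ (p.1 : ℕ)) (2 ^ (p.1 : ℕ)) (θ p) x

section
variable (R B i b : ℕ)

lemma ddS_le (hb : b < B) : ddS (3 * (B + b) * 2 ^ i) (2 ^ i) ≤ 8 * (3 * B * 2 ^ i) ^ 2 := by
  have h1 : (b:ℝ) + 1 ≤ B := by exact_mod_cast hb
  have h2 : (1:ℝ) ≤ 2 ^ i := one_le_pow₀ (by norm_num)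
  have h3 : (0:ℝ) ≤ b := by positivity
  unfold ddS
  push_cast
  set W : ℝ := 2 ^ i
  set a : ℝ := 3 * (B + b) * W with ha
  set T : ℝ := 3 * B * W with hT
  have e0 : 0 ≤ a := by positivity
  have e1 : a + 3 * W ≤ 2 * T := by rw [ha, hT]; nlinarith
  nlinarith

lemma le_ddS (hb : b < B) : (3 * B * 2 ^ i : ℝ) ^ 2 ≤ ddS (3 * (B + b) * 2 ^ i) (2 ^ i) := by
  have h1 : (b:ℝ) + 1 ≤ B := by exact_mod_cast hb
  have h2 : (1:ℝ) ≤ 2 ^ i := one_le_pow₀ (by norm_num)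
  have h3 : (0:ℝ) ≤ b := by positivity
  unfold ddS
  push_cast
  set W : ℝ := 2 ^ i
  set a : ℝ := 3 * (B + b) * W with ha
  set T : ℝ := 3 * B * W with hT
  have e0 : 1 ≤ T := by rw [hT]; nlinarith
  have e1 : T ≤ a := by rw [ha, hT]; nlinarith
  nlinarith

lemma ddS_pos (hb : b < B) : 0 < ddS (3 * (B + b) * 2 ^ i) (2 ^ i) := by
  have : 0 < (B:ℝ) := by exact_mod_cast (by omega : 0 < B)
  refine lt_of_lt_of_le ?_ (le_ddS B i b hb)
  positivity

lemma cc_nonneg (hb : b < B) : 0 ≤ cc R B i b := by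
  unfold cc
  have := ddS_pos B i b hb
  positivity

end

lemma bin_end (B b i : ℕ) : 3 * (B + b + 1) * 2 ^ i = 3 * (B + b) * 2 ^ i + 3 * 2 ^ i := by ring

lemma bin_lvl (B b₁ b₂ i₁ i₂ x : ℕ) (h₁ : 3 * (B + b₁) * 2 ^ i₁ ≤ x)
    (h₂ : x < 3 * (B + b₂ + 1) * 2 ^ i₂) (hb : b₂ < B) : i₁ ≤ i₂ := by
  by_contra hc
  push Not at hc
  have e : 2 ^ (i₂ + 1) ≤ 2 ^ i₁ := Nat.pow_le_pow_right (by norm_num) hc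
  have e1 : 3 * (B + b₂ + 1) * 2 ^ i₂ ≤ 3 * (2 * B) * 2 ^ i₂ := by gcongr; omega
  have e2 : 3 * (2 * B) * 2 ^ i₂ = 3 * B * 2 ^ (i₂ + 1) := by ring
  have e3 : 3 * B * 2 ^ (i₂ + 1) ≤ 3 * (B + b₁) * 2 ^ i₁ := by gcongr; omega
  omega

lemma bin_idx (B b₁ b₂ i x : ℕ) (h₁ : 3 * (B + b₁) * 2 ^ i ≤ x)
    (h₂ : x < 3 * (B + b₂ + 1) * 2 ^ i) : b₁ ≤ b₂ := by
  have := lt_of_mul_lt_mul_right (lt_of_le_of_lt h₁ h₂) (Nat.zero_le _)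
  omega


lemma pow_bound (k R B : ℕ) (hR : 0 < R) (hB : 0 < B) (hk : 6 * B * 2 ^ R ≤ k)
    {i : ℕ} (hi : i < R) : 12 * B * 2 ^ i ≤ k := by
  have : 2 ^ (i+1) ≤ 2 ^ R := Nat.pow_le_pow_right (by norm_num) hi
  calc 12 * B * 2 ^ i = 6 * B * 2 ^ (i+1) := by ring
    _ ≤ 6 * B * 2 ^ R := by gcongr
    _ ≤ k := hk

lemma bin_bound (k R B : ℕ) (hR : 0 < R) (hB : 0 < B) (hk : 6 * B * 2 ^ R ≤ k)
    {i b : ℕ} (hi : i < R) (hb : b < B) :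
    3 * (B + b) * 2 ^ i + 3 * 2 ^ i ≤ k := by
  have := pow_bound k R B hR hB hk hi
  have h2 : 3 * (B + b) * 2 ^ i + 3 * 2 ^ i = 3 * (B + b + 1) * 2 ^ i := by ring
  have : 3 * (B + b + 1) * 2 ^ i ≤ 12 * B * 2 ^ i := by gcongr ?_ * _; omega
  omega

lemma twelve_gt (k R B : ℕ) (hR : 0 < R) (hB : 0 < B) (hk : 6 * B * 2 ^ R ≤ k)
    (i : ℕ) : (1:ℝ) < ((12 * B * 2 ^ i : ℕ) : ℝ) := by
  have h2 : (1:ℝ) ≤ 2 ^ i := one_le_pow₀ (by norm_num)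
  have h1 : (1:ℝ) ≤ B := by exact_mod_cast hB
  push_cast
  nlinarith

lemma base_cone (k R B : ℕ) (hR : 0 < R) (hB : 0 < B) (hk : 6 * B * 2 ^ R ≤ k)
    : Cone k (base R B) := by
  unfold base
  have := fun i => twelve_gt k R B hR hB hk i
  refine ⟨fun x => ?_, fun x hx => ?_, fun x => ?_, fun x => ?_⟩
  · apply Finset.sum_nonneg; intro i hi
    have h := (hinge_cone k (12 * B * 2 ^ i) (by
      have := pow_bound k R B hR hB hk (Finset.mem_range.1 hi); omega)).1 x
    have := this i
    apply mul_nonneg _ h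
    apply div_nonneg (by positivity)
    nlinarith
  · apply Finset.sum_eq_zero; intro i hi
    rw [(hinge_cone k (12 * B * 2 ^ i) (by
      have := pow_bound k R B hR hB hk (Finset.mem_range.1 hi); omega)).2.1 x hx, mul_zero]
  · apply Finset.sum_le_sum; intro i hi
    have h := (hinge_cone k (12 * B * 2 ^ i) (by
      have := pow_bound k R B hR hB hk (Finset.mem_range.1 hi); omega)).2.2.1 x
    have := this i
    apply mul_le_mul_of_nonneg_left h
    apply div_nonneg (by positivity)
    nlinarith
  · rw [Finset.mul_sum, ← Finset.sum_sub_distrib, ← Finset.sum_add_distrib]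
    apply Finset.sum_nonneg; intro i hi
    have h := (hinge_cone k (12 * B * 2 ^ i) (by
      have := pow_bound k R B hR hB hk (Finset.mem_range.1 hi); omega)).2.2.2 x
    have := this i
    have hc : 0 ≤ 1 / (2 * (R:ℝ)) / (((12 * B * 2 ^ i : ℕ) : ℝ) *
      (((12 * B * 2 ^ i : ℕ) : ℝ) - 1) / 2) := by
      apply div_nonneg (by positivity)
      nlinarith
    have := mul_nonneg hc h
    linarith

lemma base_sum (k R B : ℕ) (hR : 0 < R) (hB : 0 < B) (hk : 6 * B * 2 ^ R ≤ k)
    : ∑ x ∈ Finset.Icc 1 k, base R B x = 1 / 2 := by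
  unfold base
  rw [Finset.sum_comm]
  have : ∀ i ∈ Finset.range R, ∑ x ∈ Finset.Icc 1 k, 1 / (2 * (R:ℝ)) / (((12 * B * 2 ^ i : ℕ) : ℝ) *
    (((12 * B * 2 ^ i : ℕ) : ℝ) - 1) / 2) * hinge (12 * B * 2 ^ i) x = 1 / (2 * R) := by
    intro i hi
    have h1 := pow_bound k R B hR hB hk (Finset.mem_range.1 hi)
    have h2 := twelve_gt k R B hR hB hk i
    rw [← Finset.mul_sum, hinge_sum _ _ (by exact_mod_cast h2.le) (by omega)]
    apply div_mul_cancel₀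
    apply ne_of_gt
    nlinarith
  rw [Finset.sum_congr rfl this]
  have : (R:ℝ) ≠ 0 := by positivity
  simp
  field_simp

lemma base_le (k R B : ℕ) (hR : 0 < R) (hB : 0 < B) (hk : 6 * B * 2 ^ R ≤ k)
    {i x : ℕ} (hi : i < R) (hx : x ≤ 6 * B * 2 ^ i) :
    1 / (8 * R * (3 * B * 2 ^ i)) ≤ base R B x := by
  have hg := fun i => twelve_gt k R B hR hB hk i
  have hR' : (0:ℝ) < R := by exact_mod_cast hR
  have hB' : (0:ℝ) < B := by exact_mod_cast hB
  refine le_trans ?_ (Finset.single_le_sum (f := fun i => 1 / (2 * (R:ℝ)) / (((12 * B * 2 ^ i : ℕ) : ℝ) *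
    (((12 * B * 2 ^ i : ℕ) : ℝ) - 1) / 2) * hinge (12 * B * 2 ^ i) x) ?_ (Finset.mem_range.2 hi))
  · have h1 : 1 / (2 * (R:ℝ)) / (8 * (3 * B * 2 ^ i) ^ 2) ≤ 1 / (2 * (R:ℝ)) / (((12 * B * 2 ^ i : ℕ) : ℝ) *
    (((12 * B * 2 ^ i : ℕ) : ℝ) - 1) / 2) := by
      have := hg i
      apply div_le_div_of_nonneg_left (by positivity) (by nlinarith)
      push_cast at this ⊢
      nlinarith
    have h2 : 2 * (3 * B * 2 ^ i : ℝ) ≤ hinge (12 * B * 2 ^ i) x := by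
      rw [hinge_of_le (hx.trans (by gcongr; norm_num))]
      have : (x:ℝ) ≤ 6 * B * 2 ^ i := by exact_mod_cast hx
      push_cast
      linarith
    have h3 := mul_le_mul h1 h2 (by positivity) (le_trans (by positivity) h1)
    refine le_trans (le_of_eq ?_) h3
    field_simp
  · intro i _
    have := hg i
    apply mul_nonneg
    · apply div_nonneg (by positivity)
      nlinarith
    · unfold hinge; positivity

lemma fam_cone (k R B : ℕ) (hR : 0 < R) (hB : 0 < B) (hk : 6 * B * 2 ^ R ≤ k)
    (l : ℝ) (hl0 : 0 ≤ l) (hl1 : l ≤ 1) (θ : Fin R × Fin B → Bool) :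
    Cone k (fam l R B θ) := by
  unfold fam
  apply (base_cone k R B hR hB hk).add
  apply Cone.sum
  intro p
  apply Cone.smul _ (cc_nonneg _ _ _ _ p.2.2)
  apply hh_cone _ _ _ _ hl0 hl1
  have := bin_bound k R B hR hB hk p.1.2 p.2.2
  omega

lemma fam_sum (k R B : ℕ) (hR : 0 < R) (hB : 0 < B) (hk : 6 * B * 2 ^ R ≤ k)
    (l : ℝ) (θ : Fin R × Fin B → Bool) :
    ∑ x ∈ Finset.Icc 1 k, fam l R B θ x = 1 := by
  unfold fam
  rw [Finset.sum_add_distrib, base_sum k R B hR hB hk, Finset.sum_comm]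
  have : ∀ p : Fin R × Fin B, ∑ x ∈ Finset.Icc 1 k, cc R B p.1 p.2 *
    hh l (3 * (B + p.2) * 2 ^ (p.1 : ℕ)) (2 ^ (p.1 : ℕ)) (θ p) x = 1 / (2 * R * B) := by
    intro p
    have := bin_bound k R B hR hB hk p.1.2 p.2.2
    rw [← Finset.mul_sum, hh_sum _ _ _ _ (Nat.pos_of_ne_zero (by positivity)) (by omega)]
    unfold cc
    exact div_mul_cancel₀ _ (ddS_pos _ _ _ p.2.2).ne'
  simp_rw [this]
  have : (R:ℝ) ≠ 0 := by positivity
  have : (B:ℝ) ≠ 0 := by positivity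
  simp
  field_simp
  norm_num

lemma fam_diff (k R B : ℕ) (hR : 0 < R) (hB : 0 < B) (hk : 6 * B * 2 ^ R ≤ k)
    (l : ℝ) (hl0 : 0 ≤ l) (θ : Fin R × Fin B → Bool) (j : Fin R × Fin B) (x : ℕ) :
    |fam l R B θ x - fam l R B (flipB j θ) x| =
      cc R B j.1 j.2 * l * |psi (3 * (B + j.2) * 2 ^ (j.1 : ℕ)) (2 ^ (j.1 : ℕ)) x| := by
  unfold fam
  rw [add_sub_add_left_eq_sub, ← Finset.sum_sub_distrib, Finset.sum_eq_single j]
  · rw [← mul_sub, abs_mul, abs_of_nonneg (cc_nonneg _ _ _ _ j.2.2)]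
    simp only [flipB, Function.update_self]
    rw [hh_diff _ _ _ _ _ hl0]; ring
  · intro p _ hp
    simp [flipB, hp]
  · simp

lemma lower_main (k R B : ℕ) (hR : 0 < R) (hB : 0 < B) (hk : 6 * B * 2 ^ R ≤ k)
    (n : ℕ) (hn : 0 < n) (l : ℝ) (hl0 : 0 ≤ l) (hl1 : l ≤ 1)
    (hl : l ^ 2 ≤ R * B ^ 5 / (16 * n)) :
    l / (4608 * B ^ 2) ≤ minimaxRisk n k (Gk k) := by
  have hR' : (0:ℝ) < R := by exact_mod_cast hR
  have hB' : (0:ℝ) < B := by exact_mod_cast hB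
  have hn' : (0:ℝ) < n := by exact_mod_cast hn
  have key := assouad n k hn
    (F := fun θ : Fin R × Fin B → Bool => fun x => if x ∈ Finset.Icc 1 k then fam l R B θ x else 0)
    (fun θ => cone_mem k _ (fam_cone k R B hR hB hk l hl0 hl1 θ) (fam_sum k R B hR hB hk l θ))
    (fun j => Finset.Ico (3 * (B + j.2) * 2 ^ (j.1 : ℕ))
      (3 * (B + j.2) * 2 ^ (j.1 : ℕ) + 3 * 2 ^ (j.1 : ℕ)))
    ?_ ?_ (l / (288 * R * B ^ 3)) ?_ (by positivity) ?_
  · refine le_trans (le_of_eq ?_) key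
    simp
    field_simp
    ring
  · intro j x hx
    have := bin_bound k R B hR hB hk j.1.2 j.2.2
    have h0 : 0 < 3 * (B + j.2) * 2 ^ (j.1 : ℕ) := by positivity
    simp only [Finset.mem_Ico, Finset.mem_Icc] at hx ⊢
    omega
  · intro i j hij
    rw [Finset.disjoint_left]
    intro x hx hy
    simp only [Finset.mem_Ico] at hx hy
    rw [← bin_end] at hx hy
    apply hij
    have e1 := le_antisymm (bin_lvl B _ _ _ _ x hx.1 hy.2 j.2.2) (bin_lvl B _ _ _ _ x hy.1 hx.2 i.2.2)
    rw [e1] at hx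
    have e2 := le_antisymm (bin_idx B _ _ _ x hx.1 hy.2) (bin_idx B _ _ _ x hy.1 hx.2)
    exact Prod.ext (Fin.ext e1) (Fin.ext e2)
  · intro θ j
    have h1 := psi_sum (3 * (B + j.2) * 2 ^ (j.1 : ℕ)) (2 ^ (j.1 : ℕ))
    have h2 : ∀ y ∈ Finset.Ico (3 * (B + j.2) * 2 ^ (j.1 : ℕ))
      (3 * (B + j.2) * 2 ^ (j.1 : ℕ) + 3 * 2 ^ (j.1 : ℕ)), 
      |(if y ∈ Finset.Icc 1 k then fam l R B θ y else 0) -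
        (if y ∈ Finset.Icc 1 k then fam l R B (flipB j θ) y else 0)| = 
      cc R B j.1 j.2 * l * |psi (3 * (B + j.2) * 2 ^ (j.1 : ℕ)) (2 ^ (j.1 : ℕ)) y| := by
      intro x hx
      have := bin_bound k R B hR hB hk j.1.2 j.2.2
      have h0 : 0 < 3 * (B + j.2) * 2 ^ (j.1 : ℕ) := by positivity
      have : x ∈ Finset.Icc 1 k := by
        simp only [Finset.mem_Ico, Finset.mem_Icc] at hx ⊢
        omega
      rw [if_pos this, if_pos this]
      exact fam_diff k R B hR hB hk l hl0 θ j x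
    rw [Finset.sum_congr rfl h2, ← Finset.mul_sum]
    have hS := ddS_pos B j.1 j.2 j.2.2
    have hc : 1 / (2 * R * B) / (8 * (3 * B * 2 ^ (j.1 : ℕ)) ^ 2) ≤ cc R B j.1 j.2 :=
      div_le_div_of_nonneg_left (by positivity) hS (ddS_le B j.1 j.2 j.2.2)
    have hc' := mul_le_mul_of_nonneg_right hc hl0
    refine le_trans (le_of_eq ?_) (mul_le_mul hc' h1 (by positivity) (le_trans (by positivity) hc'))
    push_cast
    field_simp
    ring
  · intro θ j
    set a := 3 * (B + j.2) * 2 ^ (j.1 : ℕ) with ha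
    set w := 2 ^ (j.1 : ℕ) with hw
    have hbb := bin_bound k R B hR hB hk j.1.2 j.2.2
    have h0 : 0 < a := by positivity
    have hsub : Finset.Ico a (a + 3 * w) ⊆ Finset.Icc 1 k := by
      intro x hx
      simp only [Finset.mem_Ico, Finset.mem_Icc] at hx ⊢
      omega
    have hdf := fam_diff k R B hR hB hk l hl0 θ j
    rw [← Finset.sum_subset hsub]
    swap
    · intro x hx hx'
      have := hdf x
      rw [psi_zero _ _ _ hx', abs_zero, mul_zero, abs_eq_zero, sub_eq_zero] at this
      simp only [hx, if_true, this]
      simp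
    set q : ℝ := 1 / (8 * R * (3 * B * 2 ^ (j.1:ℕ))) with hq
    have hq0 : 0 < q := by positivity
    have hterm : ∀ x ∈ Finset.Ico a (a + 3 * w),
      (Real.sqrt (if x ∈ Finset.Icc 1 k then fam l R B θ x else 0) -
        Real.sqrt (if x ∈ Finset.Icc 1 k then fam l R B (flipB j θ) x else 0)) ^ 2
       ≤ (1 / (2 * R * B) / ((3 * B * 2 ^ (j.1 : ℕ)) ^ 2) * l * (6 * 2 ^ (j.1 : ℕ))) ^ 2 / q := by
      intro x hx
      have hx' := hsub hx
      rw [if_pos hx', if_pos hx']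
      refine (sqrt_diff _ _ q hq0 ?_ ((fam_cone k R B hR hB hk l hl0 hl1 _).1 x)).trans ?_
      · have hx6 : x ≤ 6 * B * 2 ^ (j.1 : ℕ) := by
          simp only [Finset.mem_Ico] at hx
          have h2 : a + 3 * w = 3 * (B + j.2 + 1) * 2 ^ (j.1 : ℕ) := by rw [ha, hw]; ring
          have : 3 * (B + j.2 + 1) * 2 ^ (j.1 : ℕ) ≤ 6 * B * 2 ^ (j.1 : ℕ) := by
            have := j.2.2
            gcongr ?_ * _; omega
          omega
        have hb := base_le k R B hR hB hk j.1.2 hx6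
        refine hb.trans ?_
        unfold fam
        have : 0 ≤ ∑ p : Fin R × Fin B, cc R B p.1 p.2 *
          hh l (3 * (B + p.2) * 2 ^ (p.1 : ℕ)) (2 ^ (p.1 : ℕ)) (θ p) x := by
          apply Finset.sum_nonneg
          intro p _
          apply mul_nonneg (cc_nonneg _ _ _ _ p.2.2)
          have := bin_bound k R B hR hB hk p.1.2 p.2.2
          exact (hh_cone k _ _ l hl0 hl1 (by omega) _).1 x
        linarith
      · rw [← sq_abs, hdf x]
        apply div_le_div_of_nonneg_right _ hq0.le
        have hc0 := cc_nonneg R B j.1 j.2 j.2.2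
        apply pow_le_pow_left₀ (by positivity)
        have hc : cc R B j.1 j.2 ≤ 1 / (2 * R * B) / ((3 * B * 2 ^ (j.1 : ℕ)) ^ 2) :=
          div_le_div_of_nonneg_left (by positivity) (by positivity) (le_ddS B j.1 j.2 j.2.2)
        have hp := psi_le a w x
        rw [hw] at hp
        push_cast at hp
        gcongr
    refine (Finset.sum_le_sum hterm).trans ?_
    simp only [Finset.sum_const, Nat.card_Ico, nsmul_eq_mul, add_tsub_cancel_left]
    have e : ((3 * w : ℕ) : ℝ) * ((1 / (2 * R * B) / ((3 * B * 2 ^ (j.1 : ℕ)) ^ 2) * l *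
      (6 * 2 ^ (j.1 : ℕ))) ^ 2 / q) = 8 * l ^ 2 / (R * B ^ 5) := by
      rw [hq, hw]
      push_cast
      field_simp
      ring
    rw [e, div_le_div_iff₀ (by positivity) (by positivity)]
    rw [le_div_iff₀ (by positivity)] at hl
    linarith



noncomputable def two (l : ℝ) (θ : Unit → Bool) (x : ℕ) : ℝ :=
  if x = 1 then 3 / 4 + (if θ () then l else -l) else
  if x = 2 then 1 / 4 - (if θ () then l else -l) else 0

lemma sum_Icc_two (k : ℕ) (hk : 2 ≤ k) (g : ℕ → ℝ) (hg : ∀ x, 3 ≤ x → g x = 0) :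
    ∑ x ∈ Finset.Icc 1 k, g x = g 1 + g 2 := by
  have : ∑ x ∈ Finset.Icc 1 k, g x = ∑ x ∈ Finset.Icc 1 2, g x := by
    symm
    apply Finset.sum_subset (Finset.Icc_subset_Icc_right hk)
    intro x hx hx'
    apply hg
    simp only [Finset.mem_Icc] at hx hx'
    omega
  rw [this]
  simp [Finset.sum_Icc_succ_top]

lemma two_mem (k : ℕ) (hk : 2 ≤ k) (l : ℝ) (h0 : 0 ≤ l) (h1 : l ≤ 1 / 12) (θ : Unit → Bool) :
    two l θ ∈ Gk k := by
  set e : ℝ := if θ () then l else -l with he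
  have e1 : e ≤ 1 / 12 := by rw [he]; split_ifs <;> linarith
  have e2 : -(1 / 12) ≤ e := by rw [he]; split_ifs <;> linarith
  have hx : ∀ x, two l θ x = if x = 1 then 3 / 4 + e else if x = 2 then 1 / 4 - e else 0 :=
    fun x => rfl
  refine ⟨fun x => ?_, fun x h => ?_, ?_, fun x h h' => ?_, fun x h h' => ?_⟩
  · rw [hx]; split_ifs <;> linarith
  · simp only [Finset.mem_Icc] at h
    rw [hx, if_neg (by omega), if_neg (by omega)]
  · rw [sum_Icc_two k hk]
    · simp only [hx]; norm_num
    · intro x h; rw [hx, if_neg (by omega), if_neg (by omega)]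
  · simp only [hx]
    rcases (by omega : x = 1 ∨ x = 2 ∨ 3 ≤ x) with h | h | h
    · subst h; norm_num; linarith
    · subst h; norm_num; linarith
    · rw [if_neg (by omega), if_neg (by omega), if_neg (by omega), if_neg (by omega)]
  · simp only [hx]
    rcases (by omega : x = 1 ∨ x = 2 ∨ 3 ≤ x) with h | h | h
    · subst h; norm_num; linarith
    · subst h; norm_num; linarith
    · rw [if_neg (by omega), if_neg (by omega), if_neg (by omega), if_neg (by omega),
        if_neg (by omega), if_neg (by omega)]; norm_num

lemma lower_two (n k : ℕ) (hn : 0 < n) (hk : 2 ≤ k) :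
    1 / (48 * Real.sqrt n) ≤ minimaxRisk n k (Gk k) := by
  have hn' : (1:ℝ) ≤ n := by exact_mod_cast hn
  have hs : 1 ≤ Real.sqrt n := Real.one_le_sqrt.2 hn'
  have hss : Real.sqrt n ^ 2 = n := Real.sq_sqrt (by linarith)
  set l : ℝ := 1 / (12 * Real.sqrt n) with hl
  have h0 : 0 ≤ l := by positivity
  have h1 : l ≤ 1 / 12 := by
    rw [hl]
    apply one_div_le_one_div_of_le <;> linarith
  have hl2 : l ^ 2 = 1 / (144 * n) := by
    rw [hl, div_pow, mul_pow, hss]; norm_num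
  have hd : ∀ θ : Unit → Bool, ∀ x, x = 1 ∨ x = 2 →
      |two l θ x - two l (flipB () θ) x| = 2 * l := by
    intro θ x hx
    have : flipB () θ () = !θ () := by simp [flipB]
    rcases hx with rfl | rfl <;> simp only [two, this] <;> cases θ () <;> norm_num <;> ring_nf <;>
      simp [abs_mul, abs_of_nonneg h0]
  have key := assouad n k hn (two l) (fun θ => two_mem k hk l h0 h1 θ)
    (fun _ : Unit => Finset.Icc 1 2) (fun _ => Finset.Icc_subset_Icc_right hk)
    (fun i j h => absurd rfl h) (4 * l) ?_ (by positivity) ?_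
  · refine le_trans (le_of_eq ?_) key
    simp [hl]
    field_simp
    norm_num
  · intro θ j
    rw [sum_congr rfl (g := fun _ => 2 * l)]
    · simp; linarith
    · intro x hx
      simp only [Finset.mem_Icc] at hx
      exact hd θ x (by omega)
  · intro θ j
    rw [sum_Icc_two k hk]
    · have hq : ∀ x, x = 1 ∨ x = 2 → 1 / 6 ≤ two l θ x := by
        intro x hx
        rcases hx with rfl | rfl <;> simp only [two] <;> split_ifs <;> norm_num at * <;> linarith
      have t : ∀ x, x = 1 ∨ x = 2 → (Real.sqrt (two l θ x) - Real.sqrt (two l (flipB j θ) x)) ^ 2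
          ≤ (2 * l) ^ 2 / (1 / 6) := by
        intro x hx
        rw [← hd θ x hx, sq_abs]
        exact sqrt_diff _ _ (1/6) (by norm_num) (hq x hx) ((two_mem k hk l h0 h1 _).1 x)
      have t1 := t 1 (Or.inl rfl)
      have t2 := t 2 (Or.inr rfl)
      have : (2 * l) ^ 2 / (1 / 6) = 24 * l ^ 2 := by ring
      rw [this, hl2] at t1 t2
      have e : 24 * (1 / (144 * (n:ℝ))) + 24 * (1 / (144 * n)) ≤ 1 / (2 * n) := by
        have : 24 * (1 / (144 * (n:ℝ))) + 24 * (1 / (144 * n)) = (1 / 3) * (1 / n) := by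
          field_simp; norm_num
        rw [this]
        have : 1 / (2 * (n:ℝ)) = (1 / 2) * (1 / n) := by field_simp
        rw [this]
        gcongr
        norm_num
      linarith
    · intro x hx
      have h1 : x ≠ 1 := by omega
      have h2 : x ≠ 2 := by omega
      simp [two, h1, h2]


/-- local linear fit on `[a, a+L)` -/
noncomputable def fitT (a L : ℕ) (p : ℕ → ℝ) (y : ℕ) : ℝ :=
  if L ≤ 1 then p y else
    (∑ z ∈ Finset.Ico a (a + L / 2), p z) / ((L / 2 : ℕ) : ℝ) +
      ((∑ z ∈ Finset.Ico (a + (L - L / 2)) (a + L), p z) / ((L / 2 : ℕ) : ℝ) -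
        (∑ z ∈ Finset.Ico a (a + L / 2), p z) / ((L / 2 : ℕ) : ℝ)) *
      (((y : ℝ) - a - (((L / 2 : ℕ) : ℝ) - 1) / 2) / ((L : ℝ) - ((L / 2 : ℕ) : ℝ)))

lemma fit_sub (a L : ℕ) (p f : ℕ → ℝ) (y : ℕ) :
    fitT a L p y - fitT a L f y = fitT a L (fun z => p z - f z) y := by
  unfold fitT
  split_ifs
  · rfl
  · simp only [Finset.sum_sub_distrib]; ring

lemma sum_lin (a w : ℕ) (c d : ℝ) :
    ∑ z ∈ Finset.Ico a (a + w), (c + d * (z:ℝ)) = w * (c + d * (a + ((w:ℝ) - 1) / 2)) := by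
  rw [Finset.sum_Ico_eq_sum_range, add_tsub_cancel_left]
  induction w with
  | zero => simp
  | succ w ih => rw [Finset.sum_range_succ, ih]; push_cast; ring

lemma fit_lin (a L : ℕ) (hL : 2 ≤ L) (c d : ℝ) (y : ℕ) :
    fitT a L (fun z => c + d * (z:ℝ)) y = c + d * y := by
  unfold fitT
  rw [if_neg (by omega)]
  set w := L / 2 with hw
  have hw1 : 1 ≤ w := by omega
  have hwL : w ≤ L := by omega
  have e : a + L = a + (L - w) + w := by omega
  rw [e, sum_lin, sum_lin]
  push_cast [hwL]
  have h1 : (w:ℝ) ≠ 0 := by positivity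
  have h2 : (L:ℝ) - w ≠ 0 := by
    have : (w:ℝ) < L := by exact_mod_cast (by omega : w < L)
    linarith
  field_simp
  ring

lemma fit_L1 (a L : ℕ) (hL : 2 ≤ L) (g : ℕ → ℝ) :
    ∑ y ∈ Finset.Ico a (a + L), |fitT a L g y| ≤
      8 * (|∑ z ∈ Finset.Ico a (a + L / 2), g z| +
        |∑ z ∈ Finset.Ico (a + (L - L / 2)) (a + L), g z|) := by
  set w := L / 2 with hw
  have hw1 : 1 ≤ w := by omega
  have hw0 : (1:ℝ) ≤ w := by exact_mod_cast hw1
  have hwL : (2:ℝ) * w ≤ L := by exact_mod_cast (by omega : 2 * w ≤ L)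
  have hwL3 : (L:ℝ) ≤ 3 * w := by exact_mod_cast (by omega : L ≤ 3 * w)
  set A := ∑ z ∈ Finset.Ico a (a + w), g z
  set B := ∑ z ∈ Finset.Ico (a + (L - w)) (a + L), g z
  have hpt : ∀ y ∈ Finset.Ico a (a + L), |fitT a L g y| ≤ 5 / 2 * ((|A| + |B|) / w) := by
    intro y hy
    simp only [Finset.mem_Ico] at hy
    have hy1 : (a:ℝ) ≤ y := by exact_mod_cast hy.1
    have hy2 : (y:ℝ) + 1 ≤ a + L := by exact_mod_cast hy.2
    unfold fitT
    rw [if_neg (by omega)]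
    change |A / w + (B / w - A / w) * (((y : ℝ) - a - ((w : ℝ) - 1) / 2) / ((L : ℝ) - (w : ℝ)))| ≤ _
    set c := (((y : ℝ) - a - ((w : ℝ) - 1) / 2) / ((L : ℝ) - (w : ℝ))) with hc
    have hden : (0:ℝ) < (L:ℝ) - w := by linarith
    have hc1 : |c| ≤ 3 / 2 := by
      rw [hc, abs_div, abs_of_pos hden, div_le_iff₀ hden, abs_le]
      constructor <;> linarith
    have t1 : |A / w + (B / w - A / w) * c| ≤ |A / w| + (|B / w| + |A / w|) * |c| := by
      refine (abs_add_le _ _).trans ?_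
      rw [abs_mul]
      gcongr
      exact abs_sub _ _
    have hw' : (0:ℝ) < w := by linarith
    rw [abs_div, abs_div, abs_of_pos hw'] at t1
    rw [add_div]
    have : 0 ≤ |A| / w := by positivity
    have : 0 ≤ |B| / w := by positivity
    nlinarith
  refine (Finset.sum_le_sum hpt).trans ?_
  simp only [Finset.sum_const, Nat.card_Ico, add_tsub_cancel_left, nsmul_eq_mul]
  have hw' : (0:ℝ) < w := by linarith
  have hAB : 0 ≤ |A| + |B| := by positivity
  have : (L:ℝ) * (5 / 2 * ((|A| + |B|) / w)) = (5 / 2 * L / w) * (|A| + |B|) := by ring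
  rw [this]
  apply mul_le_mul_of_nonneg_right _ hAB
  rw [div_le_iff₀ hw']
  linarith

lemma bin_det (a L : ℕ) (hL : 2 ≤ L) (p f : ℕ → ℝ) (c d β : ℝ)
    (h0 : ∀ y ∈ Finset.Ico a (a + L), 0 ≤ f y - (c + d * (y:ℝ)))
    (hβ : ∑ y ∈ Finset.Ico a (a + L), (f y - (c + d * (y:ℝ))) ≤ β) :
    ∑ y ∈ Finset.Ico a (a + L), |fitT a L p y - f y| ≤
      8 * (|∑ z ∈ Finset.Ico a (a + L / 2), (p z - f z)| +
        |∑ z ∈ Finset.Ico (a + (L - L / 2)) (a + L), (p z - f z)|) + 17 * β := by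
  have h1 := fit_L1 a L hL (fun z => p z - f z)
  have h2 := fit_L1 a L hL (fun z => f z - (c + d * (z:ℝ)))
  have s1 : |∑ z ∈ Finset.Ico a (a + L / 2), (f z - (c + d * (z:ℝ)))| ≤ β := by
    have sub : Finset.Ico a (a + L / 2) ⊆ Finset.Ico a (a + L) :=
      Finset.Ico_subset_Ico_right (by omega)
    rw [abs_of_nonneg (Finset.sum_nonneg fun y hy => h0 y (sub hy))]
    exact (Finset.sum_le_sum_of_subset_of_nonneg sub fun y hy _ => h0 y hy).trans hβ
  have s2 : |∑ z ∈ Finset.Ico (a + (L - L / 2)) (a + L), (f z - (c + d * (z:ℝ)))| ≤ β := by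
    have sub : Finset.Ico (a + (L - L / 2)) (a + L) ⊆ Finset.Ico a (a + L) :=
      Finset.Ico_subset_Ico_left (by omega)
    rw [abs_of_nonneg (Finset.sum_nonneg fun y hy => h0 y (sub hy))]
    exact (Finset.sum_le_sum_of_subset_of_nonneg sub fun y hy _ => h0 y hy).trans hβ
  have h3 : ∑ y ∈ Finset.Ico a (a + L), |fitT a L p y - f y| ≤
      ∑ y ∈ Finset.Ico a (a + L), (|fitT a L (fun z => p z - f z) y| +
        |fitT a L (fun z => f z - (c + d * (z:ℝ))) y| + (f y - (c + d * (y:ℝ)))) := by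
    apply Finset.sum_le_sum
    intro y hy
    rw [← fit_sub, ← fit_sub, fit_lin a L hL]
    have e : fitT a L p y - f y = (fitT a L p y - fitT a L f y) + (fitT a L f y - (c + d * (y:ℝ)))
      - (f y - (c + d * (y:ℝ))) := by ring
    rw [e]
    refine (abs_sub _ _).trans ?_
    rw [abs_of_nonneg (h0 y hy)]
    gcongr
    exact abs_add_le _ _
  rw [Finset.sum_add_distrib, Finset.sum_add_distrib] at h3
  linarith


/-- slope -/
def slp (h : ℕ → ℝ) (y : ℕ) : ℝ := h y - h (y + 1)

lemma slp_anti (h : ℕ → ℝ) (hconv : ∀ x, 1 ≤ x → 0 ≤ h x - 2 * h (x + 1) + h (x + 2))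
    (a t : ℕ) (ha : 1 ≤ a) : slp h (a + t) ≤ slp h a := by
  induction t with
  | zero => simp
  | succ t ih =>
    refine le_trans ?_ ih
    have := hconv (a + t) (by omega)
    unfold slp
    rw [show a + (t + 1) = a + t + 1 by ring, show a + t + 1 + 1 = a + t + 2 by ring]
    linarith

lemma tangent (h : ℕ → ℝ) (hconv : ∀ x, 1 ≤ x → 0 ≤ h x - 2 * h (x + 1) + h (x + 2))
    (a L t : ℕ) (ha : 1 ≤ a) (ht : t ≤ L) :
    0 ≤ h (a + t) - (h a - slp h a * t) ∧
    h (a + t) - (h a - slp h a * t) ≤ t * (slp h a - slp h (a + L)) := by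
  induction t with
  | zero => simp
  | succ t ih =>
    obtain ⟨i1, i2⟩ := ih (by omega)
    have e : h (a + (t + 1)) = h (a + t) - slp h (a + t) := by
      unfold slp; rw [show a + (t + 1) = a + t + 1 by ring]; ring
    have s1 := slp_anti h hconv a t ha
    have s2 := slp_anti h hconv (a + t) (L - t) (by omega)
    rw [show a + t + (L - t) = a + L by omega] at s2
    rw [e]
    push_cast
    constructor <;> linarith

lemma bin_bias (h : ℕ → ℝ) (hconv : ∀ x, 1 ≤ x → 0 ≤ h x - 2 * h (x + 1) + h (x + 2))
    (a L : ℕ) (ha : 1 ≤ a) :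
    (∀ y ∈ Finset.Ico a (a + L), 0 ≤ h y - ((h a + slp h a * a) + (-slp h a) * (y:ℝ))) ∧
    ∑ y ∈ Finset.Ico a (a + L), (h y - ((h a + slp h a * a) + (-slp h a) * (y:ℝ))) ≤
      L ^ 2 * (slp h a - slp h (a + L)) := by
  have key : ∀ y ∈ Finset.Ico a (a + L),
      0 ≤ h y - ((h a + slp h a * a) + (-slp h a) * (y:ℝ)) ∧
      h y - ((h a + slp h a * a) + (-slp h a) * (y:ℝ)) ≤ L * (slp h a - slp h (a + L)) := by
    intro y hy
    simp only [Finset.mem_Ico] at hy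
    obtain ⟨t, rfl⟩ := Nat.exists_eq_add_of_le hy.1
    obtain ⟨i1, i2⟩ := tangent h hconv a L t ha (by omega)
    have s := slp_anti h hconv a L ha
    have tl : (t:ℝ) ≤ L := by exact_mod_cast (by omega : t ≤ L)
    push_cast
    constructor
    · linarith
    · have := mul_le_mul_of_nonneg_right tl (sub_nonneg.2 s)
      linarith
  refine ⟨fun y hy => (key y hy).1, ?_⟩
  refine (Finset.sum_le_sum fun y hy => (key y hy).2).trans (le_of_eq ?_)
  simp
  ring

lemma abel1 (h : ℕ → ℝ)
    (K : ℕ) : ∑ y ∈ Finset.Icc 1 K, (y:ℝ) ^ 2 * (slp h y - slp h (y + 1)) =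
    2 * ∑ y ∈ Finset.Icc 1 K, h y - h 1 - (2 * K - 1) * h (K + 1) - K ^ 2 * slp h (K + 1) := by
  induction K with
  | zero => simp
  | succ K ih =>
    rw [Finset.sum_Icc_succ_top (by omega), ih, Finset.sum_Icc_succ_top (by omega)]
    unfold slp
    push_cast
    ring

lemma abel2 (h : ℕ → ℝ) (hmono : ∀ x, 1 ≤ x → h (x + 1) ≤ h x)
    (K : ℕ) (hK : 1 ≤ K) (h0 : ∀ x, 0 ≤ h x) :
    ∑ y ∈ Finset.Icc 1 K, (y:ℝ) ^ 2 * (slp h y - slp h (y + 1)) ≤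
    2 * ∑ y ∈ Finset.Icc 1 K, h y := by
  rw [abel1]
  have a := h0 1
  have b := h0 (K + 1)
  have c : 0 ≤ slp h (K + 1) := by unfold slp; linarith [hmono (K + 1) (by omega)]
  have d : (1:ℝ) ≤ K := by exact_mod_cast hK
  have e : 0 ≤ (2 * (K:ℝ) - 1) * h (K + 1) := mul_nonneg (by linarith) b
  have f : 0 ≤ (K:ℝ) ^ 2 * slp h (K + 1) := by positivity
  linarith

lemma tele (g : ℕ → ℝ) (a L : ℕ) :
    ∑ y ∈ Finset.Ico a (a + L), (g y - g (y + 1)) = g a - g (a + L) := by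
  induction L with
  | zero => simp
  | succ L ih => rw [← add_assoc, Finset.sum_Ico_succ_top (by omega), ih]; ring

lemma bias_le (h : ℕ → ℝ) (hconv : ∀ x, 1 ≤ x → 0 ≤ h x - 2 * h (x + 1) + h (x + 2))
    (a L q : ℕ) (ha : 1 ≤ a) (hq : 0 < q) (hL : L * q ≤ a) :
    (L:ℝ) ^ 2 * (slp h a - slp h (a + L)) ≤
      (∑ y ∈ Finset.Ico a (a + L), (y:ℝ) ^ 2 * (slp h y - slp h (y + 1))) / q ^ 2 := by
  have hq' : (0:ℝ) < q := by exact_mod_cast hq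
  have hL' : (L:ℝ) * q ≤ a := by exact_mod_cast hL
  rw [le_div_iff₀ (by positivity)]
  have s := slp_anti h hconv a L ha
  calc (L:ℝ) ^ 2 * (slp h a - slp h (a + L)) * q ^ 2
      = ((L:ℝ) * q) ^ 2 * (slp h a - slp h (a + L)) := by ring
    _ ≤ (a:ℝ) ^ 2 * (slp h a - slp h (a + L)) := by
        apply mul_le_mul_of_nonneg_right _ (sub_nonneg.2 s)
        apply pow_le_pow_left₀ (by positivity) hL'
    _ = ∑ y ∈ Finset.Ico a (a + L), (a:ℝ) ^ 2 * (slp h y - slp h (y + 1)) := by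
        rw [← Finset.mul_sum, tele]
    _ ≤ _ := by
        apply Finset.sum_le_sum
        intro y hy
        simp only [Finset.mem_Ico] at hy
        have := slp_anti h hconv y 1 (by omega)
        apply mul_le_mul_of_nonneg_right _ (sub_nonneg.2 this)
        have : (a:ℝ) ≤ y := by exact_mod_cast hy.1
        apply pow_le_pow_left₀ (by positivity) this



def exf (k : ℕ) (f : ℕ → ℝ) (x : ℕ) : ℝ := f (min x k)

lemma exf_mono (k : ℕ) (f : ℕ → ℝ) (hf : f ∈ Gk k) (x : ℕ) (hx : 1 ≤ x) :
    exf k f (x + 1) ≤ exf k f x := by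
  obtain ⟨h0, hz, h1, h2, h3⟩ := hf
  unfold exf
  by_cases h : x + 1 ≤ k
  · rw [min_eq_left h, min_eq_left (by omega)]; exact h2 x hx h
  · rw [min_eq_right (by omega), min_eq_right (by omega)]

lemma exf_conv (k : ℕ) (f : ℕ → ℝ) (hf : f ∈ Gk k) (x : ℕ) (hx : 1 ≤ x) :
    0 ≤ exf k f x - 2 * exf k f (x + 1) + exf k f (x + 2) := by
  obtain ⟨h0, hz, h1, h2, h3⟩ := hf
  unfold exf
  rcases (by omega : x + 2 ≤ k ∨ x + 1 = k ∨ k ≤ x) with h | h | h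
  · rw [min_eq_left h, min_eq_left (by omega), min_eq_left (by omega)]; exact h3 x hx h
  · rw [min_eq_left (by omega), min_eq_left (by omega), min_eq_right (by omega)]
    have := h2 x hx (by omega)
    rw [← h]; linarith
  · rw [min_eq_right (by omega), min_eq_right (by omega), min_eq_right (by omega)]; linarith

lemma bin_exp (n k : ℕ) (hn : 0 < n) (f : ℕ → ℝ) (hf : f ∈ Gk k) (a L q : ℕ) (ha : 1 ≤ a)
    (hk : a + L ≤ k + 1) (hq : 0 < q) (hL : L ≤ 1 ∨ L * q ≤ a) :
    ∑ x ∈ Fintype.piFinset (fun _ : Fin n => Finset.Icc 1 k),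
      (∏ i, f (x i)) * ∑ y ∈ Finset.Ico a (a + L), |fitT a L (emp n x) y - f y| ≤
    16 * Real.sqrt ((∑ y ∈ Finset.Ico a (a + L), f y) / n) +
      17 * ((∑ y ∈ Finset.Ico a (a + L), (y:ℝ) ^ 2 *
        (slp (exf k f) y - slp (exf k f) (y + 1))) / q ^ 2) := by
  have hsub : Finset.Ico a (a + L) ⊆ Finset.Icc 1 k := by
    intro y hy; simp only [Finset.mem_Ico, Finset.mem_Icc] at hy ⊢; omega
  have hconv := exf_conv k f hf
  have hP0 : ∀ x : Fin n → ℕ, 0 ≤ ∏ i, f (x i) := fun x => Finset.prod_nonneg fun _ _ => hf.1 _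
  have hbnn : 0 ≤ (∑ y ∈ Finset.Ico a (a + L), (y:ℝ) ^ 2 *
        (slp (exf k f) y - slp (exf k f) (y + 1))) / (q:ℝ) ^ 2 := by
    apply div_nonneg _ (by positivity)
    apply Finset.sum_nonneg
    intro y hy
    simp only [Finset.mem_Ico] at hy
    have := slp_anti _ hconv y 1 (by omega)
    exact mul_nonneg (by positivity) (sub_nonneg.2 this)
  have hs0 := Real.sqrt_nonneg ((∑ y ∈ Finset.Ico a (a + L), f y) / n)
  have hemp : ∀ A ⊆ Finset.Ico a (a + L),
      ∑ x ∈ Fintype.piFinset (fun _ : Fin n => Finset.Icc 1 k),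
        (∏ l, f (x l)) * |∑ y ∈ A, (emp n x y - f y)|
      ≤ Real.sqrt ((∑ y ∈ Finset.Ico a (a + L), f y) / n) := by
    intro A hA
    refine (emp_abs n hn (Finset.Icc 1 k) A (hA.trans hsub) f hf.1 hf.2.2.1).trans ?_
    apply Real.sqrt_le_sqrt
    apply div_le_div_of_nonneg_right _ (by positivity)
    exact Finset.sum_le_sum_of_subset_of_nonneg hA fun y _ _ => hf.1 y
  rcases (by omega : L = 0 ∨ L = 1 ∨ 2 ≤ L) with h | h | h
  · subst h
    simp
  · subst h
    have e := hemp (Finset.Ico a (a + 1)) (Finset.Subset.refl _)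
    simp only [Nat.Ico_succ_singleton, Finset.sum_singleton] at e hs0 hbnn ⊢
    simp only [fitT, le_refl, if_true]
    linarith
  · have hLq : L * q ≤ a := by omega
    obtain ⟨b1, b2⟩ := bin_bias (exf k f) hconv a L ha
    have b3 := bias_le (exf k f) hconv a L q ha hq hLq
    have hfe : ∀ y ∈ Finset.Ico a (a + L), exf k f y = f y := by
      intro y hy
      have := hsub hy
      simp only [Finset.mem_Icc] at this
      unfold exf; rw [min_eq_left this.2]
    set c := exf k f a + slp (exf k f) a * a
    set d := -slp (exf k f) a
    set β := (∑ y ∈ Finset.Ico a (a + L), (y:ℝ) ^ 2 *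
        (slp (exf k f) y - slp (exf k f) (y + 1))) / (q:ℝ) ^ 2
    have hdet : ∀ x : Fin n → ℕ, _ := fun x => bin_det a L h (emp n x) f c d β
      (fun y hy => by have := b1 y hy; rw [hfe y hy] at this; exact this)
      (by
        refine le_trans (le_of_eq ?_) (b2.trans b3)
        exact Finset.sum_congr rfl fun y hy => by rw [hfe y hy])
    have e1 := hemp (Finset.Ico a (a + L / 2)) (Finset.Ico_subset_Ico_right (by omega))
    have e2 := hemp (Finset.Ico (a + (L - L / 2)) (a + L)) (Finset.Ico_subset_Ico_left (by omega))
    have e3 := expE_one n (Finset.Icc 1 k) f hf.2.2.1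
    calc _ ≤ ∑ x ∈ Fintype.piFinset (fun _ : Fin n => Finset.Icc 1 k), (∏ i, f (x i)) *
          (8 * (|∑ z ∈ Finset.Ico a (a + L / 2), (emp n x z - f z)| +
        |∑ z ∈ Finset.Ico (a + (L - L / 2)) (a + L), (emp n x z - f z)|) + 17 * β) :=
          Finset.sum_le_sum fun x _ => mul_le_mul_of_nonneg_left (hdet x) (hP0 x)
      _ = 8 * (∑ x ∈ Fintype.piFinset (fun _ : Fin n => Finset.Icc 1 k), (∏ i, f (x i)) *
          |∑ z ∈ Finset.Ico a (a + L / 2), (emp n x z - f z)|) +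
          8 * (∑ x ∈ Fintype.piFinset (fun _ : Fin n => Finset.Icc 1 k), (∏ i, f (x i)) *
          |∑ z ∈ Finset.Ico (a + (L - L / 2)) (a + L), (emp n x z - f z)|) +
          17 * β * ∑ x ∈ Fintype.piFinset (fun _ : Fin n => Finset.Icc 1 k), (∏ i, f (x i)) := by
          rw [Finset.mul_sum, Finset.mul_sum, Finset.mul_sum, ← Finset.sum_add_distrib,
            ← Finset.sum_add_distrib]
          exact Finset.sum_congr rfl fun x _ => by ring
      _ ≤ _ := by rw [e3]; linarith

lemma sum_bins (b : ℕ → ℕ) (hb : Monotone b) (m : ℕ) (g : ℕ → ℝ) :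
    ∑ y ∈ Finset.Ico (b 0) (b m), g y =
      ∑ j ∈ Finset.range m, ∑ y ∈ Finset.Ico (b j) (b (j + 1)), g y := by
  induction m with
  | zero => simp
  | succ m ih =>
    rw [Finset.sum_range_succ, ← ih, Finset.sum_Ico_consecutive _ (hb (Nat.zero_le _)) (hb (by omega))]

lemma upper_main (n k m q : ℕ) (hn : 0 < n) (hk1 : 1 ≤ k) (hq : 0 < q) (b : ℕ → ℕ) (hb : Monotone b)
    (hb0 : b 0 = 1) (hbm : b m = k + 1)
    (hstep : ∀ j < m, b (j + 1) - b j ≤ 1 ∨ (b (j + 1) - b j) * q ≤ b j) :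
    minimaxRisk n k (Gk k) ≤ 8 * Real.sqrt (m / n) + 17 / q ^ 2 := by
  have hn' : (0:ℝ) < n := by exact_mod_cast hn
  have hIcc : Finset.Icc 1 k = Finset.Ico (b 0) (b m) := by
    rw [hb0, hbm]; ext y; simp
  apply minimax_le n k _ (by positivity) (fun x y => ∑ j ∈ Finset.range m,
    if y ∈ Finset.Ico (b j) (b (j + 1)) then fitT (b j) (b (j + 1) - b j) (emp n x) y else 0)
  intro f hf
  have hP0 : ∀ x : Fin n → ℕ, 0 ≤ ∏ i, f (x i) := fun x => Finset.prod_nonneg fun _ _ => hf.1 _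
  have hTV : ∀ x : Fin n → ℕ, TVk k (fun y => ∑ j ∈ Finset.range m,
      if y ∈ Finset.Ico (b j) (b (j + 1)) then fitT (b j) (b (j + 1) - b j) (emp n x) y else 0) f =
      (∑ j ∈ Finset.range m, ∑ y ∈ Finset.Ico (b j) (b j + (b (j + 1) - b j)),
        |fitT (b j) (b (j + 1) - b j) (emp n x) y - f y|) / 2 := by
    intro x
    unfold TVk
    rw [hIcc, sum_bins b hb]
    congr 1
    apply Finset.sum_congr rfl
    intro j hj
    rw [show b j + (b (j + 1) - b j) = b (j + 1) by have := hb (Nat.le_succ j); simp at this; omega]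
    apply Finset.sum_congr rfl
    intro y hy
    dsimp only
    rw [Finset.sum_eq_single j]
    · rw [if_pos hy]
    · intro i _ hij
      rw [if_neg]
      intro hy'
      simp only [Finset.mem_Ico] at hy hy'
      rcases lt_or_gt_of_ne hij with h | h
      · have : b (i + 1) ≤ b j := hb h
        omega
      · have : b (j + 1) ≤ b i := hb h
        omega
    · intro h; exact absurd hj h
  simp_rw [hTV, ← mul_div_assoc]
  rw [← Finset.sum_div]
  simp_rw [Finset.mul_sum (Finset.range m)]
  rw [Finset.sum_comm]
  have hbin : ∀ j ∈ Finset.range m, _ := fun j hj =>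
    bin_exp n k hn f hf (b j) (b (j + 1) - b j) q
    (by have := hb (Nat.zero_le j); omega)
    (by
      have h1 := hb (Nat.le_succ j)
      have h2 := hb (Nat.succ_le_of_lt (Finset.mem_range.1 hj))
      simp only [Nat.succ_eq_add_one] at h1 h2
      omega) hq (hstep j (Finset.mem_range.1 hj))
  have hsum := Finset.sum_le_sum hbin
  rw [Finset.sum_add_distrib, ← Finset.mul_sum, ← Finset.mul_sum, ← Finset.sum_div] at hsum
  have hre : ∀ g : ℕ → ℝ, ∑ j ∈ Finset.range m,
      ∑ y ∈ Finset.Ico (b j) (b j + (b (j + 1) - b j)), g y = ∑ y ∈ Finset.Icc 1 k, g y := by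
    intro g
    rw [hIcc, sum_bins b hb]
    apply Finset.sum_congr rfl
    intro j _
    rw [show b j + (b (j + 1) - b j) = b (j + 1) by have := hb (Nat.le_succ j); simp at this; omega]
  have hext0 : ∀ x, 0 ≤ exf k f x := fun x => hf.1 _
  have hab := abel2 (exf k f) (exf_mono k f hf) k hk1 hext0
  have hes : ∑ y ∈ Finset.Icc 1 k, exf k f y = 1 := by
    rw [← hf.2.2.1]
    apply Finset.sum_congr rfl
    intro y hy
    simp only [Finset.mem_Icc] at hy
    unfold exf; rw [min_eq_left hy.2]
  rw [hes, mul_one] at hab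
  rw [hre] at hsum
  have hcs : ∑ j ∈ Finset.range m,
      Real.sqrt ((∑ y ∈ Finset.Ico (b j) (b j + (b (j + 1) - b j)), f y) / n) ≤ Real.sqrt (m / n) := by
    apply Real.le_sqrt_of_sq_le
    refine (sq_sum_le_card_mul_sum_sq).trans (le_of_eq ?_)
    have : ∀ j, Real.sqrt ((∑ y ∈ Finset.Ico (b j) (b j + (b (j + 1) - b j)), f y) / n) ^ 2 =
        (∑ y ∈ Finset.Ico (b j) (b j + (b (j + 1) - b j)), f y) / n := fun j =>
      Real.sq_sqrt (div_nonneg (Finset.sum_nonneg fun y _ => hf.1 y) hn'.le)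
    simp_rw [this]
    rw [← Finset.sum_div, hre, hf.2.2.1, Finset.card_range]
    ring
  have hq2 : (∑ y ∈ Finset.Icc 1 k, (y:ℝ) ^ 2 *
        (slp (exf k f) y - slp (exf k f) (y + 1))) / (q:ℝ) ^ 2 ≤ 2 / (q:ℝ) ^ 2 := by gcongr
  have : (17:ℝ) / q ^ 2 = 17 * (2 / q ^ 2) / 2 := by ring
  rw [this]
  linarith

/-- breakpoints -/
def brk (q : ℕ) : ℕ → ℕ
  | 0 => 1
  | j + 1 => brk q j + max 1 (brk q j / q)

lemma brk_mono (q : ℕ) : Monotone (brk q) := by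
  apply monotone_nat_of_le_succ
  intro j
  simp [brk]

lemma brk_lin (q j i : ℕ) : brk q j + i * max 1 (brk q j / q) ≤ brk q (j + i) := by
  induction i with
  | zero => simp
  | succ i ih =>
    have h1 : max 1 (brk q j / q) ≤ max 1 (brk q (j + i) / q) := by
      have : brk q j ≤ brk q (j + i) := brk_mono q (by omega)
      gcongr
    rw [← add_assoc, brk]
    rw [add_mul, one_mul]
    omega

lemma brk_double (q j : ℕ) (hq : 0 < q) : 2 * brk q j ≤ brk q (j + 2 * q) := by
  have h := brk_lin q j (2 * q)
  have : brk q j ≤ 2 * q * max 1 (brk q j / q) := by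
    rcases Nat.lt_or_ge (brk q j) q with h' | h'
    · have : 1 ≤ max 1 (brk q j / q) := le_max_left _ _
      nlinarith
    · have h1 : brk q j / q ≤ max 1 (brk q j / q) := le_max_right _ _
      have h2 : 1 ≤ brk q j / q := (Nat.one_le_div_iff hq).2 h'
      have h3 : brk q j < q * (brk q j / q + 1) := by
        have := Nat.lt_mul_div_succ (brk q j) hq
        exact this
      nlinarith
  omega

lemma brk_large (q i : ℕ) (hq : 0 < q) : 2 ^ i * q ≤ brk q (q + i * (2 * q)) := by
  induction i with
  | zero =>
    have h := brk_lin q 0 q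
    have : 1 ≤ max 1 (brk q 0 / q) := le_max_left _ _
    simp
    simp at h
    nlinarith
  | succ i ih =>
    have := brk_double q (q + i * (2 * q)) hq
    rw [show q + (i + 1) * (2 * q) = q + i * (2 * q) + 2 * q by ring]
    rw [pow_succ]
    linarith

lemma upper_geo (n k q i : ℕ) (hn : 0 < n) (hk1 : 1 ≤ k) (hq : 0 < q) (hi : k + 1 ≤ 2 ^ i * q) :
    minimaxRisk n k (Gk k) ≤ 8 * Real.sqrt (((q + i * (2 * q) : ℕ) : ℝ) / n) + 17 / q ^ 2 := by
  apply upper_main n k _ q hn hk1 hq (fun j => min (brk q j) (k + 1))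
  · intro i j hij
    exact min_le_min_right _ (brk_mono q hij)
  · simp [brk]
  · have := brk_large q i hq
    exact min_eq_right (hi.trans this)
  · intro j _
    simp only [brk]
    rcases le_or_gt (brk q j / q) 1 with h | h
    · left
      rw [max_eq_left h]; omega
    · rw [max_eq_right h.le]
      rcases le_or_gt (k + 1) (brk q j) with h' | h'
      · left; omega
      · right
        rw [min_eq_left h'.le]
        have : min (brk q j + brk q j / q) (k + 1) - brk q j ≤ brk q j / q := by omega
        calc _ ≤ brk q j / q * q := Nat.mul_le_mul_right _ this
          _ ≤ brk q j := Nat.div_mul_le_self _ _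

lemma upper_simple (n k : ℕ) (hn : 0 < n) (hk1 : 1 ≤ k) :
    minimaxRisk n k (Gk k) ≤ 8 * Real.sqrt ((k : ℝ) / n) := by
  have hq : ∀ q : ℕ, 0 < q → minimaxRisk n k (Gk k) ≤ 8 * Real.sqrt ((k : ℝ) / n) + 17 / q ^ 2 := by
    intro q hq
    apply upper_main n k k q hn hk1 hq (fun j => j + 1)
    · intro i j hij; dsimp only; omega
    · rfl
    · rfl
    · intro j _; left; omega
  have ht : Filter.Tendsto (fun q : ℕ => 8 * Real.sqrt ((k : ℝ) / n) + 17 / (q:ℝ) ^ 2) Filter.atTop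
      (nhds (8 * Real.sqrt ((k : ℝ) / n) + 0)) := by
    apply Filter.Tendsto.const_add
    apply Filter.Tendsto.div_atTop tendsto_const_nhds
    exact (Filter.tendsto_pow_atTop (by norm_num)).comp tendsto_natCast_atTop_atTop
  rw [add_zero] at ht
  apply ge_of_tendsto ht
  filter_upwards [Filter.eventually_gt_atTop 0] with q h
  exact hq q h

lemma upper_triv (n k : ℕ) : minimaxRisk n k (Gk k) ≤ 1 := by
  apply minimax_le n k 1 (by norm_num) (fun _ _ => 0)
  intro f hf
  have : ∀ x : Fin n → ℕ, TVk k (fun _ => 0) f = 1 / 2 := by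
    intro x
    unfold TVk
    rw [← hf.2.2.1]
    congr 1
    apply Finset.sum_congr rfl
    intro y _
    rw [zero_sub, abs_neg, abs_of_nonneg (hf.1 y)]
  have h2 : TVk k (fun _ => 0) f = 1 / 2 := this (fun _ => 0)
  simp only [h2]
  rw [← Finset.sum_mul, expE_one n _ f hf.2.2.1]
  norm_num


lemma lower_min (k R B : ℕ) (hR : 0 < R) (hB : 0 < B) (hk : 6 * B * 2 ^ R ≤ k) (n : ℕ) (hn : 0 < n)
    (z : ℝ) (hz : 0 ≤ z) (h1 : z * B ^ 2 ≤ 1) (h2 : z ^ 2 ≤ (R : ℝ) * B / (16 * n)) :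
    z / 4608 ≤ minimaxRisk n k (Gk k) := by
  have hB' : (0:ℝ) < B := by exact_mod_cast hB
  have hn' : (0:ℝ) < n := by exact_mod_cast hn
  have h := lower_main k R B hR hB hk n hn (z * B ^ 2) (by positivity) h1 (by
    calc (z * (B:ℝ) ^ 2) ^ 2 = z ^ 2 * (B:ℝ) ^ 4 := by ring
      _ ≤ (R : ℝ) * B / (16 * n) * (B:ℝ) ^ 4 := by gcongr
      _ = _ := by ring)
  refine le_trans (le_of_eq ?_) h
  field_simp

lemma caseA (n k : ℕ) (hn : 0 < n) (hk : 2 ≤ k)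
    (hk5 : (k:ℝ) ^ 5 ≤ 243 * n) :
    Real.sqrt ((k:ℝ) / n) / 10 ^ 6 ≤ minimaxRisk n k (Gk k) := by
  have hn' : (0:ℝ) < n := by exact_mod_cast hn
  have hk' : (0:ℝ) < k := by positivity
  rcases Nat.lt_or_ge k 24 with h | h
  · refine le_trans ?_ (lower_two n k hn hk)
    rw [Real.sqrt_div hk'.le]
    have : Real.sqrt (k:ℝ) ≤ 5 := by
      rw [Real.sqrt_le_left (by norm_num)]
      have : (k:ℝ) < 24 := by exact_mod_cast h
      linarith
    have hs : 0 < Real.sqrt (n:ℝ) := Real.sqrt_pos.2 hn'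
    rw [div_div, div_le_div_iff₀ (by positivity) (by positivity)]
    nlinarith
  · have hB1 : 12 * (k / 12) ≤ k := Nat.mul_div_le k 12
    have hB2 : k ≤ 24 * (k / 12) := by omega
    set B := k / 12
    have hB0 : 0 < B := by omega
    have hB1' : 12 * (B:ℝ) ≤ k := by exact_mod_cast hB1
    have hB2' : (k:ℝ) ≤ 24 * B := by exact_mod_cast hB2
    have hB' : (0:ℝ) < B := by exact_mod_cast hB0
    have hB5 : (B:ℝ) ^ 5 ≤ n := by
      have : (12 * (B:ℝ)) ^ 5 ≤ 243 * n := le_trans (by gcongr) hk5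
      rw [mul_pow] at this
      nlinarith
    have hsq : Real.sqrt ((k:ℝ) / n) ^ 2 = k / n := Real.sq_sqrt (by positivity)
    have := lower_min k 1 B (by norm_num) hB0 (by omega) n hn (Real.sqrt ((k:ℝ) / n) / 20)
      (by positivity) (by
        have : (Real.sqrt ((k:ℝ) / n) / 20 * (B:ℝ)^2) ^ 2 ≤ 1 := by
          rw [mul_pow, div_pow, hsq]
          rw [div_div, div_mul_eq_mul_div, div_le_one (by positivity)]
          nlinarith [mul_le_mul_of_nonneg_right hB2' (by positivity : (0:ℝ) ≤ (B:ℝ) ^ 4)]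
        exact (sq_le_one_iff₀ (by positivity)).1 this) (by
        rw [div_pow, hsq, div_div, div_le_div_iff₀ (by positivity) (by positivity)]
        push_cast
        nlinarith [mul_le_mul_of_nonneg_right hB2' hn'.le])
    have h0 := Real.sqrt_nonneg ((k:ℝ) / n)
    linarith

lemma caseC (n k : ℕ) (hn : 0 < n) (hk : 12 * 3 ^ n ≤ k) :
    1 / 10 ^ 6 ≤ minimaxRisk n k (Gk k) := by
  have hn' : (0:ℝ) < n := by exact_mod_cast hn
  have h32 : 2 ^ n ≤ 3 ^ n := Nat.pow_le_pow_left (by norm_num) n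
  have := lower_min k n 1 hn (by norm_num) (by omega) n hn (1 / 4) (by norm_num) (by norm_num) (by
    push_cast
    rw [le_div_iff₀ (by positivity)]; linarith)
  linarith

/-- `s = n^{1/5}`, `k = s 3^L`, `y = (n/L)^{1/5}`. -/
lemma caseB (n k : ℕ) (hn : 0 < n) (L y s : ℝ) (hs : 12 ≤ s) (hL1 : 1 ≤ L) (hLn : L ≤ n)
    (hy : 1 ≤ y) (hys : y ≤ s) (hs5 : s ≤ y * L) (hk : (k:ℝ) = s * 3 ^ L) (hyn : y ^ 5 * L = n) :
    (1 / y ^ 2) / 10 ^ 7 ≤ minimaxRisk n k (Gk k) ∧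
      minimaxRisk n k (Gk k) ≤ 10 ^ 6 * (1 / y ^ 2) := by
  have hn' : (0:ℝ) < n := by exact_mod_cast hn
  have h23 : (2:ℝ) ^ L ≤ 3 ^ L := Real.rpow_le_rpow (by norm_num) (by norm_num) (by linarith)
  have h2p : (0:ℝ) < 2 ^ L := by positivity
  have h3p : (0:ℝ) < 3 ^ L := by positivity
  constructor
  · have hR1 : (⌊L⌋₊ : ℝ) ≤ L := Nat.floor_le (by linarith)
    have hR2 : L < ⌊L⌋₊ + 1 := Nat.lt_floor_add_one L
    have hR0 : 1 ≤ ⌊L⌋₊ := Nat.le_floor (by simpa using hL1)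
    set R := ⌊L⌋₊
    have hR0' : (1:ℝ) ≤ R := by exact_mod_cast hR0
    have h2R : (2:ℝ) ^ R ≤ 2 ^ L := by
      rw [← Real.rpow_natCast]
      exact Real.rpow_le_rpow_of_exponent_le (by norm_num) hR1
    obtain ⟨B, hB0, hBl, hBu, hB6⟩ : ∃ B : ℕ, 0 < B ∧ y / 16 ≤ B ∧ (B:ℝ) ≤ y ∧ 6 * (B:ℝ) ≤ s := by
      rcases le_or_gt y 16 with h | h
      · exact ⟨1, by norm_num, by push_cast; linarith, by push_cast; linarith, by push_cast; linarith⟩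
      · have a1 : (⌊y / 8⌋₊ : ℝ) ≤ y / 8 := Nat.floor_le (by linarith)
        have a2 : y / 8 < ⌊y / 8⌋₊ + 1 := Nat.lt_floor_add_one _
        refine ⟨⌊y / 8⌋₊, Nat.floor_pos.2 (by linarith), by linarith, by linarith, by linarith⟩
    have hB' : (0:ℝ) < B := by exact_mod_cast hB0
    have := lower_min k R B hR0 hB0 (by
      have : (6 * (B:ℝ) * 2 ^ R) ≤ k := by
        rw [hk]
        have := h2R.trans h23
        gcongr
      exact_mod_cast this) n hn (1 / y ^ 2 / 32) (by positivity) (by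
        rw [div_div, div_mul_eq_mul_div, div_le_one (by positivity)]
        nlinarith [mul_le_mul hBu hBu hB'.le (by linarith)]) (by
        rw [← hyn]
        have hRB : L / 2 * (y / 16) ≤ R * B := by
          apply mul_le_mul (by linarith) hBl (by positivity) (by positivity)
        calc (1 / y ^ 2 / 32) ^ 2 = (L / 2 * (y / 16)) / (32 * (y ^ 5 * L)) := by
              field_simp
              norm_num
          _ ≤ (L / 2 * (y / 16)) / (16 * (y ^ 5 * L)) := by
              gcongr
              norm_num
          _ ≤ _ := by gcongr)
    have h0 : 0 ≤ 1 / y ^ 2 := by positivity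
    linarith
  · have q1 : y ≤ ⌈y⌉₊ := Nat.le_ceil y
    have q2 : (⌈y⌉₊ : ℝ) < y + 1 := Nat.ceil_lt_add_one (by linarith)
    set q := ⌈y⌉₊
    have hq0 : 0 < q := Nat.ceil_pos.2 (by linarith)
    have i1 : 4 * L ≤ ⌈4 * L⌉₊ := Nat.le_ceil _
    have i2 : (⌈4 * L⌉₊ : ℝ) < 4 * L + 1 := Nat.ceil_lt_add_one (by linarith)
    set i := ⌈4 * L⌉₊
    have hL3 : L ≤ 3 ^ L := by
      have := one_add_mul_self_le_rpow_one_add (s := 2) (by norm_num) hL1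
      norm_num at this
      linarith
    have h916 : (3:ℝ) ^ L * 3 ^ L ≤ 2 ^ i := by
      calc (3:ℝ) ^ L * 3 ^ L = 9 ^ L := by
            rw [← Real.mul_rpow (by norm_num) (by norm_num)]; norm_num
        _ ≤ 16 ^ L := Real.rpow_le_rpow (by norm_num) (by norm_num) (by linarith)
        _ = 2 ^ (4 * L) := by
            rw [Real.rpow_mul (by norm_num)]; norm_num
        _ ≤ (2:ℝ) ^ ((i:ℕ):ℝ) := Real.rpow_le_rpow_of_exponent_le (by norm_num) i1
        _ = _ := Real.rpow_natCast _ _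
    have hk1 : 1 ≤ k := by
      have : (0:ℝ) < k := by rw [hk]; positivity
      exact_mod_cast this
    have hki : (k:ℝ) ≤ 2 ^ i * q := by
      rw [hk]
      calc s * 3 ^ L ≤ (y * 3 ^ L) * 3 ^ L := by
            gcongr
            exact hs5.trans (by gcongr)
        _ = (3 ^ L * 3 ^ L) * y := by ring
        _ ≤ _ := by gcongr
    have hki' : k ≤ 2 ^ i * q := by exact_mod_cast hki
    refine (upper_geo n k q (i + 1) hn hk1 hq0 (by rw [pow_succ]; linarith)).trans ?_
    have hm : (((q + (i + 1) * (2 * q) : ℕ) : ℝ)) / n ≤ (6 / y ^ 2) ^ 2 := by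
      have : (((q + (i + 1) * (2 * q) : ℕ) : ℝ)) ≤ 36 * (y * L) := by
        push_cast
        have : (q:ℝ) + (i + 1) * (2 * q) = q * (2 * i + 3) := by ring
        rw [this]
        calc (q:ℝ) * (2 * i + 3) ≤ (2 * y) * (13 * L) := by
              apply mul_le_mul (by linarith) (by linarith) (by positivity) (by positivity)
          _ ≤ _ := by nlinarith [mul_nonneg (by linarith : 0 ≤ y) (by linarith : 0 ≤ L)]
      rw [← hyn]
      calc _ ≤ 36 * (y * L) / (y ^ 5 * L) := by gcongr
        _ = _ := by field_simp; norm_num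
    have hsq : Real.sqrt ((((q + (i + 1) * (2 * q) : ℕ) : ℝ)) / n) ≤ 6 / y ^ 2 := by
      apply (Real.sqrt_le_left (by positivity)).2 hm
    have h17 : 17 / (q:ℝ) ^ 2 ≤ 17 / y ^ 2 := by gcongr
    have h0 : 0 ≤ 1 / y ^ 2 := by positivity
    have e1 : 6 / y ^ 2 = 6 * (1 / y ^ 2) := by ring
    have e2 : 17 / y ^ 2 = 17 * (1 / y ^ 2) := by ring
    linarith

theorem stmt1 :
    ∃ C : ℝ, 1 ≤ C ∧ ∃ N : ℕ, ∀ n : ℕ, N ≤ n → ∀ k : ℕ, 2 ≤ k →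
      rateG n k / C ≤ minimaxRisk n k (Gk k) ∧ minimaxRisk n k (Gk k) ≤ C * rateG n k := by
  refine ⟨10 ^ 7, by norm_num, 12 ^ 5, ?_⟩
  intro n hN k hk
  have hn : 0 < n := lt_of_lt_of_le (by norm_num) hN
  have hn' : (0:ℝ) < n := by exact_mod_cast hn
  have hN' : (12:ℝ) ^ 5 ≤ n := by exact_mod_cast hN
  have hs5 : ((n:ℝ) ^ ((1:ℝ) / 5)) ^ 5 = n := by
    rw [← Real.rpow_natCast, ← Real.rpow_mul hn'.le]; norm_num
  have hs12 : 12 ≤ (n:ℝ) ^ ((1:ℝ) / 5) := by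
    by_contra h
    push Not at h
    have : ((n:ℝ) ^ ((1:ℝ) / 5)) ^ 5 < 12 ^ 5 := by gcongr
    linarith
  unfold rateG
  set s := (n:ℝ) ^ ((1:ℝ) / 5) with hs
  have hk' : (2:ℝ) ≤ k := by exact_mod_cast hk
  split_ifs with hA hB
  · have h0 := Real.sqrt_nonneg ((k:ℝ) / n)
    constructor
    · have := caseA n k hn hk (by
        calc (k:ℝ) ^ 5 ≤ (3 * s) ^ 5 := by gcongr
          _ = 243 * (n:ℝ) := by rw [mul_pow, hs5]; norm_num)
      linarith
    · have := upper_simple n k hn (by omega)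
      linarith
  · push Not at hA
    have hs0 : 0 < s := by linarith
    set L := Real.logb 3 ((k:ℝ) / s) with hL
    have hkL : (3:ℝ) ^ L = k / s := Real.rpow_logb (by norm_num) (by norm_num) (by positivity)
    have hL1 : 1 ≤ L := by
      rw [hL, Real.le_logb_iff_rpow_le (by norm_num) (by positivity), Real.rpow_one,
        le_div_iff₀ hs0]
      exact hA
    have hLn : L ≤ n := by
      rw [hL, Real.logb_le_iff_le_rpow (by norm_num) (by positivity), Real.rpow_natCast,
        div_le_iff₀ hs0]
      linarith
    have hL0 : 0 < L := by linarith
    have hy5 : (((n:ℝ) / L) ^ ((1:ℝ) / 5)) ^ 5 = n / L := by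
      rw [← Real.rpow_natCast, ← Real.rpow_mul (by positivity)]; norm_num
    have hy1 : 1 ≤ ((n:ℝ) / L) ^ ((1:ℝ) / 5) :=
      Real.one_le_rpow ((one_le_div hL0).2 hLn) (by norm_num)
    have hrate : (L / n) ^ ((2:ℝ) / 5) = 1 / (((n:ℝ) / L) ^ ((1:ℝ) / 5)) ^ 2 := by
      rw [← Real.rpow_natCast, ← Real.rpow_mul (by positivity), one_div,
        ← Real.inv_rpow (by positivity), inv_div]
      norm_num
    rw [hrate]
    set y := ((n:ℝ) / L) ^ ((1:ℝ) / 5) with hy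
    have hys : y ≤ s := by
      apply Real.rpow_le_rpow (by positivity) _ (by norm_num)
      exact div_le_self hn'.le hL1
    have hyn : y ^ 5 * L = n := by rw [hy5]; field_simp
    have hsyL : s ≤ y * L := by
      by_contra h
      push Not at h
      have h1 : (y * L) ^ 5 < s ^ 5 := by gcongr
      rw [hs5, mul_pow] at h1
      have h2 : L ≤ L ^ 5 := le_self_pow₀ hL1 (by norm_num)
      have h3 : y ^ 5 * L ≤ y ^ 5 * L ^ 5 := by gcongr
      linarith
    obtain ⟨g1, g2⟩ := caseB n k hn L y s hs12 hL1 hLn hy1 hys hsyL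
      (by rw [hkL]; field_simp) hyn
    have h0 : 0 ≤ 1 / y ^ 2 := by positivity
    exact ⟨g1, by linarith⟩
  · push Not at hB
    constructor
    · have := caseC n k hn (by
        have h : (12:ℝ) * 3 ^ n ≤ k := le_trans (by gcongr) hB
        exact_mod_cast h)
      linarith
    · have := upper_triv n k
      linarith
end
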